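/- arXiv:2004.12561 — 3 statements merged into one kernel-verified Lean document; each statement's English description precedes it below -/
import Mathlib

section
/- For every integer k ≥ 2 there exists n₀ = n₀(k) such that for all integers n ≥ n₀ and t ≥ 1 with n > 2kt the following holds: if F_1, …, F_t ⊆ C([n],k) satisfy |F_i| > C(n,k) − C(n−t+1,k) for every i ∈ [t], then the family {F_1, …, F_t} admits a rainbow matching. -/
namespace RainbowMatching

open Finset
open scoped FinsetFamily

/-- A family of finite sets of natural numbers is shifted above `a` if replacing an element of a
member by a smaller element that is at least `a` gives a member again. -/
def Shifted (a : ℕ) (F : Finset (Finset ℕ)) : Prop :=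
  ∀ e ∈ F, ∀ x ∈ e, ∀ y ∉ e, a ≤ y → y < x → insert y (e.erase x) ∈ F

/-- A choice of pairwise disjoint members, one from each family. -/
def HasRainbowMatching {ι α : Type*} (F : ι → Finset (Finset α)) : Prop :=
  ∃ e : ι → Finset α, (∀ i, e i ∈ F i) ∧ ∀ i j, i ≠ j → Disjoint (e i) (e j)

theorem Shifted.image_mem {a : ℕ} {F : Finset (Finset ℕ)} (hF : Shifted a F) {e : Finset ℕ}
    (he : e ∈ F) {φ : ℕ → ℕ} (hinj : Set.InjOn φ e) (hφ : ∀ x ∈ e, a ≤ φ x ∧ φ x ≤ x) :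
    e.image φ ∈ F := by
  induction hN : ∑ x ∈ e, x using Nat.strong_induction_on generalizing e φ with
  | _ N ih =>
    by_cases hfix : ∀ x ∈ e, φ x = x
    · have : e.image φ = e := by
        ext y
        simp only [mem_image]
        exact ⟨fun ⟨x, hx, h⟩ => h ▸ (hfix x hx).symm ▸ hx, fun hy => ⟨y, hy, hfix y hy⟩⟩
      rwa [this]
    · push Not at hfix
      have hne : (e.filter fun x => φ x ≠ x).Nonempty := by
        obtain ⟨x, hx, h⟩ := hfix
        exact ⟨x, by simp [hx, h]⟩
      obtain ⟨x, hx, hmin⟩ := exists_min_image _ id hne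
      simp only [mem_filter, id] at hx hmin
      obtain ⟨hxe, hxφ⟩ := hx
      have hlt : φ x < x := lt_of_le_of_ne (hφ x hxe).2 hxφ
      have hye : φ x ∉ e := by
        intro hy
        by_cases h : φ (φ x) = φ x
        · exact hxφ (hinj hy hxe h)
        · exact absurd (hmin _ ⟨hy, h⟩) (by omega)
      have hmem := hF e he x hxe (φ x) hye (hφ x hxe).1 hlt
      have hsum : ∑ z ∈ insert (φ x) (e.erase x), z < N := by
        rw [sum_insert (by simp [hye]), ← hN, ← add_sum_erase e (fun z => z) hxe]
        omega
      have hy2 : ∀ z ∈ e.erase x, z ≠ φ x := by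
        intro z hz h
        exact hye (h ▸ (mem_of_mem_erase hz))
      have key := ih _ hsum (e := insert (φ x) (e.erase x)) (φ := fun z => if z = φ x then φ x else φ z)
        hmem ?_ ?_ rfl
      · convert key using 1
        ext w
        simp only [mem_image, mem_insert, mem_erase]
        constructor
        · rintro ⟨z, hz, rfl⟩
          by_cases hzx : z = x
          · exact ⟨φ x, Or.inl rfl, by simp [hzx]⟩
          · exact ⟨z, Or.inr ⟨hzx, hz⟩, by rw [if_neg (hy2 z (by simp [hzx, hz]))]⟩
        · rintro ⟨z, rfl | ⟨hzx, hz⟩, rfl⟩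
          · exact ⟨x, hxe, by simp⟩
          · exact ⟨z, hz, by rw [if_neg (hy2 z (by simp [hzx, hz]))]⟩
      · intro z hz w hw h
        simp only [coe_insert, Set.mem_insert_iff, mem_coe] at hz hw
        rcases hz with rfl | hz <;> rcases hw with rfl | hw
        · rfl
        · simp only [if_true, if_neg (hy2 w hw)] at h
          exact absurd (hinj hxe (mem_of_mem_erase hw) h) (ne_of_mem_erase hw).symm
        · simp only [if_true, if_neg (hy2 z hz)] at h
          exact absurd (hinj (mem_of_mem_erase hz) hxe h) (ne_of_mem_erase hz)
        · simp only [if_neg (hy2 w hw), if_neg (hy2 z hz)] at h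
          exact hinj (mem_of_mem_erase hz) (mem_of_mem_erase hw) h
      · intro z hz
        rcases mem_insert.1 hz with rfl | hz
        · simp [(hφ x hxe).1]
        · simp only [if_neg (hy2 z hz)]
          exact hφ z (mem_of_mem_erase hz)

/-- Hall's theorem for the nested sets `{q ∈ A | q ≤ x i}`. -/
theorem exists_injOn_le {ι : Type*} (I : Finset ι) (x : ι → ℕ) (A : Finset ℕ)
    (h : ∀ i ∈ I, #{j ∈ I | x j ≤ x i} ≤ #{q ∈ A | q ≤ x i}) :
    ∃ φ : ι → ℕ, Set.InjOn φ I ∧ ∀ i ∈ I, φ i ∈ A ∧ φ i ≤ x i := by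
  classical
  have hall := (Finset.all_card_le_biUnion_card_iff_exists_injective
    (fun i : I => {q ∈ A | q ≤ x i})).1 (by
      intro S
      rcases S.eq_empty_or_nonempty with rfl | hS
      · simp
      obtain ⟨m, hm, hmax⟩ := exists_max_image S (fun i => x i) hS
      calc #S = #(S.map (Function.Embedding.subtype _)) := (card_map _).symm
        _ ≤ #{j ∈ I | x j ≤ x m} := by
            apply card_le_card
            intro j hj
            simp only [mem_map, Function.Embedding.subtype_apply] at hj
            obtain ⟨j', hj', rfl⟩ := hj
            exact mem_filter.2 ⟨j'.2, hmax _ hj'⟩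
        _ ≤ #{q ∈ A | q ≤ x m} := h m m.2
        _ ≤ _ := card_le_card (subset_biUnion_of_mem
            (fun i : I => {q ∈ A | q ≤ x i}) hm))
  obtain ⟨f, hf, hfm⟩ := hall
  refine ⟨fun i => if hi : i ∈ I then f ⟨i, hi⟩ else 0, ?_, ?_⟩
  · intro i hi j hj hij
    simp only [mem_coe] at hi hj
    simp only [hi, hj, dif_pos] at hij
    simpa using hf hij
  · intro i hi
    simpa [hi] using hfm ⟨i, hi⟩

theorem Shifted.exists_disjoint {F : Finset (Finset ℕ)} (hF : Shifted 0 F) {e X : Finset ℕ}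
    (he : e ∈ F) (h0 : 0 ∉ X) (hX : #(e ∩ range (#X + 1)) ≤ 1) :
    ∃ e' ∈ F, Disjoint e' X := by
  obtain ⟨φ, hinj, hφ⟩ := exists_injOn_le e id (range (e.sup id + 1) \ X) (by
    intro p hp
    simp only [id]
    have hpe : p ≤ e.sup id := le_sup (f := id) hp
    have hset : {q ∈ range (e.sup id + 1) \ X | q ≤ p} = range (p + 1) \ X := by
      ext q; simp only [mem_filter, mem_sdiff, mem_range]; 
      constructor
      · rintro ⟨⟨_, h⟩, h'⟩; exact ⟨by omega, h⟩
      · rintro ⟨h, h'⟩; exact ⟨⟨by omega, h'⟩, by omega⟩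
    rw [hset]
    have hlow : 1 ≤ #(range (p + 1) \ X) := card_pos.2 ⟨0, by simp [h0]⟩
    have hlow' : p + 1 ≤ #(range (p + 1) \ X) + #X := by
      have := card_le_card_sdiff_add_card (s := range (p + 1)) (t := X)
      simpa using this
    have hup : #{j ∈ e | j ≤ p} ≤ #(e ∩ range (#X + 1)) + #(Ico (#X + 1) (p + 1)) := by
      refine (card_le_card ?_).trans (card_union_le _ _)
      intro j hj
      simp only [mem_filter, mem_union, mem_inter, mem_range, mem_Ico] at hj ⊢
      by_cases h : j < #X + 1
      · exact Or.inl ⟨hj.1, h⟩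
      · exact Or.inr ⟨by omega, by omega⟩
    rw [Nat.card_Ico] at hup
    omega)
  refine ⟨e.image φ, hF.image_mem he hinj fun x hx => ⟨Nat.zero_le _, (hφ x hx).2⟩, ?_⟩
  rw [disjoint_left]
  intro y hy
  obtain ⟨x, hx, rfl⟩ := mem_image.1 hy
  exact (mem_sdiff.1 (hφ x hx).1).2

open scoped FinsetFamily

theorem card_mul_le_card_shadow_mul {k : ℕ} {Y : Finset ℕ} {F : Finset (Finset ℕ)}
    (hF : F ⊆ Y.powersetCard k) : #F * k ≤ #(∂ F) * (#Y + 1 - k) := by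
  classical
  refine card_mul_le_card_mul (fun e B => B ⊆ e) ?_ ?_
  · intro e he
    obtain ⟨heY, hek⟩ := mem_powersetCard.1 (hF he)
    calc k = #(e.image e.erase) := by
          rw [card_image_of_injOn (fun x hx y hy h => (erase_inj e hx).1 h), hek]
      _ ≤ _ := by
          apply card_le_card
          intro B hB
          obtain ⟨x, hx, rfl⟩ := mem_image.1 hB
          exact mem_filter.2 ⟨erase_mem_shadow he hx, erase_subset _ _⟩
  · intro B hB
    obtain ⟨e, he, x, hx, rfl⟩ := mem_shadow_iff.1 hB
    obtain ⟨heY, hek⟩ := mem_powersetCard.1 (hF he)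
    have hpos : 0 < #e := card_pos.2 ⟨x, hx⟩
    have hBcard : #(e.erase x) = k - 1 := by rw [card_erase_of_mem hx, hek]
    calc _ ≤ #((Y \ e.erase x).image fun y => insert y (e.erase x)) := by
          apply card_le_card
          intro f hf
          obtain ⟨hf, hsub⟩ := mem_filter.1 hf
          obtain ⟨hfY, hfk⟩ := mem_powersetCard.1 (hF hf)
          obtain ⟨y, hy⟩ : ∃ y, f \ e.erase x = {y} := card_eq_one.1 (by
            rw [card_sdiff_of_subset hsub]; omega)
          have hyf : y ∈ f \ e.erase x := by simp [hy]
          refine mem_image.2 ⟨y, ?_, ?_⟩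
          · exact mem_sdiff.2 ⟨hfY (mem_sdiff.1 hyf).1, (mem_sdiff.1 hyf).2⟩
          · rw [insert_eq, ← hy, sdiff_union_of_subset hsub]
      _ ≤ #(Y \ e.erase x) := card_image_le
      _ = #Y + 1 - k := by
          rw [card_sdiff_of_subset ((erase_subset _ _).trans heY), hBcard]; omega

theorem not_hasRainbowMatching_memberSubfamily {a N k s : ℕ} {F : Finset (Finset ℕ)}
    (hsh : Shifted a F) (hF : F ⊆ (Ico a (a + (N + 1))).powersetCard (k + 1))
    (hN : (k + 1) * (s + 1) ≤ N + 1)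
    (hno : ¬ HasRainbowMatching fun _ : Fin (s + 1) => F) :
    ¬ HasRainbowMatching fun _ : Fin (s + 1) => F.memberSubfamily (a + N) := by
  rintro ⟨f, hf, hdisj⟩
  apply hno
  have hf' := fun i => mem_memberSubfamily.1 (hf i)
  have hcard : ∀ i, #(f i) = k := fun i => by
    have := (mem_powersetCard.1 (hF (hf' i).1)).2
    rw [card_insert_of_notMem (hf' i).2] at this
    omega
  set W := univ.biUnion f with hW
  have hWcard : #W ≤ (s + 1) * k := by
    refine card_biUnion_le.trans ?_
    simp [hcard]
  have hrest : s + 1 ≤ #(Ico a (a + (N + 1)) \ W) := by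
    have := le_card_sdiff W (Ico a (a + (N + 1)))
    rw [Nat.card_Ico] at this
    have h2 : (k + 1) * (s + 1) = (s + 1) * k + (s + 1) := by ring
    omega
  obtain ⟨R, hR, hRc⟩ := exists_subset_card_eq hrest
  let g := R.orderEmbOfFin hRc
  have hg : ∀ i, g i ∈ Ico a (a + (N + 1)) ∧ g i ∉ W := fun i =>
    mem_sdiff.1 (hR (orderEmbOfFin_mem R hRc i))
  have hgf : ∀ i j, g i ∉ f j := fun i j h =>
    (hg i).2 (mem_biUnion.2 ⟨j, mem_univ _, h⟩)
  refine ⟨fun i => insert (g i) (f i), fun i => ?_, fun i j hij => ?_⟩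
  · obtain ⟨hins, hnot⟩ := hf' i
    rcases eq_or_ne (g i) (a + N) with h | h
    · simpa only [h] using hins
    · have hlt : g i < a + N := by
        have := mem_Ico.1 (hg i).1
        omega
      have := hsh _ hins (a + N) (mem_insert_self _ _) (g i)
        (by simp [h, hgf i i]) (mem_Ico.1 (hg i).1).1 hlt
      rwa [erase_insert hnot] at this
  · simp only [disjoint_insert_left, disjoint_insert_right, mem_insert, not_or]
    exact ⟨⟨fun h => hij (g.injective h).symm, hgf j i⟩, hgf i j, hdisj i j hij⟩

theorem card_shadow_subfamilies_le (a : ℕ) (F : Finset (Finset ℕ)) :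
    #(∂ (F.nonMemberSubfamily a)) + #(∂ (F.memberSubfamily a)) ≤ #(∂ F) := by
  classical
  have hnot : ∀ B ∈ ∂ (F.memberSubfamily a), a ∉ B := by
    intro B hB
    obtain ⟨e, he, hBe⟩ := exists_subset_of_mem_shadow hB
    exact fun h => (mem_memberSubfamily.1 he).2 (hBe h)
  rw [← card_image_of_injOn (f := insert a) (s := ∂ (F.memberSubfamily a))
    (fun B hB C hC h => by
      rw [← erase_insert (hnot B hB), ← erase_insert (hnot C hC)]
      exact congrArg (fun s => erase s a) h),
    ← card_union_of_disjoint]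
  · apply card_le_card
    refine union_subset (shadow_mono (filter_subset _ _)) ?_
    intro B hB
    obtain ⟨C, hC, rfl⟩ := mem_image.1 hB
    have hCa := hnot C hC
    obtain ⟨x, hx, hins⟩ := mem_shadow_iff_insert_mem.1 hC
    obtain ⟨hmem, hna⟩ := mem_memberSubfamily.1 hins
    rw [mem_shadow_iff_insert_mem]
    refine ⟨x, ?_, by rwa [insert_comm]⟩
    simp only [mem_insert, not_or] at hna ⊢
    exact ⟨Ne.symm hna.1, hx⟩
  · rw [disjoint_left]
    intro B hB hB'
    obtain ⟨e, he, hBe⟩ := exists_subset_of_mem_shadow hB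
    obtain ⟨C, _, rfl⟩ := mem_image.1 hB'
    exact (mem_nonMemberSubfamily.1 he).2 (hBe (mem_insert_self _ _))

/-- Frankl's bound: a shifted family without `s + 1` pairwise disjoint members has at most `s` times
as many members as its shadow. -/
theorem card_le_mul_card_shadow {a s : ℕ} (N : ℕ) {k : ℕ} {F : Finset (Finset ℕ)}
    (hsh : Shifted a F) (hF : F ⊆ (Ico a (a + N)).powersetCard (k + 1))
    (hno : ¬ HasRainbowMatching fun _ : Fin (s + 1) => F) : #F ≤ s * #(∂ F) := by
  classical
  induction N generalizing k F with
  | zero =>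
    have : F = ∅ := by
      have h : (Ico a (a + 0)).powersetCard (k + 1) = ∅ := powersetCard_eq_empty.2 (by simp)
      exact subset_empty.1 (h ▸ hF)
    simp [this]
  | succ N ih =>
    rcases lt_or_ge (N + 1) ((k + 1) * (s + 1)) with hN | hN
    · have h := card_mul_le_card_shadow_mul hF
      rw [Nat.card_Ico, show a + (N + 1) - a = N + 1 by omega] at h
      have h2 : N + 1 + 1 - (k + 1) ≤ s * (k + 1) := by
        have : (k + 1) * (s + 1) = s * (k + 1) + (k + 1) := by ring
        omega
      refine Nat.le_of_mul_le_mul_right (h.trans ?_) (Nat.succ_pos k)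
      calc _ ≤ #(∂ F) * (s * (k + 1)) := Nat.mul_le_mul_left _ h2
        _ = s * #(∂ F) * (k + 1) := by ring
    rcases k with _ | k
    · rcases F.eq_empty_or_nonempty with rfl | ⟨e, he⟩
      · simp
      have hpos : 0 < #(∂ F) := by
        obtain ⟨x, rfl⟩ := card_eq_one.1 (mem_powersetCard.1 (hF he)).2
        exact card_pos.2 ⟨_, erase_mem_shadow he (mem_singleton_self x)⟩
      refine le_trans ?_ (Nat.le_mul_of_pos_right s hpos)
      by_contra hlt
      push Not at hlt
      apply hno
      obtain ⟨R, hR, hRc⟩ := exists_subset_card_eq (Nat.succ_le_of_lt hlt)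
      let g := (R.equivFinOfCardEq hRc).symm
      refine ⟨fun i => g i, fun i => hR (g i).2, fun i j hij => ?_⟩
      obtain ⟨x, hx⟩ := card_eq_one.1 (mem_powersetCard.1 (hF (hR (g i).2))).2
      obtain ⟨y, hy⟩ := card_eq_one.1 (mem_powersetCard.1 (hF (hR (g j).2))).2
      simp only [hx, hy, disjoint_singleton]
      rintro rfl
      exact hij (g.injective (Subtype.ext (hx.trans hy.symm)))
    · have hno1 := not_hasRainbowMatching_memberSubfamily hsh hF hN hno
      have hF1 : F.memberSubfamily (a + N) ⊆ (Ico a (a + N)).powersetCard (k + 1) := by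
        intro e he
        obtain ⟨hins, hnot⟩ := mem_memberSubfamily.1 he
        obtain ⟨hsub, hc⟩ := mem_powersetCard.1 (hF hins)
        rw [card_insert_of_notMem hnot] at hc
        refine mem_powersetCard.2 ⟨fun x hx => ?_, by omega⟩
        have h1 := mem_Ico.1 (hsub (mem_insert_of_mem hx))
        have h2 : x ≠ a + N := fun h => hnot (h ▸ hx)
        exact mem_Ico.2 ⟨h1.1, by omega⟩
      have hsh1 : Shifted a (F.memberSubfamily (a + N)) := by
        intro e he x hx y hy hay hyx
        obtain ⟨hins, hnot⟩ := mem_memberSubfamily.1 he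
        have hxN : x < a + N := (mem_Ico.1 ((mem_powersetCard.1 (hF1 he)).1 hx)).2
        have := hsh _ hins x (mem_insert_of_mem hx) y
          (by simp only [mem_insert, not_or]; exact ⟨by omega, hy⟩) hay hyx
        rw [erase_insert_of_ne (by omega), insert_comm] at this
        refine mem_memberSubfamily.2 ⟨this, ?_⟩
        simp only [mem_insert, mem_erase, not_or, not_and]
        exact ⟨by omega, fun _ => hnot⟩
      have hF0 : F.nonMemberSubfamily (a + N) ⊆ (Ico a (a + N)).powersetCard (k + 1 + 1) := by
        intro e he
        obtain ⟨hins, hnot⟩ := mem_nonMemberSubfamily.1 he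
        obtain ⟨hsub, hc⟩ := mem_powersetCard.1 (hF hins)
        refine mem_powersetCard.2 ⟨fun x hx => ?_, hc⟩
        have h1 := mem_Ico.1 (hsub hx)
        have h2 : x ≠ a + N := fun h => hnot (h ▸ hx)
        exact mem_Ico.2 ⟨h1.1, by omega⟩
      have hsh0 : Shifted a (F.nonMemberSubfamily (a + N)) := by
        intro e he x hx y hy hay hyx
        obtain ⟨hins, hnot⟩ := mem_nonMemberSubfamily.1 he
        have hxN : x < a + N := (mem_Ico.1 ((mem_powersetCard.1 (hF0 he)).1 hx)).2
        refine mem_nonMemberSubfamily.2 ⟨hsh _ hins x hx y hy hay hyx, ?_⟩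
        simp only [mem_insert, mem_erase, not_or, not_and]
        exact ⟨by omega, fun _ => hnot⟩
      have hno0 : ¬ HasRainbowMatching fun _ : Fin (s + 1) => F.nonMemberSubfamily (a + N) :=
        fun ⟨f, hf, hd⟩ => hno ⟨f, fun i => (mem_nonMemberSubfamily.1 (hf i)).1, hd⟩
      calc #F = #(F.memberSubfamily (a + N)) + #(F.nonMemberSubfamily (a + N)) :=
            (card_memberSubfamily_add_card_nonMemberSubfamily _ _).symm
        _ ≤ s * #(∂ (F.memberSubfamily (a + N))) + s * #(∂ (F.nonMemberSubfamily (a + N))) :=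
            add_le_add (ih hsh1 hF1 hno1) (ih hsh0 hF0 hno0)
        _ = s * (#(∂ (F.nonMemberSubfamily (a + N))) + #(∂ (F.memberSubfamily (a + N)))) := by
            ring
        _ ≤ _ := Nat.mul_le_mul_left _ (card_shadow_subfamilies_le _ _)

theorem exists_perm_map_eq {α : Type*} [Fintype α] [DecidableEq α] {B C : Finset α}
    (h : #B = #C) : ∃ σ : Equiv.Perm α, B.map σ.toEmbedding = C := by
  have hc : Fintype.card {x // x ∈ B} = Fintype.card {x // x ∈ C} := by simpa using h
  let e : {x // x ∈ B} ≃ {x // x ∈ C} := Fintype.equivOfCardEq hc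
  refine ⟨e.extendSubtype, eq_of_subset_of_card_le ?_ (by simp [h])⟩
  intro y hy
  obtain ⟨x, hx, rfl⟩ := mem_map.1 hy
  exact e.extendSubtype_mem x hx

/-- The number of permutations that move a given `l`-set into a family `G` of `l`-sets is
proportional to the size of `G`. -/
theorem exists_card_perm_map_mem {α : Type*} [Fintype α] [DecidableEq α] (l : ℕ)
    (hl : l ≤ Fintype.card α) :
    ∃ c : ℕ, 0 < c ∧ Fintype.card (Equiv.Perm α) = c * (Fintype.card α).choose l ∧
      ∀ B : Finset α, #B = l → ∀ G ⊆ (univ : Finset α).powersetCard l,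
        #{π : Equiv.Perm α | B.map π.toEmbedding ∈ G} = c * #G := by
  obtain ⟨B₀, -, hB₀⟩ := exists_subset_card_eq (s := (univ : Finset α)) (n := l) (by simpa using hl)
  set c := #{π : Equiv.Perm α | B₀.map π.toEmbedding = B₀} with hc
  have hconst : ∀ B C : Finset α, #B = l → #C = l →
      #{π : Equiv.Perm α | B.map π.toEmbedding = C} = c := by
    intro B C hB hC
    obtain ⟨σ, hσ⟩ := exists_perm_map_eq (hB₀.trans hB.symm)
    obtain ⟨τ, hτ⟩ := exists_perm_map_eq (hC.trans hB₀.symm)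
    refine card_bij' (fun π _ => τ * π * σ) (fun π _ => τ⁻¹ * π * σ⁻¹) ?_ ?_ ?_ ?_
    · intro π hπ
      simp only [mem_filter, mem_univ, true_and] at hπ ⊢
      have : (τ * π * σ).toEmbedding = (σ.toEmbedding.trans π.toEmbedding).trans τ.toEmbedding := by
        ext; rfl
      rw [this, ← map_map, ← map_map, hσ, hπ, hτ]
    · intro π hπ
      simp only [mem_filter, mem_univ, true_and] at hπ ⊢
      have : (τ⁻¹ * π * σ⁻¹).toEmbedding =
          (σ.symm.toEmbedding.trans π.toEmbedding).trans τ.symm.toEmbedding := by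
        ext; rfl
      rw [this, ← map_map, ← map_map, ← hσ, map_map _ _ B₀]
      have hid : σ.toEmbedding.trans σ.symm.toEmbedding = Function.Embedding.refl α := by
        ext; simp
      have hid' : τ.toEmbedding.trans τ.symm.toEmbedding = Function.Embedding.refl α := by
        ext; simp
      rw [hid, map_refl, hπ, ← hτ, map_map _ _ C, hid', map_refl]
    · intro π _
      group
    · intro π _
      group
  have hcount : ∀ B : Finset α, #B = l → ∀ G ⊆ (univ : Finset α).powersetCard l,
      #{π : Equiv.Perm α | B.map π.toEmbedding ∈ G} = c * #G := by
    intro B hB G hG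
    rw [card_eq_sum_card_fiberwise (s := {π : Equiv.Perm α | B.map π.toEmbedding ∈ G})
      (f := fun π : Equiv.Perm α => B.map π.toEmbedding) (t := G) (fun π hπ => (mem_filter.1 (mem_coe.1 hπ)).2)]
    rw [sum_congr rfl (g := fun _ => c), sum_const, smul_eq_mul, mul_comm]
    intro C hC
    rw [← hconst B C hB (mem_powersetCard.1 (hG hC)).2, filter_filter]
    congr 1
    ext π
    simp only [mem_filter, mem_univ, true_and]
    exact ⟨fun h => h.2, fun h => ⟨h ▸ hC, h⟩⟩
  refine ⟨c, card_pos.2 ⟨1, ?_⟩, ?_, hcount⟩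
  · simp only [mem_filter, mem_univ, true_and]
    exact map_refl
  · have := hcount B₀ hB₀ _ Subset.rfl
    rw [card_powersetCard, card_univ] at this
    rw [← this, ← card_univ]
    congr 1
    ext π
    simp [mem_powersetCard, hB₀]

theorem exists_disjoint_sets {α : Type*} [Fintype α] [DecidableEq α] {r l : ℕ}
    (h : r * l ≤ Fintype.card α) :
    ∃ B : Fin r → Finset α, (∀ i, #(B i) = l) ∧ ∀ i j, i ≠ j → Disjoint (B i) (B j) := by
  obtain ⟨φ⟩ : Nonempty (Fin r × Fin l ↪ α) :=
    Function.Embedding.nonempty_of_card_le (by simpa using h)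
  refine ⟨fun i => univ.image fun j => φ (i, j), fun i => ?_, fun i j hij => ?_⟩
  · rw [card_image_of_injective _ (fun a b h => by simpa using φ.injective h)]
    simp
  · rw [disjoint_left]
    intro x hx hx'
    obtain ⟨a, -, rfl⟩ := mem_image.1 hx
    obtain ⟨b, -, hb⟩ := mem_image.1 hx'
    exact hij (congrArg Prod.fst (φ.injective hb)).symm

/-- Hall's theorem with a linear bound on the sizes of the sets. -/
theorem exists_le_card_of_not_injective {β : Type*} [DecidableEq β] {s : ℕ} {N : ℕ → Finset β}
    (hno : ¬ ∃ f : Fin (s + 1) → β, Function.Injective f ∧ ∀ i : Fin (s + 1), f i ∈ N i) :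
    ∃ j ≤ s, #(N j) ≤ s - j := by
  by_contra hcon
  push Not at hcon
  apply hno
  refine (Finset.all_card_le_biUnion_card_iff_exists_injective
    (fun i : Fin (s + 1) => N i)).1 fun S => ?_
  rcases S.eq_empty_or_nonempty with rfl | hS
  · simp
  obtain ⟨m, hm, hmin⟩ := exists_min_image S id hS
  calc #S ≤ #(Ici m) := card_le_card fun i hi => mem_Ici.2 (hmin i hi)
    _ = s - m + 1 := by rw [Fin.card_Ici]; omega
    _ ≤ #(N m) := hcon m (by omega)
    _ ≤ _ := card_le_card (subset_biUnion_of_mem (fun i : Fin (s + 1) => N i) hm)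

theorem sum_antitone_le {s r q : ℕ} {x : ℕ → ℕ} (hr : r = 2 * s + 1 + q)
    (hanti : ∀ i j, i ≤ j → j ≤ s → x j ≤ x i) (hx : x 0 ≤ r) (hj : ∃ j ≤ s, x j ≤ s - j) :
    r * (∑ i ∈ range s, x i + (s + 1) * x s) ≤ s * ((2 * s + 1) * r + q * x 0) := by
  obtain ⟨j, hjs, hj⟩ := hj
  obtain ⟨d, rfl⟩ := Nat.exists_eq_add_of_le hjs
  rw [Nat.add_sub_cancel_left] at hj
  have h1 : ∑ i ∈ range (j + d), x i ≤ j * x 0 + d * d := by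
    rw [sum_range_add]
    refine add_le_add ?_ ?_
    · calc _ ≤ ∑ i ∈ range j, x 0 := sum_le_sum fun i hi =>
            hanti 0 i (Nat.zero_le _) (by have := mem_range.1 hi; omega)
        _ = _ := by simp
    · calc _ ≤ ∑ i ∈ range d, d := sum_le_sum fun i hi =>
            (hanti j (j + i) (by omega) (by have := mem_range.1 hi; omega)).trans hj
        _ = _ := by simp
  have h2 : x (j + d) ≤ d := (hanti j (j + d) (by omega) le_rfl).trans hj
  have h3 : ∑ i ∈ range (j + d), x i + (j + d + 1) * x (j + d) ≤
      j * x 0 + d * (2 * (j + d) + 1) := by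
    have := Nat.mul_le_mul_left (j + d + 1) h2
    nlinarith
  have h4 : r * x 0 ≤ (2 * (j + d) + 1) * r + q * x 0 := by
    have := Nat.mul_le_mul_left (2 * (j + d) + 1) hx
    calc r * x 0 = (2 * (j + d) + 1) * x 0 + q * x 0 := by rw [hr]; ring
      _ ≤ _ := by omega
  calc _ ≤ r * (j * x 0 + d * (2 * (j + d) + 1)) := Nat.mul_le_mul_left _ h3
    _ = j * (r * x 0) + d * ((2 * (j + d) + 1) * r) := by ring
    _ ≤ j * ((2 * (j + d) + 1) * r + q * x 0) + d * ((2 * (j + d) + 1) * r + q * x 0) := by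
        gcongr
        omega
    _ = _ := by ring

/-- A stability form of Frankl's inequality for nested cross-dependent families. -/
theorem sum_card_nested_le {α : Type*} [Fintype α] [DecidableEq α] {l s r q : ℕ}
    (hr : r = 2 * s + 1 + q) (hrl : r * l ≤ Fintype.card α) (G : ℕ → Finset (Finset α))
    (hG : ∀ j, G j ⊆ (univ : Finset α).powersetCard l)
    (hanti : ∀ i j, i ≤ j → j ≤ s → G j ⊆ G i)
    (hno : ¬ HasRainbowMatching fun i : Fin (s + 1) => G i) :
    r * (∑ j ∈ range s, #(G j) + (s + 1) * #(G s)) ≤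
      s * ((2 * s + 1) * (Fintype.card α).choose l + q * #(G 0)) := by
  have hrpos : 0 < r := by omega
  obtain ⟨c, hcpos, hcard, hcount⟩ := exists_card_perm_map_mem (α := α) l
    (le_trans (Nat.le_mul_of_pos_left l hrpos) hrl)
  obtain ⟨B, hBc, hBd⟩ := exists_disjoint_sets hrl
  let N : Equiv.Perm α → ℕ → Finset (Fin r) := fun π j => {i | (B i).map π.toEmbedding ∈ G j}
  have hpoint : ∀ π, r * (∑ j ∈ range s, #(N π j) + (s + 1) * #(N π s)) ≤
      s * ((2 * s + 1) * r + q * #(N π 0)) := by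
    intro π
    have hN : ∀ i j, i ≤ j → j ≤ s → N π j ⊆ N π i := fun i j hij hjs b hb =>
      mem_filter.2 ⟨mem_univ _, hanti i j hij hjs (mem_filter.1 hb).2⟩
    refine sum_antitone_le (x := fun j => #(N π j)) hr
      (fun i j hij hjs => card_le_card (hN i j hij hjs)) ?_ ?_
    · exact (card_le_univ _).trans (by simp)
    · refine exists_le_card_of_not_injective ?_
      rintro ⟨f, hf, hfm⟩
      refine hno ⟨fun i => (B (f i)).map π.toEmbedding, fun i => (mem_filter.1 (hfm i)).2,
        fun i j hij => ?_⟩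
      exact (disjoint_map _).2 (hBd _ _ fun h => hij (hf h))
  have hsum : ∀ j, ∑ π, #(N π j) = r * (c * #(G j)) := by
    intro j
    simp only [N, card_filter]
    rw [sum_comm]
    simp only [← card_filter]
    rw [sum_congr rfl fun i _ => hcount (B i) (hBc i) (G j) (hG j)]
    simp
  have htotal := sum_le_sum fun π (_ : π ∈ (univ : Finset (Equiv.Perm α))) => hpoint π
  simp only [← mul_sum, sum_add_distrib] at htotal
  rw [sum_comm] at htotal
  simp only [hsum, sum_const, card_univ, smul_eq_mul, hcard] at htotal
  simp only [← mul_sum] at htotal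
  refine le_of_mul_le_mul_left (a := r * c) ?_ (Nat.mul_pos hrpos hcpos)
  calc _ = r * (r * (c * ∑ j ∈ range s, #(G j)) + (s + 1) * (r * (c * #(G s)))) := by ring
    _ ≤ _ := htotal
    _ = _ := by ring

open scoped FinsetFamily

/-- The embedding `x ↦ a + x` of `Fin m` into the natural numbers. -/
def tail (a m : ℕ) : Fin m ↪ ℕ := ⟨fun x => a + x, fun _ _ h => Fin.ext (Nat.add_left_cancel h)⟩

/-- The `l`-subsets of `Ico a (a + m)`, viewed as subsets of `Fin m`, that together with `j` form
a member of `F`. -/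
def link (F : Finset (Finset ℕ)) (a m l j : ℕ) : Finset (Finset (Fin m)) :=
  {B ∈ (univ : Finset (Fin m)).powersetCard l | insert j (B.map (tail a m)) ∈ F}

theorem le_of_mem_map_tail {a m x : ℕ} {B : Finset (Fin m)} (h : x ∈ B.map (tail a m)) :
    a ≤ x ∧ x < a + m := by
  obtain ⟨y, -, rfl⟩ := mem_map.1 h
  exact ⟨Nat.le_add_right _ _, Nat.add_lt_add_left y.2 _⟩

theorem exists_map_tail_eq {a m : ℕ} {e : Finset ℕ} (he : ∀ x ∈ e, a ≤ x ∧ x < a + m) :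
    ∃ B : Finset (Fin m), B.map (tail a m) = e := by
  refine ⟨univ.filter fun x => a + x.1 ∈ e, ?_⟩
  ext y
  simp only [mem_map, mem_filter, mem_univ, true_and]
  constructor
  · rintro ⟨x, hx, rfl⟩
    exact hx
  · intro hy
    obtain ⟨h1, h2⟩ := he y hy
    have : a + (y - a) = y := by omega
    exact ⟨⟨y - a, by omega⟩, by simpa [this] using hy, this⟩

theorem notMem_map_tail {a m j : ℕ} (hj : j < a) (B : Finset (Fin m)) :
    j ∉ B.map (tail a m) := fun h => absurd (le_of_mem_map_tail h).1 (by omega)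

theorem insert_map_tail_injective {a m j : ℕ} (hj : j < a) :
    Function.Injective fun B : Finset (Fin m) => insert j (B.map (tail a m)) := by
  intro B C h
  have h' := congrArg (fun s => erase s j) h
  simp only [erase_insert (notMem_map_tail hj _)] at h'
  exact map_injective _ h'

theorem card_filter_inter_range_eq_singleton {F : Finset (Finset ℕ)} {a m l j : ℕ} (hj : j < a)
    (hF : F ⊆ (range (a + m)).powersetCard (l + 1)) :
    #{e ∈ F | e ∩ range a = {j}} = #(link F a m l j) := by
  rw [← card_image_of_injective (link F a m l j) (insert_map_tail_injective hj)]
  congr 1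
  ext e
  simp only [mem_filter, mem_image, link, mem_powersetCard]
  constructor
  · rintro ⟨he, hinter⟩
    obtain ⟨hsub, hcard⟩ := mem_powersetCard.1 (hF he)
    have hje : j ∈ e := (mem_inter.1 (hinter ▸ mem_singleton_self j : j ∈ e ∩ range a)).1
    obtain ⟨B, hB⟩ := exists_map_tail_eq (a := a) (m := m) (e := e.erase j) (by
      intro x hx
      obtain ⟨hxj, hxe⟩ := mem_erase.1 hx
      refine ⟨?_, mem_range.1 (hsub hxe)⟩
      by_contra hlt
      exact hxj (mem_singleton.1 (hinter ▸ mem_inter.2 ⟨hxe, mem_range.2 (by omega)⟩)))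
    refine ⟨B, ⟨⟨subset_univ _, ?_⟩, ?_⟩, ?_⟩
    · rw [← card_map (tail a m), hB, card_erase_of_mem hje]
      omega
    · rwa [hB, insert_erase hje]
    · rw [hB, insert_erase hje]
  · rintro ⟨B, ⟨-, hB⟩, rfl⟩
    refine ⟨hB, ?_⟩
    ext x
    simp only [mem_inter, mem_insert, mem_range, mem_singleton]
    constructor
    · rintro ⟨rfl | h, hx⟩
      · rfl
      · exact absurd (le_of_mem_map_tail h).1 (by omega)
    · rintro rfl
      exact ⟨Or.inl rfl, hj⟩

theorem card_eq_partition {F : Finset (Finset ℕ)} {a m l : ℕ}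
    (hF : F ⊆ (range (a + m)).powersetCard (l + 1)) :
    #F = #{e ∈ F | e ∩ range a = ∅} + ∑ j ∈ range a, #(link F a m l j) +
      #{e ∈ F | 2 ≤ #(e ∩ range a)} := by
  rw [sum_congr rfl fun j hj => (card_filter_inter_range_eq_singleton (mem_range.1 hj) hF).symm]
  simp only [card_filter]
  rw [sum_comm, ← sum_add_distrib, ← sum_add_distrib, card_eq_sum_ones]
  refine sum_congr rfl fun e _ => ?_
  rcases Nat.lt_or_ge #(e ∩ range a) 2 with h | h
  · rcases Nat.lt_or_ge #(e ∩ range a) 1 with h' | h'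
    · have h0 : e ∩ range a = ∅ := card_eq_zero.1 (by omega)
      simp [h0, eq_comm]
    · obtain ⟨x, hx⟩ := card_eq_one.1 (show #(e ∩ range a) = 1 by omega)
      have hxa : x ∈ range a := (mem_inter.1 (hx ▸ mem_singleton_self x : x ∈ e ∩ range a)).2
      have hxa' := mem_range.1 hxa
      simp [hx, hxa']
  · have h0 : e ∩ range a ≠ ∅ := fun h' => by simp [h'] at h
    have h1 : ∀ j, e ∩ range a ≠ {j} := fun j h' => by simp [h'] at h
    simp [h0, h1, h]

theorem card_filter_inter_range_eq_empty_le {F : Finset (Finset ℕ)} {s m l : ℕ}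
    (hF : F ⊆ (range (s + 1 + m)).powersetCard (l + 1)) (hsh : Shifted 0 F)
    (hno : ¬ HasRainbowMatching fun _ : Fin (s + 1) => F) :
    #{e ∈ F | e ∩ range (s + 1) = ∅} ≤ s * #(link F (s + 1) m l s) := by
  set E := {e ∈ F | e ∩ range (s + 1) = ∅} with hE
  have hlow : ∀ e ∈ E, ∀ x ∈ e, s + 1 ≤ x := by
    intro e he x hx
    by_contra hlt
    have : x ∈ e ∩ range (s + 1) := mem_inter.2 ⟨hx, mem_range.2 (by omega)⟩
    rw [(mem_filter.1 he).2] at this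
    exact notMem_empty _ this
  have hEF : ∀ e ∈ E, e ∈ F := fun e he => (mem_filter.1 he).1
  have hEsub : E ⊆ (Ico (s + 1) (s + 1 + m)).powersetCard (l + 1) := by
    intro e he
    obtain ⟨hsub, hcard⟩ := mem_powersetCard.1 (hF (hEF e he))
    exact mem_powersetCard.2
      ⟨fun x hx => mem_Ico.2 ⟨hlow e he x hx, mem_range.1 (hsub hx)⟩, hcard⟩
  have hEsh : Shifted (s + 1) E := by
    intro e he x hx y hy hay hyx
    refine mem_filter.2 ⟨hsh e (hEF e he) x hx y hy (Nat.zero_le _) hyx, ?_⟩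
    rw [eq_empty_iff_forall_notMem]
    intro z hz
    obtain ⟨hz1, hz2⟩ := mem_inter.1 hz
    have hz3 := mem_range.1 hz2
    rcases mem_insert.1 hz1 with rfl | h
    · omega
    · exact absurd (hlow e he z (mem_of_mem_erase h)) (by omega)
  refine (card_le_mul_card_shadow m hEsh hEsub
    fun ⟨f, hf, hd⟩ => hno ⟨f, fun i => hEF _ (hf i), hd⟩).trans (Nat.mul_le_mul_left s ?_)
  rw [← card_map (mapEmbedding (tail (s + 1) m)).toEmbedding]
  apply card_le_card
  intro C hC
  obtain ⟨x, hx, hins⟩ := mem_shadow_iff_insert_mem.1 hC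
  obtain ⟨hsub, hcard⟩ := mem_powersetCard.1 (hEsub hins)
  rw [card_insert_of_notMem hx] at hcard
  obtain ⟨B, hB⟩ := exists_map_tail_eq (a := s + 1) (m := m) (e := C)
    fun y hy => mem_Ico.1 (hsub (mem_insert_of_mem hy))
  refine mem_map.2 ⟨B, mem_filter.2 ⟨mem_powersetCard.2 ⟨subset_univ _, ?_⟩, ?_⟩, hB⟩
  · rw [← card_map (tail (s + 1) m), hB]
    omega
  · rw [hB]
    have hsx : s < x := by
      have := hlow _ hins x (mem_insert_self _ _)
      omega
    have hsC : s ∉ insert x C := fun h => absurd (hlow _ hins s h) (by omega)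
    have := hsh _ (hEF _ hins) x (mem_insert_self _ _) s hsC (Nat.zero_le _) hsx
    rwa [erase_insert hx] at this

theorem link_subset_link {F : Finset (Finset ℕ)} (hsh : Shifted 0 F) {a m l i j : ℕ} (hij : i ≤ j)
    (hj : j < a) : link F a m l j ⊆ link F a m l i := by
  intro B hB
  obtain ⟨h1, h2⟩ := mem_filter.1 hB
  refine mem_filter.2 ⟨h1, ?_⟩
  rcases hij.eq_or_lt with rfl | hlt
  · exact h2
  have := hsh _ h2 j (mem_insert_self _ _) i
    (by simp only [mem_insert, not_or]; exact ⟨by omega, notMem_map_tail (by omega) _⟩)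
    (Nat.zero_le _) hlt
  rwa [erase_insert (notMem_map_tail hj _)] at this

theorem not_hasRainbowMatching_link {F : Finset (Finset ℕ)} {s m l : ℕ}
    (hno : ¬ HasRainbowMatching fun _ : Fin (s + 1) => F) :
    ¬ HasRainbowMatching fun i : Fin (s + 1) => link F (s + 1) m l i := by
  rintro ⟨f, hf, hd⟩
  refine hno ⟨fun i => insert i.1 ((f i).map (tail (s + 1) m)),
    fun i => (mem_filter.1 (hf i)).2, fun i j hij => ?_⟩
  simp only [disjoint_insert_left, disjoint_insert_right, mem_insert, not_or]
  exact ⟨⟨fun h => hij (Fin.ext h).symm, notMem_map_tail j.2 _⟩, notMem_map_tail i.2 _,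
    (disjoint_map _).2 (hd i j hij)⟩

theorem card_link_zero_add_le {F : Finset (Finset ℕ)} {a m l w : ℕ} (ha : a ≤ w)
    (hw : ∀ e ∈ F, 2 ≤ #(e ∩ range w)) :
    #(link F a m l 0) + (a + m - w).choose l ≤ m.choose l := by
  let H : Finset (Fin m) := {x | w ≤ a + x.1}
  have hH : #H = a + m - w := by
    have : H.map (tail a m) = Ico w (a + m) := by
      ext y
      simp only [H, mem_map, mem_filter, mem_univ, true_and, mem_Ico]
      constructor
      · rintro ⟨x, hx, rfl⟩
        exact ⟨hx, Nat.add_lt_add_left x.2 _⟩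
      · rintro ⟨h1, h2⟩
        have : a + (y - a) = y := by omega
        exact ⟨⟨y - a, by omega⟩, by simpa [this] using h1, this⟩
    rw [← card_map (tail a m), this, Nat.card_Ico]
  have hdisj : Disjoint (link F a m l 0) (H.powersetCard l) := by
    rw [disjoint_left]
    intro B hB hBH
    have h2 := hw _ (mem_filter.1 hB).2
    have : insert 0 (B.map (tail a m)) ∩ range w ⊆ {0} := by
      intro x hx
      obtain ⟨hx1, hx2⟩ := mem_inter.1 hx
      rcases mem_insert.1 hx1 with rfl | h
      · simp
      · obtain ⟨y, hy, rfl⟩ := mem_map.1 h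
        have h3 : w ≤ a + y.1 := (mem_filter.1 ((mem_powersetCard.1 hBH).1 hy)).2
        exact absurd (mem_range.1 hx2) (not_lt.2 h3)
    exact absurd (h2.trans (card_le_card this)) (by simp)
  have hsub : link F a m l 0 ∪ H.powersetCard l ⊆ (univ : Finset (Fin m)).powersetCard l :=
    union_subset (filter_subset _ _) (powersetCard_mono (subset_univ _))
  have := card_le_card hsub
  rw [card_union_of_disjoint hdisj, card_powersetCard, card_powersetCard, hH] at this
  simpa using this

theorem link_powersetCard {a m l j : ℕ} (hj : j < a) :
    link ((range (a + m)).powersetCard (l + 1)) a m l j = univ.powersetCard l := by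
  refine filter_true_of_mem fun B hB => mem_powersetCard.2 ⟨?_, ?_⟩
  · intro x hx
    rcases mem_insert.1 hx with rfl | h
    · exact mem_range.2 (by omega)
    · exact mem_range.2 (le_of_mem_map_tail h).2
  · rw [card_insert_of_notMem (notMem_map_tail hj _), card_map, (mem_powersetCard.1 hB).2]

/-- A stability form of Frankl's theorem on shifted families without `s + 1` pairwise disjoint
members. -/
theorem card_add_le_of_not_hasRainbowMatching {F : Finset (Finset ℕ)} {s m l r q w : ℕ}
    (hF : F ⊆ (range (s + 1 + m)).powersetCard (l + 1)) (hsh : Shifted 0 F)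
    (hno : ¬ HasRainbowMatching fun _ : Fin (s + 1) => F)
    (hr : r = 2 * s + 1 + q) (hrl : r * l ≤ m) (hsw : s + 1 ≤ w)
    (hw : ∀ e ∈ F, 2 ≤ #(e ∩ range w)) :
    r * #F + r * (m + 1).choose (l + 1) + s * q * (s + 1 + m - w).choose l ≤
      r * (s + 1 + m).choose (l + 1) := by
  have hnested := sum_card_nested_le (α := Fin m) (l := l) hr (by simpa using hrl)
    (link F (s + 1) m l) (fun _ => filter_subset _ _)
    (fun i j hij hjs => link_subset_link hsh hij (by omega)) (not_hasRainbowMatching_link hno)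
  rw [Fintype.card_fin] at hnested
  have h0 := card_link_zero_add_le (m := m) (l := l) hsw hw
  have hempty := card_filter_inter_range_eq_empty_le hF hsh hno
  have hpF := card_eq_partition hF
  have hpP := card_eq_partition (Subset.refl ((range (s + 1 + m)).powersetCard (l + 1)))
  rw [sum_congr rfl fun j hj => congrArg card (link_powersetCard (mem_range.1 hj))] at hpP
  have hE : #{e ∈ (range (s + 1 + m)).powersetCard (l + 1) | e ∩ range (s + 1) = ∅} =
      m.choose (l + 1) := by
    have : {e ∈ (range (s + 1 + m)).powersetCard (l + 1) | e ∩ range (s + 1) = ∅} =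
        (Ico (s + 1) (s + 1 + m)).powersetCard (l + 1) := by
      ext e
      simp only [mem_filter, mem_powersetCard]
      constructor
      · rintro ⟨⟨h1, h2⟩, h3⟩
        refine ⟨fun x hx => mem_Ico.2 ⟨?_, mem_range.1 (h1 hx)⟩, h2⟩
        by_contra hlt
        exact notMem_empty x (h3 ▸ mem_inter.2 ⟨hx, mem_range.2 (by omega)⟩)
      · rintro ⟨h1, h2⟩
        refine ⟨⟨fun x hx => mem_range.2 (mem_Ico.1 (h1 hx)).2, h2⟩, ?_⟩
        rw [eq_empty_iff_forall_notMem]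
        intro x hx
        have h3 := mem_Ico.1 (h1 (mem_inter.1 hx).1)
        have h4 := mem_range.1 (mem_inter.1 hx).2
        omega
    rw [this, card_powersetCard, Nat.card_Ico]
    congr 1
    omega
  rw [hE] at hpP
  simp only [card_powersetCard, card_range, card_univ, Fintype.card_fin, sum_const,
    smul_eq_mul] at hpP
  have htwo : #{e ∈ F | 2 ≤ #(e ∩ range (s + 1))} ≤
      #{e ∈ (range (s + 1 + m)).powersetCard (l + 1) | 2 ≤ #(e ∩ range (s + 1))} :=
    card_le_card (filter_subset_filter _ hF)
  rw [sum_range_succ] at hpF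
  rw [Nat.choose_succ_succ]
  set Y := ∑ j ∈ range s, #(link F (s + 1) m l j) + (s + 1) * #(link F (s + 1) m l s) with hY
  have hY' : Y = ∑ j ∈ range s, #(link F (s + 1) m l j) + s * #(link F (s + 1) m l s) +
      #(link F (s + 1) m l s) := by rw [hY]; ring
  have hsize : #F + (m.choose (l + 1) + (s + 1) * m.choose l) ≤
      (s + 1 + m).choose (l + 1) + Y := by omega
  have h1 := Nat.mul_le_mul_left r hsize
  have h2 := Nat.mul_le_mul_left (s * q) h0
  have h3 : s * ((2 * s + 1) * m.choose l + q * m.choose l) = r * s * m.choose l := by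
    rw [hr]; ring
  nlinarith

/-- A choice of vectors, one from each of several finite families, whose sum is close to the sum of
the averages of the families. -/
theorem exists_choice_sum_sq_le {ι β ν : Type*} [DecidableEq ι] (V : Finset ν) (J : ι → Finset β)
    (hJ : ∀ i, (J i).Nonempty) (u : ι → β → ν → ℝ) (K : ℝ)
    (hu : ∀ i, ∀ j ∈ J i, ∑ v ∈ V, u i j v ^ 2 ≤ K) (I : Finset ι) :
    ∃ c : ι → β, (∀ i, c i ∈ J i) ∧
      ∑ v ∈ V, (∑ i ∈ I, (u i (c i) v - (∑ j ∈ J i, u i j v) / #(J i))) ^ 2 ≤ #I * K := by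
  induction I using Finset.induction_on with
  | empty => exact ⟨fun i => (hJ i).choose, fun i => (hJ i).choose_spec, by simp⟩
  | insert a I ha ih =>
    obtain ⟨c, hc, hcI⟩ := ih
    set S : ν → ℝ := fun v => ∑ i ∈ I, (u i (c i) v - (∑ j ∈ J i, u i j v) / #(J i)) with hS
    set μ : ν → ℝ := fun v => (∑ j ∈ J a, u a j v) / #(J a) with hμ
    have hpos : (0 : ℝ) < #(J a) := by exact_mod_cast card_pos.2 (hJ a)
    have hμsum : ∀ v, ∑ j ∈ J a, u a j v = #(J a) * μ v := fun v => by
      simp only [hμ]; field_simp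
    have hexp : ∀ v, ∑ j ∈ J a, (u a j v - μ v + S v) ^ 2 ≤
        ∑ j ∈ J a, (S v ^ 2 + u a j v ^ 2) := by
      intro v
      have h1 : ∑ j ∈ J a, (u a j v - μ v + S v) ^ 2 =
          ∑ j ∈ J a, (S v ^ 2 + u a j v ^ 2) + 2 * (S v - μ v) * ∑ j ∈ J a, u a j v +
            #(J a) * (μ v ^ 2 - 2 * μ v * S v) := by
        rw [mul_sum, ← sum_add_distrib, ← nsmul_eq_mul, ← sum_const, ← sum_add_distrib]
        exact sum_congr rfl fun j _ => by ring
      rw [h1, hμsum]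
      nlinarith [mul_nonneg hpos.le (sq_nonneg (μ v))]
    have hle : ∑ j ∈ J a, ∑ v ∈ V, (u a j v - μ v + S v) ^ 2 ≤
        ∑ j ∈ J a, (#(insert a I) * K) := by
      calc _ = ∑ v ∈ V, ∑ j ∈ J a, (u a j v - μ v + S v) ^ 2 := sum_comm
        _ ≤ ∑ v ∈ V, ∑ j ∈ J a, (S v ^ 2 + u a j v ^ 2) := sum_le_sum fun v _ => hexp v
        _ = ∑ j ∈ J a, (∑ v ∈ V, S v ^ 2 + ∑ v ∈ V, u a j v ^ 2) := by
            rw [sum_comm]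
            exact sum_congr rfl fun j _ => sum_add_distrib
        _ ≤ _ := sum_le_sum fun j hj => by
            rw [card_insert_of_notMem ha]
            push_cast
            linarith [hu a j hj]
    obtain ⟨j, hj, hjle⟩ := exists_le_of_sum_le (hJ a) hle
    refine ⟨Function.update c a j, fun i => ?_, ?_⟩
    · rcases eq_or_ne i a with rfl | h
      · simpa using hj
      · simpa [h] using hc i
    · refine le_trans (le_of_eq (sum_congr rfl fun v _ => ?_)) hjle
      rw [sum_insert ha, Function.update_self]
      congr 2
      refine sum_congr rfl fun i hi => ?_
      rw [Function.update_of_ne (fun h : i = a => ha (h ▸ hi))]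

theorem sum_card_inter_le {ι : Type*} (J : Finset ι) {f : ι → Finset ℕ}
    (hf : ∀ i j, i ≠ j → Disjoint (f i) (f j)) (S : Finset ℕ) : ∑ j ∈ J, #(f j ∩ S) ≤ #S := by
  classical
  rw [← card_biUnion fun i _ j _ hij =>
    (hf i j hij).mono inter_subset_left inter_subset_left]
  exact card_le_card (biUnion_subset.2 fun j _ => inter_subset_right)

theorem le_card_filter_disjoint {b τ : ℕ} {f : Fin (b + τ) → Finset ℕ}
    (hf : ∀ i j, i ≠ j → Disjoint (f i) (f j)) :
    τ ≤ #{j | Disjoint (f j) (range b)} := by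
  have h1 : #{j | ¬ Disjoint (f j) (range b)} ≤ b := by
    calc _ = ∑ j with ¬ Disjoint (f j) (range b), 1 := card_eq_sum_ones _
      _ ≤ ∑ j with ¬ Disjoint (f j) (range b), #(f j ∩ range b) :=
          sum_le_sum fun j hj => card_pos.2
            (not_disjoint_iff_nonempty_inter.1 (mem_filter.1 hj).2)
      _ ≤ #(range b) := sum_card_inter_le _ hf _
      _ = b := card_range b
  have h2 := card_filter_add_card_filter_not (s := (univ : Finset (Fin (b + τ))))
    (fun j => Disjoint (f j) (range b))
  rw [card_univ, Fintype.card_fin] at h2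
  omega

/-- Sets chosen from shifted families can be moved down to become disjoint if they avoid the first
block of length `b` and every other block of length `b` is met at most `b` times. -/
theorem hasRainbowMatching_of_block_loads {t n k b : ℕ} {F : Fin t → Finset (Finset ℕ)}
    (hsh : ∀ i, Shifted 0 (F i)) (hF : ∀ i, F i ⊆ (range n).powersetCard k) (hb : 0 < b)
    {e : Fin t → Finset ℕ} (he : ∀ i, e i ∈ F i) (h0 : ∀ i, Disjoint (e i) (range b))
    (hload : ∀ v < n, ∑ i, #{x ∈ e i | x / b = v} ≤ b) : HasRainbowMatching F := by
  have hen : ∀ i, ∀ x ∈ e i, x < n := fun i x hx =>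
    mem_range.1 ((mem_powersetCard.1 (hF i (he i))).1 hx)
  have heb : ∀ i, ∀ x ∈ e i, b ≤ x := fun i x hx => by
    by_contra hlt
    exact (disjoint_left.1 (h0 i) hx) (mem_range.2 (by omega))
  let I : Finset (Σ _ : Fin t, ℕ) := univ.sigma e
  obtain ⟨φ, hinj, hφ⟩ := exists_injOn_le I (fun p => p.2) (range n) (by
    rintro ⟨i, y⟩ hy
    have hye : y ∈ e i := (mem_sigma.1 hy).2
    have hyn := hen i y hye
    have hright : #{q ∈ range n | q ≤ y} = y + 1 := by
      rw [← card_range (y + 1)]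
      congr 1
      ext q
      simp only [mem_filter, mem_range]
      omega
    have hleft : #{p ∈ I | p.2 ≤ y} ≤ b * #(Icc 1 (y / b)) := by
      refine card_le_mul_card_image_of_maps_to (f := fun p : (Σ _ : Fin t, ℕ) => p.2 / b) ?_ b ?_
      · rintro ⟨j, z⟩ hz
        obtain ⟨hz1, hz2⟩ := mem_filter.1 hz
        exact mem_Icc.2 ⟨Nat.div_pos (heb j z (mem_sigma.1 hz1).2) hb, Nat.div_le_div_right hz2⟩
      · intro v hv
        have hvn : v < n := by
          have h1 := (mem_Icc.1 hv).2
          have h2 := Nat.div_le_self y b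
          omega
        refine le_trans ?_ (hload v hvn)
        rw [← card_sigma]
        apply card_le_card
        rintro ⟨j, z⟩ hz
        simp only [I, mem_filter, mem_sigma] at hz ⊢
        exact ⟨mem_univ _, hz.1.1.2, hz.2⟩
    rw [Nat.card_Icc, Nat.add_sub_cancel] at hleft
    have := Nat.mul_div_le y b
    simp only
    omega)
  have hmem : ∀ i, ∀ x ∈ e i, (⟨i, x⟩ : Σ _ : Fin t, ℕ) ∈ I := fun i x hx =>
    mem_sigma.2 ⟨mem_univ _, hx⟩
  refine ⟨fun i => (e i).image fun x => φ ⟨i, x⟩, fun i => ?_, fun i j hij => ?_⟩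
  · refine (hsh i).image_mem (he i) ?_ fun x hx => ⟨Nat.zero_le _, (hφ _ (hmem i x hx)).2⟩
    intro x hx y hy h
    simpa using hinj (hmem i x hx) (hmem i y hy) h
  · rw [disjoint_left]
    intro z hz hz'
    obtain ⟨x, hx, rfl⟩ := mem_image.1 hz
    obtain ⟨y, hy, h⟩ := mem_image.1 hz'
    have := hinj (hmem j y hy) (hmem i x hx) h
    exact hij (congrArg Sigma.fst this).symm

/-- Shifted families that each contain somewhat more than `t` pairwise disjoint members have a
rainbow matching. -/
theorem hasRainbowMatching_of_matchings {t n k b τ x : ℕ} {F : Fin t → Finset (Finset ℕ)}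
    (hsh : ∀ i, Shifted 0 (F i)) (hF : ∀ i, F i ⊆ (range n).powersetCard k)
    (hM : ∀ i, HasRainbowMatching fun _ : Fin (b + τ) => F i) (hb : 0 < b) (hτ : 0 < τ)
    (hx : k ^ 2 * t ≤ x ^ 2) (hnum : t * b + x * τ ≤ b * τ) : HasRainbowMatching F := by
  choose M hMF hMd using hM
  let J : Fin t → Finset (Fin (b + τ)) := fun i => {j | Disjoint (M i j) (range b)}
  have hJ : ∀ i, τ ≤ #(J i) := fun i => le_card_filter_disjoint (hMd i)
  let u : Fin t → Fin (b + τ) → ℕ → ℝ := fun i j v => (#{y ∈ M i j | y / b = v} : ℝ)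
  have hu : ∀ i, ∀ j ∈ J i, ∑ v ∈ range n, u i j v ^ 2 ≤ (k : ℝ) ^ 2 := by
    intro i j _
    obtain ⟨hsub, hcard⟩ := mem_powersetCard.1 (hF i (hMF i j))
    have hmaps : ∀ y ∈ M i j, y / b ∈ range n := fun y hy =>
      mem_range.2 (lt_of_le_of_lt (Nat.div_le_self _ _) (mem_range.1 (hsub hy)))
    have hsum : ∑ v ∈ range n, #{y ∈ M i j | y / b = v} = k := by
      rw [← card_eq_sum_card_fiberwise hmaps, hcard]
    have hle : ∀ v, #{y ∈ M i j | y / b = v} ≤ k := fun v => hcard ▸ card_filter_le _ _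
    have : ∑ v ∈ range n, #{y ∈ M i j | y / b = v} ^ 2 ≤ k ^ 2 := by
      calc _ ≤ ∑ v ∈ range n, k * #{y ∈ M i j | y / b = v} := sum_le_sum fun v _ => by
            rw [pow_two]; exact Nat.mul_le_mul_right _ (hle v)
        _ = k ^ 2 := by rw [← mul_sum, hsum, pow_two]
    simp only [u]
    exact_mod_cast this
  obtain ⟨c, hcJ, hc⟩ := exists_choice_sum_sq_le (range n) J
    (fun i => card_pos.1 (hτ.trans_le (hJ i))) u _ hu univ
  have hτ' : (0 : ℝ) < τ := by exact_mod_cast hτ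
  have hmean : ∀ i v, (∑ j ∈ J i, u i j v) / #(J i) ≤ (b : ℝ) / τ := by
    intro i v
    have h1 : ∑ j ∈ J i, #{y ∈ M i j | y / b = v} ≤ b := by
      calc _ ≤ ∑ j ∈ J i, #(M i j ∩ Ico (v * b) (v * b + b)) := sum_le_sum fun j _ => by
            apply card_le_card
            intro y hy
            obtain ⟨hy1, rfl⟩ := mem_filter.1 hy
            have h2 := Nat.div_add_mod y b
            have h3 := Nat.mod_lt y hb
            have h4 := mul_comm b (y / b)
            exact mem_inter.2 ⟨hy1, mem_Ico.2 ⟨by omega, by omega⟩⟩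
        _ ≤ #(Ico (v * b) (v * b + b)) := sum_card_inter_le _ (hMd i) _
        _ = b := by simp
    have h2 : ∑ j ∈ J i, u i j v ≤ b := by
      simp only [u]
      exact_mod_cast h1
    have h3 : (τ : ℝ) ≤ #(J i) := by exact_mod_cast hJ i
    exact div_le_div₀ (Nat.cast_nonneg b) h2 hτ' h3
  refine hasRainbowMatching_of_block_loads hsh hF hb (e := fun i => M i (c i))
    (fun i => hMF i (c i)) (fun i => (mem_filter.1 (hcJ i)).2) fun v hv => ?_
  have hdev : (∑ i, (u i (c i) v - (∑ j ∈ J i, u i j v) / #(J i))) ^ 2 ≤ (x : ℝ) ^ 2 := by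
    refine (single_le_sum (f := fun v => (∑ i, (u i (c i) v -
      (∑ j ∈ J i, u i j v) / #(J i))) ^ 2) (fun v _ => sq_nonneg _) (mem_range.2 hv)).trans
        (hc.trans ?_)
    rw [card_univ, Fintype.card_fin, mul_comm]
    exact_mod_cast hx
  have hdev' := (le_abs_self _).trans (abs_le_of_sq_le_sq hdev (Nat.cast_nonneg x))
  rw [sum_sub_distrib] at hdev'
  have hmeans : ∑ i, (∑ j ∈ J i, u i j v) / #(J i) ≤ t * ((b : ℝ) / τ) := by
    calc _ ≤ ∑ _i : Fin t, (b : ℝ) / τ := sum_le_sum fun i _ => hmean i v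
      _ = _ := by simp
  have hnum' : t * ((b : ℝ) / τ) + x ≤ b := by
    have : (t : ℝ) * b + x * τ ≤ b * τ := by exact_mod_cast hnum
    rw [← mul_div_assoc, div_add' _ _ _ hτ'.ne', div_le_iff₀ hτ']
    exact this
  have hfinal : ∑ i, u i (c i) v ≤ b := by linarith
  simp only [u] at hfinal
  exact_mod_cast hfinal

/-- The set `e` with the roles of `x` and `y` exchanged. -/
def swapSet (x y : ℕ) (e : Finset ℕ) : Finset ℕ := e.map (Equiv.swap x y).toEmbedding

theorem swapSet_swapSet (x y : ℕ) (e : Finset ℕ) : swapSet x y (swapSet x y e) = e := by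
  ext z
  simp [swapSet]

theorem mem_swapSet {x y z : ℕ} {e : Finset ℕ} :
    z ∈ swapSet x y e ↔ Equiv.swap x y z ∈ e := by
  simp [swapSet]

theorem swapSet_of_mem_of_notMem {x y : ℕ} {e : Finset ℕ} (hx : x ∈ e) (hy : y ∉ e) :
    swapSet x y e = insert y (e.erase x) := by
  ext z
  rw [mem_swapSet, mem_insert, mem_erase]
  rcases eq_or_ne z x with rfl | hzx
  · have : z ≠ y := fun h => hy (h ▸ hx)
    simp [hy, this]
  rcases eq_or_ne z y with rfl | hzy
  · simp [hx]
  · simp [Equiv.swap_apply_of_ne_of_ne hzx hzy, hzx, hzy]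

theorem swapSet_of_notMem_of_notMem {x y : ℕ} {e : Finset ℕ} (hx : x ∉ e) (hy : y ∉ e) :
    swapSet x y e = e := by
  ext z
  rw [mem_swapSet]
  rcases eq_or_ne z x with rfl | hzx
  · simp [hy, hx]
  rcases eq_or_ne z y with rfl | hzy
  · simp [hx, hy]
  · simp [Equiv.swap_apply_of_ne_of_ne hzx hzy]

/-- The effect on `e` of shifting `x` to `y` in the family `F`. -/
def shiftSet (x y : ℕ) (F : Finset (Finset ℕ)) (e : Finset ℕ) : Finset ℕ :=
  if x ∈ e ∧ y ∉ e ∧ swapSet x y e ∉ F then swapSet x y e else e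

theorem shiftSet_injOn (x y : ℕ) (F : Finset (Finset ℕ)) : Set.InjOn (shiftSet x y F) F := by
  intro e he f hf h
  unfold shiftSet at h
  split_ifs at h with h1 h2 h2
  · rw [← swapSet_swapSet x y e, h, swapSet_swapSet]
  · exact absurd (h ▸ hf) h1.2.2
  · exact absurd (h ▸ he) h2.2.2
  · exact h

theorem mem_or_of_mem_image_shiftSet {x y : ℕ} {F : Finset (Finset ℕ)} {e : Finset ℕ}
    (he : e ∈ F.image (shiftSet x y F)) : e ∈ F ∨ (swapSet x y e ∈ F ∧ y ∈ e ∧ x ∉ e) := by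
  obtain ⟨f, hf, rfl⟩ := mem_image.1 he
  unfold shiftSet
  split_ifs with h
  · right
    rw [swapSet_swapSet, mem_swapSet, mem_swapSet]
    simpa using ⟨hf, h.1, h.2.1⟩
  · exact Or.inl hf

theorem swapSet_mem_of_mem_image_shiftSet {x y : ℕ} {F : Finset (Finset ℕ)} {e : Finset ℕ}
    (he : e ∈ F.image (shiftSet x y F)) (hx : x ∈ e) (hy : y ∉ e) : swapSet x y e ∈ F := by
  obtain ⟨f, hf, rfl⟩ := mem_image.1 he
  unfold shiftSet at hx hy ⊢
  split_ifs at hx hy ⊢ with h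
  · rwa [swapSet_swapSet]
  · by_contra hcon
    exact h ⟨hx, hy, hcon⟩

theorem HasRainbowMatching.of_image_shiftSet {ι : Type*} {x y : ℕ} {F : ι → Finset (Finset ℕ)}
    (h : HasRainbowMatching fun i => (F i).image (shiftSet x y (F i))) :
    HasRainbowMatching F := by
  obtain ⟨e, he, hd⟩ := h
  by_cases hall : ∀ i, e i ∈ F i
  · exact ⟨e, hall, hd⟩
  push Not at hall
  obtain ⟨p, hp⟩ := hall
  obtain ⟨hps, hyp, hxp⟩ := (mem_or_of_mem_image_shiftSet (he p)).resolve_left hp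
  refine ⟨fun i => swapSet x y (e i), fun i => ?_, fun i j hij => (disjoint_map _).2 (hd i j hij)⟩
  rcases eq_or_ne i p with rfl | hip
  · exact hps
  have hyi : y ∉ e i := fun h => disjoint_left.1 (hd i p hip) h hyp
  by_cases hxi : x ∈ e i
  · exact swapSet_mem_of_mem_image_shiftSet (he i) hxi hyi
  · simp only [swapSet_of_notMem_of_notMem hxi hyi]
    exact (mem_or_of_mem_image_shiftSet (he i)).resolve_right fun h => hyi h.2.1

theorem sum_shiftSet_le {x y : ℕ} (hyx : y < x) (F : Finset (Finset ℕ)) (e : Finset ℕ) :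
    ∑ z ∈ shiftSet x y F e, z ≤ ∑ z ∈ e, z ∧
      (x ∈ e → y ∉ e → swapSet x y e ∉ F → ∑ z ∈ shiftSet x y F e, z < ∑ z ∈ e, z) := by
  unfold shiftSet
  split_ifs with h
  · rw [swapSet_of_mem_of_notMem h.1 h.2.1, sum_insert (by simp [h.2.1]),
      ← add_sum_erase e (fun z => z) h.1]
    exact ⟨by omega, fun _ _ _ => by omega⟩
  · exact ⟨le_rfl, fun h1 h2 h3 => absurd ⟨h1, h2, h3⟩ h⟩

/-- Shifting reduces rainbow matching problems to shifted families. -/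
theorem exists_shifted_of_not_hasRainbowMatching {ι : Type*} [Fintype ι] {n k : ℕ}
    (F : ι → Finset (Finset ℕ)) (hF : ∀ i, F i ⊆ (range n).powersetCard k)
    (hno : ¬ HasRainbowMatching F) :
    ∃ F' : ι → Finset (Finset ℕ), (∀ i, F' i ⊆ (range n).powersetCard k) ∧
      (∀ i, #(F' i) = #(F i)) ∧ (∀ i, Shifted 0 (F' i)) ∧ ¬ HasRainbowMatching F' := by
  induction hN : ∑ i, ∑ e ∈ F i, ∑ x ∈ e, x using Nat.strong_induction_on generalizing F with
  | _ N ih =>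
    by_cases hsh : ∀ i, Shifted 0 (F i)
    · exact ⟨F, hF, fun _ => rfl, hsh, hno⟩
    · simp only [Shifted, not_forall] at hsh
      obtain ⟨i₀, e₀, he₀, x, hx, y, hy, -, hyx, hnot⟩ := hsh
      rw [← swapSet_of_mem_of_notMem hx hy] at hnot
      have hsum : ∑ i, ∑ e ∈ (F i).image (shiftSet x y (F i)), ∑ z ∈ e, z < N := by
        rw [← hN]
        simp only [sum_image (shiftSet_injOn x y (F _))]
        refine sum_lt_sum (fun i _ => sum_le_sum fun e _ => (sum_shiftSet_le hyx (F i) e).1)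
          ⟨i₀, mem_univ _, ?_⟩
        exact sum_lt_sum (fun e _ => (sum_shiftSet_le hyx (F i₀) e).1)
          ⟨e₀, he₀, (sum_shiftSet_le hyx (F i₀) e₀).2 hx hy hnot⟩
      obtain ⟨F', h1, h2, h3, h4⟩ := ih _ hsum (fun i => (F i).image (shiftSet x y (F i)))
        (fun i f hf => by
          obtain ⟨e, he, rfl⟩ := mem_image.1 hf
          have hmem := hF i he
          unfold shiftSet
          split_ifs with h
          · obtain ⟨hsub, hcard⟩ := mem_powersetCard.1 hmem
            refine mem_powersetCard.2 ⟨?_, by simpa [swapSet] using hcard⟩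
            rw [swapSet_of_mem_of_notMem h.1 h.2.1]
            have hxn := mem_range.1 (hsub h.1)
            exact insert_subset (mem_range.2 (by omega)) ((erase_subset _ _).trans hsub)
          · exact hmem)
        (fun h => hno h.of_image_shiftSet) rfl
      exact ⟨F', h1, fun i => (h2 i).trans (card_image_of_injOn (shiftSet_injOn x y (F i))), h3, h4⟩

/-- The members of `F` avoiding `0`, moved down by one. -/
def avoidZero (n k : ℕ) (F : Finset (Finset ℕ)) : Finset (Finset ℕ) :=
  ((range n).powersetCard k).filter fun B => B.map (addRightEmbedding 1) ∈ F

theorem Shifted.avoidZero {n k : ℕ} {F : Finset (Finset ℕ)} (hF : Shifted 0 F) :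
    Shifted 0 (avoidZero n k F) := by
  intro e he x hx y hy _ hyx
  simp only [RainbowMatching.avoidZero, mem_filter, mem_powersetCard] at he ⊢
  obtain ⟨⟨hen, hek⟩, heF⟩ := he
  refine ⟨⟨?_, ?_⟩, ?_⟩
  · have := mem_range.1 (hen hx)
    exact insert_subset (mem_range.2 (by omega)) ((erase_subset _ _).trans hen)
  · rw [card_insert_of_notMem (by simp [hy]), card_erase_of_mem hx, hek]
    have := card_pos.2 ⟨x, hx⟩
    omega
  · have h := hF _ heF (x + 1) (by simpa using hx) (y + 1) (by simpa using hy) (Nat.zero_le _)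
      (by omega)
    convert h using 1
    rw [map_insert, map_erase]
    rfl

theorem map_succ_image_pred {e : Finset ℕ} (h0 : 0 ∉ e) :
    (e.image Nat.pred).map (addRightEmbedding 1) = e := by
  ext x
  simp only [mem_map, mem_image, addRightEmbedding_apply]
  constructor
  · rintro ⟨_, ⟨y, hy, rfl⟩, rfl⟩
    have : y ≠ 0 := fun h => h0 (h ▸ hy)
    rwa [Nat.pred_eq_sub_one, Nat.sub_add_cancel (by omega)]
  · intro hx
    have : x ≠ 0 := fun h => h0 (h ▸ hx)
    exact ⟨_, ⟨x, hx, rfl⟩, by rw [Nat.pred_eq_sub_one]; omega⟩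

theorem card_le_card_avoidZero_add {n l : ℕ} {F : Finset (Finset ℕ)}
    (hF : F ⊆ (range (n + 1)).powersetCard (l + 1)) :
    #F ≤ #(avoidZero n (l + 1) F) + n.choose l := by
  have hsub : F ⊆ (avoidZero n (l + 1) F).image (fun B => B.map (addRightEmbedding 1)) ∪
      ((range n).powersetCard l).image (fun B => insert 0 (B.map (addRightEmbedding 1))) := by
    intro e he
    obtain ⟨hen, hek⟩ := mem_powersetCard.1 (hF he)
    have hpred : ∀ e' : Finset ℕ, e' ⊆ range (n + 1) → 0 ∉ e' → e'.image Nat.pred ⊆ range n := by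
      intro e' he' h0 x hx
      obtain ⟨y, hy, rfl⟩ := mem_image.1 hx
      have h1 := mem_range.1 (he' hy)
      have h2 : y ≠ 0 := fun h => h0 (h ▸ hy)
      rw [mem_range, Nat.pred_eq_sub_one]
      omega
    rw [mem_union, mem_image, mem_image]
    by_cases h0 : 0 ∈ e
    · right
      have h0' : 0 ∉ e.erase 0 := notMem_erase _ _
      have hm := map_succ_image_pred h0'
      refine ⟨(e.erase 0).image Nat.pred, mem_powersetCard.2
        ⟨hpred _ ((erase_subset _ _).trans hen) h0', ?_⟩, ?_⟩
      · rw [← card_map (addRightEmbedding 1), hm, card_erase_of_mem h0, hek]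
        rfl
      · rw [hm, insert_erase h0]
    · left
      have hm := map_succ_image_pred h0
      refine ⟨e.image Nat.pred, ?_, hm⟩
      simp only [avoidZero, mem_filter, mem_powersetCard]
      refine ⟨⟨hpred _ hen h0, ?_⟩, by rwa [hm]⟩
      rw [← card_map (addRightEmbedding 1), hm, hek]
  calc #F ≤ _ := card_le_card hsub
    _ ≤ _ := card_union_le _ _
    _ ≤ _ := Nat.add_le_add card_image_le card_image_le
    _ = _ := by simp

theorem two_le_card_inter {t n l : ℕ} {F : Fin (t + 1) → Finset (Finset ℕ)}
    (hF : ∀ i, F i ⊆ (range (n + 1)).powersetCard (l + 1)) (hsh : ∀ i, Shifted 0 (F i))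
    (hno : ¬ HasRainbowMatching F)
    (hcard : ∀ i, (n + 1).choose (l + 1) < #(F i) + (n - t + 1).choose (l + 1))
    (ih : ∀ F' : Fin t → Finset (Finset ℕ), (∀ i, F' i ⊆ (range n).powersetCard (l + 1)) →
      (∀ i, Shifted 0 (F' i)) →
      (∀ i, n.choose (l + 1) < #(F' i) + (n - t + 1).choose (l + 1)) → HasRainbowMatching F')
    (i : Fin (t + 1)) (e : Finset ℕ) (he : e ∈ F i) :
    2 ≤ #(e ∩ range ((l + 1) * t + 1)) := by
  by_contra hlt
  obtain ⟨f, hfF, hfd⟩ := ih (fun j => avoidZero n (l + 1) (F (i.succAbove j)))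
    (fun j => filter_subset _ _) (fun j => (hsh _).avoidZero) (fun j => by
      have h1 := card_le_card_avoidZero_add (hF (i.succAbove j))
      have h2 := hcard (i.succAbove j)
      rw [Nat.choose_succ_succ'] at h2
      omega)
  simp only [avoidZero, mem_filter, mem_powersetCard] at hfF
  set X := univ.biUnion fun j => (f j).map (addRightEmbedding 1) with hX
  have hXc : #X ≤ (l + 1) * t := by
    calc #X ≤ ∑ j : Fin t, #((f j).map (addRightEmbedding 1)) := card_biUnion_le
      _ = ∑ j : Fin t, (l + 1) := sum_congr rfl fun j _ => by rw [card_map, (hfF j).1.2]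
      _ = _ := by simp [mul_comm]
  have h0 : 0 ∉ X := by simp [hX]
  obtain ⟨e', he'F, he'X⟩ := (hsh i).exists_disjoint he h0 (by
    have : #(e ∩ range (#X + 1)) ≤ #(e ∩ range ((l + 1) * t + 1)) :=
      card_le_card (inter_subset_inter_left (range_subset_range.2 (by omega)))
    omega)
  rw [hX, disjoint_biUnion_right] at he'X
  refine hno ⟨i.insertNth e' fun j => (f j).map (addRightEmbedding 1), ?_, ?_⟩
  · intro a
    refine Fin.succAboveCases i ?_ (fun j => ?_) a
    · simpa using he'F
    · simpa using (hfF j).2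
  · intro a b
    refine Fin.succAboveCases i ?_ (fun j => ?_) a
    · refine Fin.succAboveCases i ?_ (fun j' => ?_) b
      · simp
      · intro _
        simpa using he'X j' (mem_univ _)
    · refine Fin.succAboveCases i ?_ (fun j' => ?_) b
      · intro _
        simpa using (he'X j (mem_univ _)).symm
      · intro hne
        have : j ≠ j' := fun h => hne (by rw [h])
        simpa using hfd j j' this

theorem card_le_of_two_le_card_inter {n l w : ℕ} {F : Finset (Finset ℕ)}
    (hF : F ⊆ (range n).powersetCard (l + 2)) (hw : ∀ e ∈ F, 2 ≤ #(e ∩ range w)) :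
    #F ≤ w.choose 2 * n.choose l := by
  have hsub : F ⊆ ((range w).powersetCard 2 ×ˢ (range n).powersetCard l).image
      fun p => p.1 ∪ p.2 := by
    intro e he
    obtain ⟨hen, hek⟩ := mem_powersetCard.1 (hF he)
    obtain ⟨p, hp, hpc⟩ := exists_subset_card_eq (hw e he)
    have hpe : p ⊆ e := hp.trans inter_subset_left
    refine mem_image.2 ⟨(p, e \ p), ?_, by simp [hpe]⟩
    simp only [mem_product, mem_powersetCard]
    refine ⟨⟨hp.trans inter_subset_right, hpc⟩, sdiff_subset.trans hen, ?_⟩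
    rw [card_sdiff_of_subset hpe, hek, hpc]
    rfl
  calc #F ≤ _ := card_le_card hsub
    _ ≤ _ := card_image_le
    _ = _ := by simp

theorem choose_le_four_pow_mul_choose {n M : ℕ} (hM : n ≤ 2 * M) :
    ∀ j : ℕ, 4 * j ≤ n → n.choose j ≤ 4 ^ j * M.choose j
  | 0, _ => by simp
  | j + 1, hj => by
    have ih := choose_le_four_pow_mul_choose hM j (by omega)
    refine Nat.le_of_mul_le_mul_right ?_ (Nat.succ_pos j)
    calc n.choose (j + 1) * (j + 1) = n.choose j * (n - j) := Nat.choose_succ_right_eq n j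
      _ ≤ (4 ^ j * M.choose j) * (4 * (M - j)) := Nat.mul_le_mul ih (by omega)
      _ = 4 ^ (j + 1) * (M.choose j * (M - j)) := by ring
      _ = 4 ^ (j + 1) * (M.choose (j + 1) * (j + 1)) := by rw [Nat.choose_succ_right_eq]
      _ = 4 ^ (j + 1) * M.choose (j + 1) * (j + 1) := by ring

theorem choose_succ_add_mul_le (a l : ℕ) :
    ∀ u : ℕ, a.choose (l + 1) + u * a.choose l ≤ (a + u).choose (l + 1)
  | 0 => by simp
  | u + 1 => by
    have ih := choose_succ_add_mul_le a l u
    have h : a.choose l ≤ (a + u).choose l := Nat.choose_le_choose l (by omega)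
    rw [← add_assoc, Nat.choose_succ_succ', add_one_mul]
    omega

theorem choose_succ_le_add_mul (a l : ℕ) :
    ∀ u : ℕ, (a + u).choose (l + 1) ≤ a.choose (l + 1) + u * (a + u).choose l
  | 0 => by simp
  | u + 1 => by
    have ih := choose_succ_le_add_mul a l u
    have h : (a + u).choose l ≤ (a + (u + 1)).choose l := Nat.choose_le_choose l (by omega)
    have h' := Nat.mul_le_mul_left u h
    have hpascal : (a + (u + 1)).choose (l + 1) = (a + u).choose l + (a + u).choose (l + 1) :=
      Nat.choose_succ_succ' _ _
    rw [hpascal, add_one_mul]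
    omega

theorem choose_two_mul_choose_add_le {n t p : ℕ}
    (hn : 4 * (p + 2) ^ 3 * 4 ^ (p + 2) * (t + 1) < n) :
    ((p + 2) * t + 1).choose 2 * n.choose p + (n - t).choose (p + 2) ≤ n.choose (p + 2) := by
  have hpow : 1 ≤ 4 ^ p := Nat.one_le_pow _ _ (by norm_num)
  have hn' : 64 * ((p + 2) ^ 3 * 4 ^ p * (t + 1)) < n := by
    refine lt_of_eq_of_lt ?_ hn
    ring
  have hB : (p + 2) ^ 3 * (t + 1) ≤ (p + 2) ^ 3 * 4 ^ p * (t + 1) := by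
    have := Nat.mul_le_mul_left ((p + 2) ^ 3 * (t + 1)) hpow
    nlinarith
  have hpt : p + t + 1 ≤ (p + 2) ^ 3 * (t + 1) := by
    have : (p + 2) ^ 3 * (t + 1) = p ^ 3 * t + p^3 + 6 * p^2 * t + 6 * p^2 + 12 * p * t + 12 * p
      + 8 * t + 8 := by ring
    rw [this]
    nlinarith [Nat.zero_le (p ^ 3 * t), Nat.zero_le (p ^ 3), Nat.zero_le (p ^ 2 * t),
      Nat.zero_le (p ^ 2), Nat.zero_le (p * t)]
  have hw : ((p + 2) * t + 1).choose 2 ≤ (p + 2) ^ 2 * (t + 1) * t := by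
    rw [Nat.choose_two_right, Nat.add_sub_cancel]
    refine (Nat.div_le_self _ _).trans ?_
    nlinarith [Nat.zero_le (p * t), Nat.zero_le (p ^ 2 * t)]
  have hratio : n.choose p ≤ 4 ^ p * (n - t).choose p :=
    choose_le_four_pow_mul_choose (by omega) p (by omega)
  have hstep : (p + 2) ^ 2 * (t + 1) * n.choose p ≤ (n - t).choose (p + 1) := by
    refine Nat.le_of_mul_le_mul_right ?_ (Nat.succ_pos p)
    rw [Nat.choose_succ_right_eq]
    calc (p + 2) ^ 2 * (t + 1) * n.choose p * (p + 1)
        ≤ (p + 2) ^ 2 * (t + 1) * (4 ^ p * (n - t).choose p) * (p + 2) :=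
          Nat.mul_le_mul (Nat.mul_le_mul_left _ hratio) (by omega)
      _ = (n - t).choose p * ((p + 2) ^ 3 * 4 ^ p * (t + 1)) := by ring
      _ ≤ _ := Nat.mul_le_mul_left _ (by omega)
  have hadd := choose_succ_add_mul_le (n - t) (p + 1) t
  rw [Nat.sub_add_cancel (by omega)] at hadd
  calc ((p + 2) * t + 1).choose 2 * n.choose p + (n - t).choose (p + 2)
      ≤ (p + 2) ^ 2 * (t + 1) * t * n.choose p + (n - t).choose (p + 2) :=
        Nat.add_le_add_right (Nat.mul_le_mul_right _ hw) _
    _ = (n - t).choose (p + 2) + t * ((p + 2) ^ 2 * (t + 1) * n.choose p) := by ring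
    _ ≤ (n - t).choose (p + 2) + t * (n - t).choose (p + 1) :=
        Nat.add_le_add_left (Nat.mul_le_mul_left _ hstep) _
    _ ≤ _ := hadd

/-- A large shifted family all of whose members meet a short initial segment twice has a matching
with noticeably more than `t` edges, provided that `n` is linear in `t`. -/
theorem hasRainbowMatching_const {n t l C Δ : ℕ} {F : Finset (Finset ℕ)} (hl : 1 ≤ l)
    (hC : 1 ≤ C) (hΔ : Δ = 8 * l * C * 4 ^ l) (ht : 4 * Δ ≤ t) (hnt : 2 * (l + 1) * t < n)
    (hn : n ≤ C * t) (hF : F ⊆ (range n).powersetCard (l + 1)) (hsh : Shifted 0 F)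
    (hw : ∀ e ∈ F, 2 ≤ #(e ∩ range ((l + 1) * (t - 1) + 1)))
    (hcard : n.choose (l + 1) < #F + (n - t + 1).choose (l + 1)) :
    HasRainbowMatching fun _ : Fin (t + t / Δ + 1) => F := by
  by_contra hno
  have hpow : 4 ≤ 4 ^ l := Nat.le_self_pow (by omega) 4
  have hΔl : 32 * l ≤ Δ := by
    rw [hΔ]
    have := Nat.mul_le_mul (Nat.mul_le_mul_left (8 * l) hC) hpow
    omega
  have hdl : 32 * (l * (t / Δ)) ≤ t := by
    have h1 := Nat.mul_le_mul_right (t / Δ) hΔl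
    have h2 := Nat.mul_div_le t Δ
    nlinarith
  have hql : 2 * (l * (t / (2 * l))) ≤ t := by
    have := Nat.mul_div_le t (2 * l)
    nlinarith
  have hql' : t ≤ 4 * (l * (t / (2 * l))) := by
    have := Nat.lt_mul_div_succ t (show 0 < 2 * l by omega)
    nlinarith
  have hd' : Δ * (t / Δ + 1) ≤ 2 * t := by
    have := Nat.mul_div_le t Δ
    nlinarith
  set d := t / Δ
  set q := t / (2 * l)
  clear_value d q
  have hdle : d ≤ l * d := Nat.le_mul_of_pos_left _ hl
  have htl : t ≤ l * t := Nat.le_mul_of_pos_left _ hl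
  have hnt' : 2 * (l * t) + 2 * t < n := by nlinarith
  have hwle : (l + 1) * (t - 1) + 1 + l = l * t + t := by
    obtain ⟨t', rfl⟩ : ∃ t', t = t' + 1 := ⟨t - 1, by omega⟩
    rw [Nat.add_sub_cancel]
    ring
  have hm : t + d + 1 + (n - (t + d + 1)) = n := by omega
  have hrl : (2 * (t + d) + 1 + q) * l ≤ n - (t + d + 1) := by
    have : (2 * (t + d) + 1 + q) * l = 2 * (l * t) + 2 * (l * d) + l + l * q := by ring
    omega
  have hltw : t + d + 1 ≤ (l + 1) * (t - 1) + 1 := by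
    obtain ⟨t', rfl⟩ : ∃ t', t = t' + 1 := ⟨t - 1, by omega⟩
    rw [Nat.add_sub_cancel]
    have : t' ≤ l * t' := Nat.le_mul_of_pos_left _ hl
    have : (l + 1) * t' = l * t' + t' := by ring
    omega
  have key := card_add_le_of_not_hasRainbowMatching (s := t + d) (m := n - (t + d + 1)) (q := q)
    (r := 2 * (t + d) + 1 + q) (w := (l + 1) * (t - 1) + 1) (by rwa [hm]) hsh hno rfl hrl hltw hw
  rw [hm, show n - (t + d + 1) + 1 = n - (t + d) by omega] at key
  set w := (l + 1) * (t - 1) + 1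
  set r := 2 * (t + d) + 1 + q with hr
  have hratio : n.choose l ≤ 4 ^ l * (n - w).choose l :=
    choose_le_four_pow_mul_choose (by omega) l (by omega)
  have hup : (n - t + 1).choose (l + 1) ≤
      (n - (t + d)).choose (l + 1) + (d + 1) * n.choose l := by
    have h := choose_succ_le_add_mul (n - (t + d)) l (d + 1)
    rw [show n - (t + d) + (d + 1) = n - t + 1 by omega] at h
    exact h.trans (Nat.add_le_add_left (Nat.mul_le_mul_left _ (Nat.choose_le_choose _ (by omega))) _)
  have hlt : (t + d) * q * (n - w).choose l < r * (d + 1) * 4 ^ l * (n - w).choose l := by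
    have h1 : n.choose (l + 1) < #F + (n - (t + d)).choose (l + 1) +
        (d + 1) * (4 ^ l * (n - w).choose l) := by
      have := Nat.mul_le_mul_left (d + 1) hratio
      omega
    have h2 := Nat.mul_lt_mul_of_pos_left h1 (show 0 < r by omega)
    nlinarith
  have hlt' := Nat.lt_of_mul_lt_mul_right hlt
  have hrn : r ≤ C * t := by
    have : r ≤ r * l := Nat.le_mul_of_pos_right _ hl
    omega
  have hfin : Δ * (t * t) < Δ * (t * t) := by
    calc Δ * (t * t) ≤ Δ * ((t + d) * (4 * (l * q))) :=
          Nat.mul_le_mul_left _ (Nat.mul_le_mul (by omega) hql')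
      _ = (4 * l * Δ) * ((t + d) * q) := by ring
      _ < (4 * l * Δ) * (r * (d + 1) * 4 ^ l) :=
          Nat.mul_lt_mul_of_pos_left hlt' (Nat.mul_pos (by omega) (by omega))
      _ = 4 * l * 4 ^ l * (r * (Δ * (d + 1))) := by ring
      _ ≤ 4 * l * 4 ^ l * ((C * t) * (2 * t)) := Nat.mul_le_mul_left _ (Nat.mul_le_mul hrn hd')
      _ = 8 * l * C * 4 ^ l * (t * t) := by ring
      _ = Δ * (t * t) := by rw [← hΔ]
  exact lt_irrefl _ hfin

theorem hasRainbowMatching_of_linear {n t l C Δ : ℕ} {F : Fin t → Finset (Finset ℕ)} (hl : 1 ≤ l)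
    (hC : 1 ≤ C) (hΔ : Δ = 8 * l * C * 4 ^ l) (ht : (32 * Δ ^ 2 * (l + 1)) ^ 2 ≤ t)
    (hnt : 2 * (l + 1) * t < n) (hn : n ≤ C * t)
    (hF : ∀ i, F i ⊆ (range n).powersetCard (l + 1)) (hsh : ∀ i, Shifted 0 (F i))
    (hw : ∀ i, ∀ e ∈ F i, 2 ≤ #(e ∩ range ((l + 1) * (t - 1) + 1)))
    (hcard : ∀ i, n.choose (l + 1) < #(F i) + (n - t + 1).choose (l + 1)) :
    HasRainbowMatching F := by
  have hΔ1 : 1 ≤ Δ := by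
    rw [hΔ]
    exact Nat.mul_pos (Nat.mul_pos (by omega) hC) (by positivity)
  have hsqrt : 32 * Δ ^ 2 * (l + 1) ≤ Nat.sqrt t := Nat.le_sqrt'.2 ht
  have hsqrt' : Nat.sqrt t * Nat.sqrt t ≤ t := Nat.sqrt_le t
  have hlt : t < (Nat.sqrt t + 1) ^ 2 := Nat.lt_succ_sqrt' t
  set R := Nat.sqrt t
  clear_value R
  have hR : 32 * Δ * Δ ≤ R := by nlinarith [Nat.zero_le (32 * Δ ^ 2 * l)]
  have hΔR : 32 * Δ ≤ R := by nlinarith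
  have ht4 : 4 * Δ ≤ t := by nlinarith
  have hM := fun i => hasRainbowMatching_const hl hC hΔ ht4 hnt hn (hF i) (hsh i) (hw i) (hcard i)
  have hd : t < Δ * (t / Δ + 1) := Nat.lt_mul_div_succ t hΔ1
  have hd' : t / Δ + 1 ≤ t := by
    have h2 : 2 ≤ Δ := by
      rw [hΔ]
      have := Nat.mul_pos (Nat.mul_pos hl hC) (show 0 < 4 ^ l by positivity)
      nlinarith
    have := Nat.mul_div_le t Δ
    nlinarith
  have hb : t < 2 * Δ * (t / (2 * Δ) + 1) := Nat.lt_mul_div_succ t (by omega)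
  have hb' : 2 * Δ * (t / (2 * Δ)) ≤ t := Nat.mul_div_le t (2 * Δ)
  set d := t / Δ
  set b := t / (2 * Δ)
  clear_value d b
  have hbd : b ≤ d := by
    by_contra hcon
    have : Δ * (d + 1) ≤ Δ * b := Nat.mul_le_mul_left _ (by omega)
    nlinarith
  obtain ⟨c, hc⟩ : ∃ c, d + 1 = b + c := ⟨d + 1 - b, by omega⟩
  have hcΔ : t ≤ 2 * Δ * c := by
    rw [hc] at hd
    nlinarith
  have hbΔ : t ≤ 4 * Δ * b := by nlinarith
  have hb0 : 0 < b := by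
    rcases Nat.eq_zero_or_pos b with h | h
    · rw [h] at hbΔ
      omega
    · exact h
  refine hasRainbowMatching_of_matchings (k := l + 1) (b := b) (τ := t + c)
    (x := (l + 1) * (R + 1)) hsh hF (fun i => ?_) hb0 (by omega) ?_ ?_
  · have h := hM i
    rwa [show t + d + 1 = b + (t + c) by omega] at h
  · rw [mul_pow]
    exact Nat.mul_le_mul_left _ hlt.le
  · have hx : 16 * Δ ^ 2 * ((l + 1) * (R + 1)) ≤ t := by
      calc 16 * Δ ^ 2 * ((l + 1) * (R + 1)) ≤ 16 * Δ ^ 2 * ((l + 1) * (2 * R)) := by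
            gcongr
            omega
        _ = 32 * Δ ^ 2 * (l + 1) * R := by ring
        _ ≤ R * R := Nat.mul_le_mul_right _ hsqrt
        _ ≤ t := hsqrt'
    have hxb : (l + 1) * (R + 1) * (t + c) ≤ b * c := by
      refine Nat.le_of_mul_le_mul_left ?_ (show 0 < 8 * Δ ^ 2 by positivity)
      calc 8 * Δ ^ 2 * ((l + 1) * (R + 1) * (t + c))
          ≤ 8 * Δ ^ 2 * ((l + 1) * (R + 1) * (2 * t)) := by
            gcongr
            omega
        _ = 16 * Δ ^ 2 * ((l + 1) * (R + 1)) * t := by ring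
        _ ≤ t * t := Nat.mul_le_mul_right _ hx
        _ ≤ (4 * Δ * b) * (2 * Δ * c) := Nat.mul_le_mul hbΔ hcΔ
        _ = 8 * Δ ^ 2 * (b * c) := by ring
    nlinarith

theorem exists_threshold_shifted (p : ℕ) :
    ∃ N : ℕ, ∀ t n : ℕ, N + t ≤ n → 2 * (p + 2) * t < n →
      ∀ F : Fin t → Finset (Finset ℕ), (∀ i, F i ⊆ (range n).powersetCard (p + 2)) →
        (∀ i, Shifted 0 (F i)) →
        (∀ i, n.choose (p + 2) < #(F i) + (n - t + 1).choose (p + 2)) →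
        HasRainbowMatching F := by
  set C := 4 * (p + 2) ^ 3 * 4 ^ (p + 2) with hC
  have hC1 : 1 ≤ C := Nat.one_le_iff_ne_zero.2 (by positivity)
  clear_value C
  set Δ := 8 * (p + 1) * C * 4 ^ (p + 1) with hΔ
  clear_value Δ
  refine ⟨C * (32 * Δ ^ 2 * (p + 2)) ^ 2, fun t => ?_⟩
  induction t with
  | zero => exact fun n _ _ F _ _ _ => ⟨fun i => i.elim0, fun i => i.elim0, fun i => i.elim0⟩
  | succ t ih =>
    intro n hN hnt F hF hsh hcard
    by_contra hno
    obtain ⟨n, rfl⟩ : ∃ n', n = n' + 1 := ⟨n - 1, by omega⟩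
    rw [show n + 1 - (t + 1) + 1 = n - t + 1 by omega] at hcard
    have htn : t ≤ n := by omega
    have hw := two_le_card_inter (l := p + 1) hF hsh hno hcard
      (ih n (by omega) (by
        have : 2 * (p + 2) * (t + 1) = 2 * (p + 2) * t + 2 * (p + 2) := by ring
        omega))
    rcases lt_or_ge (C * (t + 1)) (n + 1) with hlt | hge
    · have h1 : #(F 0) ≤ ((p + 2) * t + 1).choose 2 * (n + 1).choose p :=
        card_le_of_two_le_card_inter (hF 0) (hw 0)
      have h2 := choose_two_mul_choose_add_le (p := p) (t := t) (n := n + 1) (hC ▸ hlt)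
      have h3 := hcard 0
      rw [show n + 1 - t = n - t + 1 by omega] at h2
      omega
    · refine hno (hasRainbowMatching_of_linear (l := p + 1) (by omega) hC1 hΔ ?_ hnt hge hF hsh hw
        ?_)
      · have : C * (32 * Δ ^ 2 * (p + 2)) ^ 2 ≤ C * (t + 1) := by omega
        exact Nat.le_of_mul_le_mul_left this hC1
      · rwa [show n + 1 - (t + 1) + 1 = n - t + 1 by omega]

end RainbowMatching

/-- Main theorem of the paper: for every `k ≥ 2` there is `n₀` such that for all
`n ≥ n₀` and `t ≥ 1` with `n > 2kt`, any family `F₁, …, F_t ⊆ C([n],k)` with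
`|F_i| > C(n,k) - C(n-t+1,k)` admits a rainbow matching. -/
theorem stmt_0 (k : ℕ) (hk : 2 ≤ k) :
    ∃ n₀ : ℕ, ∀ n t : ℕ, n₀ ≤ n → 1 ≤ t → 2 * k * t < n →
      ∀ F : Fin t → Finset (Finset (Fin n)),
        (∀ i, F i ⊆ Finset.univ.powersetCard k) →
        (∀ i, Nat.choose n k - Nat.choose (n - t + 1) k < (F i).card) →
        ∃ e : Fin t → Finset (Fin n),
          (∀ i, e i ∈ F i) ∧ ∀ i j, i ≠ j → Disjoint (e i) (e j) := by
  obtain ⟨p, rfl⟩ : ∃ p, k = p + 2 := ⟨k - 2, by omega⟩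
  obtain ⟨N, hN⟩ := RainbowMatching.exists_threshold_shifted p
  refine ⟨2 * N, fun n t hn _ hnt F hF hcard => ?_⟩
  have htn : 4 * t ≤ n := by
    have : 4 * t ≤ 2 * (p + 2) * t := Nat.mul_le_mul_right _ (by omega)
    omega
  let G : Fin t → Finset (Finset ℕ) := fun i =>
    (F i).map (Finset.mapEmbedding Fin.valEmbedding).toEmbedding
  have hG : RainbowMatching.HasRainbowMatching G := by
    by_contra hno
    obtain ⟨F', hF', hc', hs', hno'⟩ :=
      RainbowMatching.exists_shifted_of_not_hasRainbowMatching (n := n) (k := p + 2) G (by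
        intro i e he
        obtain ⟨f, hf, rfl⟩ := Finset.mem_map.1 he
        refine Finset.mem_powersetCard.2 ⟨?_, ?_⟩
        · intro x hx
          obtain ⟨y, -, rfl⟩ := Finset.mem_map.1 hx
          exact Finset.mem_range.2 y.2
        · exact (Finset.card_map _).trans (Finset.mem_powersetCard.1 (hF i hf)).2) hno
    refine hno' (hN t n (by omega) hnt F' hF' hs' fun i => ?_)
    have h1 := hcard i
    have h2 : (F' i).card = (F i).card := (hc' i).trans (Finset.card_map _)
    omega
  obtain ⟨e, he, hd⟩ := hG
  choose f hf hfe using fun i => Finset.mem_map.1 (he i)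
  refine ⟨f, hf, fun i j hij => ?_⟩
  have h := hd i j hij
  rw [← hfe, ← hfe] at h
  exact (Finset.disjoint_map Fin.valEmbedding).1 h
end

section
/- Let ζ, α be real numbers and n, k, t positive integers such that 0 < ζ < 1, n ≥ 24k³, n/(6k²) ≤ t < (1−ζ)n/k, and α < min{ ((k+1)·24^k·k^{2k})^{-1}, ζ^{k−1}·(6k²·2^k·(k−1)!)^{-1} }. Let H be a (1,k)-partite (k+1)-graph with partition classes X = {x_1,…,x_t} and [n] in which every vertex is α-good with respect to 𝔉_t(k,n), and set W = [t] and U = [n] ∖ [t]. If M is a matching in H such that |e ∩ X| = |e ∩ W| = 1 for every e ∈ M and |M| < n/(12k²), then there exists an edge f ∈ E(H) disjoint from V(M) with |f ∩ X| = |f ∩ W| = 1; in particular, M is not a maximal matching with this property. -/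
/-- `H_k(t,n)`: the `k`-graph on `Fin n` whose edges are the `k`-subsets meeting `[t]`. -/
def Hk (n k t : ℕ) : Finset (Finset (Fin n)) :=
  (Finset.univ.powersetCard k).filter fun e => ∃ v ∈ e, (v : ℕ) < t

/-- The `(1,k)`-partite `(k+1)`-graph `𝔉_t(k,n)` with partition classes `Fin t`, `Fin n`
and edges `{x_i} ∪ e` for `i ∈ [t]`, `e ∈ H_k(t,n)`. -/
def FtEdges (n k t : ℕ) : Finset (Finset (Fin t ⊕ Fin n)) :=
  Finset.univ.biUnion fun i : Fin t =>
    (Hk n k t).image fun e => insert (Sum.inl i) (e.image Sum.inr)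

/-- `N_H(v)`: the `k`-subsets `S` of the vertex set with `S ∪ {v}` an edge of `H`. -/
def nbhd {V : Type*} [Fintype V] [DecidableEq V] (k : ℕ)
    (E : Finset (Finset V)) (v : V) : Finset (Finset V) :=
  (Finset.univ.powersetCard k).filter fun S => insert v S ∈ E

/-- `|e ∩ X|`: the number of vertices of `e` in the class `X = Fin t`. -/
def Xcount {n t : ℕ} (e : Finset (Fin t ⊕ Fin n)) : ℕ :=
  (e.filter fun v => v.isLeft = true).card

/-- `|e ∩ W|` where `W = [t] ⊆ [n]`: the number of vertices `inr j ∈ e` with `j < t`. -/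
def Wcount {n : ℕ} (t' : ℕ) {t : ℕ} (e : Finset (Fin t ⊕ Fin n)) : ℕ :=
  (e.filter fun v => ∃ j : Fin n, v = Sum.inr j ∧ (j : ℕ) < t').card

/-- Deleting the vertices covered by a family `M`, each member of which meets the class `p` in at
most `c` vertices, removes at most `c * |M|` vertices of that class. -/
lemma card_filter_le_card_uncovered_add {V : Type*} [Fintype V] [DecidableEq V]
    (M : Finset (Finset V)) (p : V → Prop) [DecidablePred p] (c : ℕ)
    (h : ∀ e ∈ M, (e.filter p).card ≤ c) :
    (Finset.univ.filter p).card ≤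
      (Finset.univ.filter fun v => p v ∧ v ∉ M.biUnion id).card + M.card * c := by
  have hsub : Finset.univ.filter p ⊆
      (Finset.univ.filter fun v => p v ∧ v ∉ M.biUnion id) ∪ M.biUnion fun e => e.filter p := by
    intro v hv
    simp only [Finset.mem_filter, Finset.mem_univ, true_and, Finset.mem_union,
      Finset.mem_biUnion, id] at hv ⊢
    by_cases hB : ∃ e ∈ M, v ∈ e
    · obtain ⟨e, he, hve⟩ := hB
      exact Or.inr ⟨e, he, hve, hv⟩
    · exact Or.inl ⟨hv, hB⟩
  calc _ ≤ _ := Finset.card_le_card hsub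
    _ ≤ _ := Finset.card_union_le _ _
    _ ≤ _ := by gcongr; exact Finset.card_biUnion_le_card_mul _ _ _ h

/-- Adding one vertex of `A` to an `m`-subset of `B`, where `A` and `B` are disjoint, gives
`|A| * C(|B|, m)` different sets. -/
lemma card_image_insert_powersetCard {V : Type*} [DecidableEq V] (A B : Finset V)
    (hAB : Disjoint A B) (m : ℕ) :
    ((A ×ˢ B.powersetCard m).image fun q => insert q.1 q.2).card = A.card * B.card.choose m := by
  rw [Finset.card_image_of_injOn, Finset.card_product, Finset.card_powersetCard]
  rintro ⟨a, S⟩ h1 ⟨b, T⟩ h2 h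
  simp only [Finset.coe_product, Set.mem_prod, Finset.mem_coe, Finset.mem_powersetCard] at h1 h2
  have hne : ∀ a ∈ A, ∀ T ⊆ B, a ∉ T := fun a ha T hT haT =>
    Finset.disjoint_left.mp hAB ha (hT haT)
  simp only at h
  have hab : a = b := by
    have : a ∈ insert b T := h ▸ Finset.mem_insert_self a S
    exact (Finset.mem_insert.mp this).resolve_right (hne a h1.1 T h2.2.1)
  subst hab
  have hST : S = T := by
    rw [← Finset.erase_insert (hne a h1.1 S h1.2.1), h,
      Finset.erase_insert (hne a h1.1 T h2.2.1)]
  rw [hST]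

lemma card_filter_inr {n t : ℕ} (p : Fin n → Prop) [DecidablePred p] :
    (Finset.univ.filter fun v : Fin t ⊕ Fin n => ∃ j : Fin n, v = Sum.inr j ∧ p j).card =
      (Finset.univ.filter p).card := by
  rw [← Finset.card_map (Function.Embedding.inr : Fin n ↪ Fin t ⊕ Fin n)]
  congr 1
  ext v
  simp only [Finset.mem_filter, Finset.mem_univ, true_and, Finset.mem_map,
    Function.Embedding.inr_apply]
  exact ⟨fun ⟨j, h, hj⟩ => ⟨j, hj, h.symm⟩, fun ⟨j, hj, h⟩ => ⟨j, h.symm, hj⟩⟩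

lemma card_filter_inl {n t : ℕ} :
    (Finset.univ.filter fun v : Fin t ⊕ Fin n => v.isLeft = true).card = t := by
  have : (Finset.univ.filter fun v : Fin t ⊕ Fin n => v.isLeft = true) =
      Finset.univ.map Function.Embedding.inl := by
    ext v
    cases v <;> simp
  rw [this, Finset.card_map, Finset.card_univ, Fintype.card_fin]

/-- Every edge splits into its parts in `X`, in `W = [t]` and in `U = [n] ∖ [t]`. -/
lemma Xcount_add_Wcount_add_card {n t : ℕ} (e : Finset (Fin t ⊕ Fin n)) :
    Xcount e + Wcount t e +
      (e.filter fun v => ∃ j : Fin n, v = Sum.inr j ∧ t ≤ (j : ℕ)).card = e.card := by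
  unfold Xcount Wcount
  rw [← Finset.card_union_of_disjoint, ← Finset.card_union_of_disjoint]
  · congr 1
    ext v
    cases v with
    | inl i => simp
    | inr j => simp [← and_or_left, lt_or_ge]
  · rw [Finset.disjoint_left]
    rintro (i | j) <;> simp +contextual
  · rw [Finset.disjoint_left]
    rintro (i | j) <;> simp +contextual

/-- Every `k`-subset of `[n]` that meets `[t]` lies in the neighbourhood of every vertex of `X` in
`𝔉_t(k,n)`. -/
lemma mem_nbhd_FtEdges {n k t : ℕ} (i : Fin t) (S : Finset (Fin t ⊕ Fin n)) (hS : S.card = k)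
    (hX : ∀ v ∈ S, ∃ j : Fin n, v = Sum.inr j)
    (hW : ∃ j : Fin n, Sum.inr j ∈ S ∧ (j : ℕ) < t) :
    S ∈ nbhd k (FtEdges n k t) (Sum.inl i) := by
  have hSe : ((Finset.univ.filter fun j : Fin n => Sum.inr j ∈ S).image Sum.inr) = S := by
    ext v
    simp only [Finset.mem_image, Finset.mem_filter, Finset.mem_univ, true_and]
    constructor
    · rintro ⟨j, hj, rfl⟩
      exact hj
    · intro hv
      obtain ⟨j, rfl⟩ := hX v hv
      exact ⟨j, hv, rfl⟩
  simp only [nbhd, FtEdges, Finset.mem_filter, Finset.mem_powersetCard, Finset.subset_univ,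
    true_and, hS, Finset.mem_biUnion, Finset.mem_univ, Finset.mem_image]
  refine ⟨i, _, ?_, by rw [hSe]⟩
  obtain ⟨j, hj, hjt⟩ := hW
  simp only [Hk, Finset.mem_filter, Finset.mem_powersetCard, Finset.subset_univ, true_and]
  refine ⟨?_, j, by simpa using hj, hjt⟩
  rw [← hS]
  conv_rhs => rw [← hSe]
  rw [Finset.card_image_of_injective _ Sum.inr_injective]

/-- The number of sets `{w} ∪ S` with `w` among `a` vertices and `S` a `(k - 1)`-subset of `u`
vertices exceeds the goodness threshold. -/
lemma threshold_lt_mul_choose {ζ α : ℝ} {n k t m a u : ℕ} (hn0 : 0 < n) (hk : 0 < k)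
    (hζ0 : 0 < ζ) (hζ1 : ζ < 1) (hn : 24 * k ^ 3 ≤ n)
    (htlb : (n : ℝ) / (6 * k ^ 2) ≤ t) (htn : (t : ℝ) < (1 - ζ) * n / k)
    (hα : α < ζ ^ (k - 1) * (6 * (k : ℝ) ^ 2 * 2 ^ k * ((k - 1).factorial : ℝ))⁻¹)
    (hm : (m : ℝ) < (n : ℝ) / (12 * k ^ 2))
    (ha : t ≤ a + m) (hu : n ≤ t + u + m * (k - 1)) :
    α * (n : ℝ) ^ k < ((a * u.choose (k - 1) : ℕ) : ℝ) := by
  obtain ⟨l, rfl⟩ : ∃ l, k = l + 1 := ⟨k - 1, by omega⟩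
  simp only [Nat.add_sub_cancel] at *
  have hnR : (0 : ℝ) < n := by exact_mod_cast hn0
  have ha' : (t : ℝ) ≤ a + m := by exact_mod_cast ha
  have hu' : (n : ℝ) ≤ t + u + m * l := by exact_mod_cast hu
  have hn' : (24 : ℝ) * (l + 1) ^ 3 ≤ n := by exact_mod_cast hn
  have hK : (0 : ℝ) < (l : ℝ) + 1 := by positivity
  push_cast at htlb htn hα hm ⊢
  have hA : (n : ℝ) / (12 * (l + 1) ^ 2) ≤ a := by
    have : (n : ℝ) / (6 * (l + 1) ^ 2) = 2 * (n / (12 * (l + 1) ^ 2)) := by field_simp; norm_num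
    linarith
  have hC : (ζ * n / 2) ^ l / (l.factorial : ℝ) ≤ (u.choose l : ℝ) := by
    rcases Nat.eq_zero_or_pos l with rfl | hl
    · simp
    have hl1 : (1 : ℝ) ≤ l := by exact_mod_cast hl
    have hbig : ζ * n / 2 + l ≤ (u : ℝ) + 1 := by
      rw [lt_div_iff₀ hK] at htn
      rw [lt_div_iff₀ (by positivity)] at hm
      have h1 : (t : ℝ) + ζ * n / 2 ≤ n / 2 := by
        have h0 : 0 ≤ (1 - ζ) * n * ((l : ℝ) - 1) :=
          mul_nonneg (mul_nonneg (by linarith) hnR.le) (by linarith)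
        refine le_of_mul_le_mul_right ?_ hK
        linarith
      have h2 : (m : ℝ) * l ≤ n / 12 := by
        have h0 : (m : ℝ) * l ≤ m * (l + 1) ^ 2 :=
          mul_le_mul_of_nonneg_left (by nlinarith) (Nat.cast_nonneg m)
        linarith
      have h3 : (l : ℝ) ≤ n / 24 := by
        have h0 : (l : ℝ) + 1 ≤ (l + 1) ^ 3 := le_self_pow₀ (by linarith) (by norm_num)
        linarith
      linarith
    have hlu : l ≤ u + 1 := by
      have : (l : ℝ) ≤ u + 1 := by nlinarith [mul_pos hζ0 hnR]
      exact_mod_cast this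
    refine le_trans ?_ (Nat.pow_le_choose l u)
    gcongr
    push_cast [Nat.cast_sub hlu]
    linarith
  calc α * (n : ℝ) ^ (l + 1)
      < ζ ^ l * (6 * ((l : ℝ) + 1) ^ 2 * 2 ^ (l + 1) * (l.factorial : ℝ))⁻¹ * (n : ℝ) ^ (l + 1) := by
        gcongr
    _ = n / (12 * (l + 1) ^ 2) * ((ζ * n / 2) ^ l / (l.factorial : ℝ)) := by
        have : (l.factorial : ℝ) ≠ 0 := by positivity
        rw [div_pow, mul_pow]
        field_simp
        ring
    _ ≤ a * u.choose l := by gcongr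

/-- The claim in the proof of Lemma 3.1: under the hypotheses of that lemma together with
`n/(6k²) ≤ t`, any matching `M` in `H` with `|e ∩ X| = |e ∩ W| = 1` for each `e ∈ M` and
`|M| < n/(12k²)` can be extended: there is an edge `f` of `H` disjoint from `V(M)` with
`|f ∩ X| = |f ∩ W| = 1`. -/
theorem stmt_3 (ζ α : ℝ) (n k t : ℕ) (hn0 : 0 < n) (hk : 0 < k) (ht : 0 < t)
    (hζ0 : 0 < ζ) (hζ1 : ζ < 1) (hn : 24 * k ^ 3 ≤ n)
    (htlb : (n : ℝ) / (6 * k ^ 2) ≤ t) (htn : (t : ℝ) < (1 - ζ) * n / k)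
    (hα : α < min ((((k : ℝ) + 1) * 24 ^ k * (k : ℝ) ^ (2 * k))⁻¹)
      (ζ ^ (k - 1) * (6 * (k : ℝ) ^ 2 * 2 ^ k * ((k - 1).factorial : ℝ))⁻¹))
    (H : Finset (Finset (Fin t ⊕ Fin n)))
    (hpart : ∀ e ∈ H, Xcount e = 1 ∧ e.card = k + 1)
    (hgood : ∀ v : Fin t ⊕ Fin n,
      ((nbhd k (FtEdges n k t) v \ nbhd k H v).card : ℝ) ≤ α * (n : ℝ) ^ k)
    (M : Finset (Finset (Fin t ⊕ Fin n))) (hMH : M ⊆ H)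
    (hMdisj : ∀ e ∈ M, ∀ f ∈ M, e ≠ f → Disjoint e f)
    (hMXW : ∀ e ∈ M, Xcount e = 1 ∧ Wcount t e = 1)
    (hMcard : (M.card : ℝ) < (n : ℝ) / (12 * k ^ 2)) :
    ∃ f ∈ H, Disjoint f (M.biUnion id) ∧ Xcount f = 1 ∧ Wcount t f = 1 := by
  have htn' : t ≤ n := by
    have hkR : (1 : ℝ) ≤ k := by exact_mod_cast hk
    have hnR : (0 : ℝ) < n := by exact_mod_cast hn0
    have h1 : (1 - ζ) * n / k ≤ n := by
      rw [div_le_iff₀ (by linarith)]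
      nlinarith
    exact_mod_cast (htn.trans_le h1).le
  have hXle := card_filter_le_card_uncovered_add M
    (fun v : Fin t ⊕ Fin n => v.isLeft = true) 1 fun e he => (hMXW e he).1.le
  have hWle := card_filter_le_card_uncovered_add M
    (fun v : Fin t ⊕ Fin n => ∃ j : Fin n, v = Sum.inr j ∧ (j : ℕ) < t) 1
    fun e he => (hMXW e he).2.le
  have hUle := card_filter_le_card_uncovered_add M
    (fun v : Fin t ⊕ Fin n => ∃ j : Fin n, v = Sum.inr j ∧ t ≤ (j : ℕ)) (k - 1) fun e he => by
      have h1 := Xcount_add_Wcount_add_card e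
      have h2 := hMXW e he
      have h3 := hpart e (hMH he)
      omega
  rw [card_filter_inl] at hXle
  have hWc : (Finset.univ.filter fun j : Fin n => (j : ℕ) < t).card = t := by
    rw [Fin.card_filter_val_lt, min_eq_right htn']
  have hUc : t + (Finset.univ.filter fun j : Fin n => t ≤ (j : ℕ)).card = n := by
    have := Finset.card_filter_add_card_filter_not (s := (Finset.univ : Finset (Fin n)))
      (fun j : Fin n => (j : ℕ) < t)
    simpa only [not_lt, hWc, Finset.card_univ, Fintype.card_fin] using this
  rw [card_filter_inr, hWc] at hWle
  rw [card_filter_inr] at hUle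
  set A := Finset.univ.filter fun v : Fin t ⊕ Fin n =>
    (∃ j : Fin n, v = Sum.inr j ∧ (j : ℕ) < t) ∧ v ∉ M.biUnion id
  set B := Finset.univ.filter fun v : Fin t ⊕ Fin n =>
    (∃ j : Fin n, v = Sum.inr j ∧ t ≤ (j : ℕ)) ∧ v ∉ M.biUnion id
  have hAB : Disjoint A B := by
    rw [Finset.disjoint_left]
    intro v hvA hvB
    obtain ⟨⟨i, rfl, hi⟩, -⟩ := (Finset.mem_filter.mp hvA).2
    obtain ⟨⟨j, hij, hj⟩, -⟩ := (Finset.mem_filter.mp hvB).2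
    cases hij
    omega
  obtain ⟨x, hx⟩ : ∃ x : Fin t, Sum.inl x ∉ M.biUnion id := by
    have hMt : M.card < t := by
      have : (n : ℝ) / (12 * k ^ 2) ≤ n / (6 * k ^ 2) := by
        gcongr
        norm_num
      exact_mod_cast (hMcard.trans_le this).trans_le htlb
    obtain ⟨v, hv⟩ := Finset.card_pos.mp (show 0 < (Finset.univ.filter fun v : Fin t ⊕ Fin n =>
      v.isLeft = true ∧ v ∉ M.biUnion id).card by omega)
    obtain ⟨hl, hvB⟩ := (Finset.mem_filter.mp hv).2
    obtain ⟨x, rfl⟩ := Sum.isLeft_iff.mp hl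
    exact ⟨x, hvB⟩
  have hlt : (nbhd k (FtEdges n k t) (Sum.inl x) \ nbhd k H (Sum.inl x)).card <
      ((A ×ˢ B.powersetCard (k - 1)).image fun q => insert q.1 q.2).card := by
    rw [card_image_insert_powersetCard A B hAB]
    exact_mod_cast (hgood (Sum.inl x)).trans_lt (threshold_lt_mul_choose hn0 hk hζ0 hζ1 hn htlb htn
      (hα.trans_le (min_le_right _ _)) hMcard (by omega) (by omega))
  obtain ⟨S, hS, hSnot⟩ := Finset.exists_mem_notMem_of_card_lt_card hlt
  obtain ⟨⟨w, T⟩, hq, rfl⟩ := Finset.mem_image.mp hS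
  obtain ⟨hw, hT⟩ := Finset.mem_product.mp hq
  obtain ⟨hTB, hTcard⟩ := Finset.mem_powersetCard.mp hT
  simp only at hw hTB hTcard hSnot
  obtain ⟨⟨j, rfl, hj⟩, hjM⟩ := (Finset.mem_filter.mp hw).2
  have hTU : ∀ v ∈ T, (∃ j : Fin n, v = Sum.inr j ∧ t ≤ (j : ℕ)) ∧ v ∉ M.biUnion id :=
    fun v hv => (Finset.mem_filter.mp (hTB hv)).2
  have hjT : Sum.inr j ∉ T := fun h => Finset.disjoint_left.mp hAB hw (hTB h)
  have hF : insert (Sum.inr j) T ∈ nbhd k (FtEdges n k t) (Sum.inl x) := by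
    refine mem_nbhd_FtEdges x _ ?_ ?_ ⟨j, Finset.mem_insert_self _ _, hj⟩
    · rw [Finset.card_insert_of_notMem hjT]
      omega
    · intro v hv
      rcases Finset.mem_insert.mp hv with rfl | hv
      · exact ⟨j, rfl⟩
      · obtain ⟨⟨i, hi, -⟩, -⟩ := hTU v hv
        exact ⟨i, hi⟩
  have hH : insert (Sum.inl x) (insert (Sum.inr j) T) ∈ H := by
    by_contra hcon
    exact hSnot (Finset.mem_sdiff.mpr ⟨hF, fun h => hcon (Finset.mem_filter.mp h).2⟩)
  refine ⟨_, hH, ?_, (hpart _ hH).1, ?_⟩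
  · rw [Finset.disjoint_insert_left, Finset.disjoint_insert_left, Finset.disjoint_left]
    exact ⟨hx, hjM, fun v hv => (hTU v hv).2⟩
  · rw [Wcount, Finset.card_eq_one]
    refine ⟨Sum.inr j, ?_⟩
    ext v
    simp only [Finset.mem_filter, Finset.mem_insert, Finset.mem_singleton]
    constructor
    · rintro ⟨rfl | rfl | hv, i, hi, hit⟩
      · cases hi
      · rfl
      · obtain ⟨⟨i', hi', hit'⟩, -⟩ := hTU v hv
        rw [hi] at hi'
        cases hi'
        omega
    · rintro rfl
      exact ⟨Or.inr (Or.inl rfl), j, rfl, hj⟩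
end

section
/- Let 0 < ζ < 1 and 0 < ε < 1 be real numbers and k ≥ 3, t ≥ 0, n ≥ 1 integers such that t < (1−ζ)(1−k(k+1)√ε)·n/k, n ≥ 48k³, and 2^k·√ε < min{ ((k+1)·24^k·k^{2k})^{-1}, ζ^{k−1}·(6k²·2^k·(k−1)!)^{-1} }. Let F_1, …, F_t ⊆ C([n],k) satisfy |F_i| > C(n,k) − C(n−t+1,k) for every i ∈ [t], and let 𝔉^t(k,n) be the corresponding (1,k)-partite (k+1)-graph. If 𝔉^t(k,n) is ε-close to 𝔉_t(k,n), then 𝔉^t(k,n) has a matching of size t (equivalently, {F_1,…,F_t} admits a rainbow matching). -/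
/-- `𝔉^t(k,n)` built from a family `F : Fin t → Finset (Finset (Fin n))`. -/
def Fedges (n k t : ℕ) (F : Fin t → Finset (Finset (Fin n))) :
    Finset (Finset (Fin t ⊕ Fin n)) :=
  Finset.univ.biUnion fun i : Fin t =>
    (F i).image fun e => insert (Sum.inl i) (e.image Sum.inr)

/-- `E₂` is `ε`-close to `E₁`: some isomorphic copy (relabelling of the common vertex set)
of `E₂` misses at most `ε·|E₁|` edges of `E₁`. -/
def isClose {V : Type*} [DecidableEq V] (E₁ E₂ : Finset (Finset V)) (ε : ℝ) : Prop :=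
  ∃ σ : Equiv.Perm V, ((E₁ \ E₂.image fun e => e.image σ).card : ℝ) ≤ ε * E₁.card

section RainbowMatching

variable {ι α : Type*} [DecidableEq α]

/-- The families `F i`, `i ∈ I`, have pairwise disjoint representatives. -/
def HasRainbowMatching (F : ι → Finset (Finset α)) (I : Finset ι) : Prop :=
  ∃ e : ι → Finset α, (∀ i ∈ I, e i ∈ F i) ∧ (I : Set ι).PairwiseDisjoint e

theorem hasRainbowMatching_insert [DecidableEq ι] {F : ι → Finset (Finset α)} {I : Finset ι} {a : ι}
    (ha : a ∉ I) {e : ι → Finset α} (he : ∀ i ∈ I, e i ∈ F i)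
    (hd : (I : Set ι).PairwiseDisjoint e) {A : Finset α} (hA : A ∈ F a)
    (hdA : Disjoint A (I.biUnion e)) : HasRainbowMatching F (insert a I) := by
  have hne : ∀ i ∈ I, i ≠ a := fun i hi h => ha (h ▸ hi)
  refine ⟨Function.update e a A, ?_, ?_⟩
  · intro i hi
    rcases Finset.mem_insert.1 hi with rfl | hi
    · simpa using hA
    · simpa [Function.update_of_ne (hne i hi)] using he i hi
  · rw [Finset.coe_insert, Set.pairwiseDisjoint_insert_of_notMem (by simpa using ha)]
    refine ⟨?_, ?_⟩
    · intro i hi j hj hij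
      have h := hd hi hj hij
      simpa [Function.onFun, Function.update_of_ne (hne i hi),
        Function.update_of_ne (hne j hj)] using h
    · intro j hj
      simpa [Function.update_of_ne (hne j hj)] using
        (Finset.disjoint_biUnion_right _ _ _).1 hdA j hj

theorem card_biUnion_le_mul_of_mem {F : ι → Finset (Finset α)} {I : Finset ι} {k : ℕ}
    (hF : ∀ i ∈ I, ∀ e ∈ F i, e.card ≤ k) {e : ι → Finset α} (he : ∀ i ∈ I, e i ∈ F i) :
    (I.biUnion e).card ≤ I.card * k :=
  Finset.card_biUnion_le_card_mul _ _ _ fun i hi => hF i hi _ (he i hi)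

theorem hasRainbowMatching_of_greedy [DecidableEq ι] (F : ι → Finset (Finset α)) (k c : ℕ)
    (I : Finset ι)
    (hc : (I.card - 1) * k ≤ c) (hF : ∀ i ∈ I, ∀ e ∈ F i, e.card ≤ k)
    (h : ∀ i ∈ I, ∀ U : Finset α, U.card ≤ c → ∃ e ∈ F i, Disjoint e U) :
    HasRainbowMatching F I := by
  induction I using Finset.induction_on with
  | empty => exact ⟨fun _ => ∅, by simp, by simp⟩
  | insert a I ha ih =>
    rw [Finset.card_insert_of_notMem ha, Nat.add_sub_cancel] at hc
    have hF' : ∀ i ∈ I, ∀ e ∈ F i, e.card ≤ k :=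
      fun i hi => hF i (Finset.mem_insert_of_mem hi)
    obtain ⟨e, he, hd⟩ := ih ((Nat.mul_le_mul_right k (Nat.sub_le _ _)).trans hc) hF'
      (fun i hi => h i (Finset.mem_insert_of_mem hi))
    obtain ⟨A, hA, hdA⟩ := h a (Finset.mem_insert_self a I) (I.biUnion e)
      ((card_biUnion_le_mul_of_mem hF' he).trans hc)
    exact hasRainbowMatching_insert ha he hd hA hdA

theorem card_filter_not_disjoint_le (G : Finset (Finset α)) (U : Finset α) (d : ℕ)
    (hd : ∀ u ∈ U, (G.filter (u ∈ ·)).card ≤ d) :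
    (G.filter fun e => ¬ Disjoint e U).card ≤ U.card * d := by
  refine le_trans (Finset.card_le_card ?_)
    (Finset.card_biUnion_le_card_mul U (fun u => G.filter (u ∈ ·)) d hd)
  intro e he
  obtain ⟨heG, h⟩ := Finset.mem_filter.1 he
  obtain ⟨u, hu, hu'⟩ := Finset.not_disjoint_iff.1 h
  exact Finset.mem_biUnion.2 ⟨u, hu', Finset.mem_filter.2 ⟨heG, hu⟩⟩

theorem exists_disjoint_of_degree_le (G : Finset (Finset α)) (U : Finset α) (d : ℕ)
    (hd : ∀ u ∈ U, (G.filter (u ∈ ·)).card ≤ d) (h : U.card * d < G.card) :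
    ∃ e ∈ G, Disjoint e U := by
  by_contra! hcon
  have := card_filter_not_disjoint_le G U d hd
  rw [Finset.filter_true_of_mem hcon] at this
  omega

theorem choose_le_choose_sub_add (m r j : ℕ) (hj : j ≤ m) :
    (m + 1).choose (r + 1) ≤ (m + 1 - j).choose (r + 1) + j * m.choose r := by
  induction j with
  | zero => simp
  | succ j ih =>
    have h1 := ih (by omega)
    have h2 : (m + 1 - j).choose (r + 1) = (m - j).choose r + (m - j).choose (r + 1) := by
      rw [show m + 1 - j = (m - j) + 1 by omega, Nat.choose_succ_succ]
    have h3 : (m - j).choose r ≤ m.choose r := Nat.choose_le_choose r (Nat.sub_le _ _)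
    rw [show m + 1 - (j + 1) = m - j by omega, add_mul, one_mul]
    omega

theorem choose_sub_add_mul_le (m r j : ℕ) (hj : j ≤ m + 1) :
    (m + 2 - j).choose (r + 2) + j * (m + 1).choose (r + 1)
      ≤ (m + 2).choose (r + 2) + j ^ 2 * m.choose r := by
  induction j with
  | zero => simp
  | succ j ih =>
    have h1 := ih (by omega)
    have h2 : (m + 2 - j).choose (r + 2)
        = (m + 1 - j).choose (r + 1) + (m + 1 - j).choose (r + 2) := by
      rw [show m + 2 - j = (m + 1 - j) + 1 by omega, Nat.choose_succ_succ]
    have h3 := choose_le_choose_sub_add m r j (by omega)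
    rw [show m + 2 - (j + 1) = m + 1 - j by omega]
    nlinarith [Nat.zero_le (j * m.choose r), Nat.zero_le (m.choose r)]

/-- Families of `k`-sets larger than the trivial extremal example have a rainbow matching,
provided the ground set is large compared with the number of families. -/
theorem hasRainbowMatching_of_card [DecidableEq ι] (k : ℕ) (hk : 2 ≤ k) (I : Finset ι)
    (S : Finset α)
    (F : ι → Finset (Finset α)) (hF : ∀ i ∈ I, F i ⊆ S.powersetCard k)
    (hS : k ^ 3 * I.card ≤ S.card)
    (hcard : ∀ i ∈ I, S.card.choose k < (F i).card + (S.card - I.card + 1).choose k) :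
    HasRainbowMatching F I := by
  obtain ⟨b, hb⟩ : ∃ b, I.card = b := ⟨_, rfl⟩
  induction b generalizing I S F with
  | zero => rw [Finset.card_eq_zero.1 hb]; exact ⟨fun _ => ∅, by simp, by simp⟩
  | succ b ih =>
    rw [hb] at hS hcard
    have hk3 : 8 ≤ k ^ 3 := by
      calc 8 = 2 ^ 3 := rfl
        _ ≤ k ^ 3 := Nat.pow_le_pow_left hk 3
    have hSb : k ^ 3 * b + 8 ≤ S.card := by
      rw [mul_add, mul_one] at hS; omega
    have hbS : 8 * b + 8 ≤ S.card := by nlinarith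
    obtain ⟨m, hm⟩ : ∃ m, S.card = m + 2 := ⟨S.card - 2, by omega⟩
    obtain ⟨r, rfl⟩ : ∃ r, k = r + 2 := ⟨k - 2, by omega⟩
    have hsz : ∀ i ∈ I, ∀ e ∈ F i, e ⊆ S ∧ e.card = r + 2 :=
      fun i hi e he => Finset.mem_powersetCard.1 (hF i hi he)
    have hdeg1 : ∀ i ∈ I, ∀ v ∈ S, ((F i).filter (v ∈ ·)).card ≤ (m + 1).choose (r + 1) := by
      intro i hi v hv
      have := Finset.card_filter_powersetCard_subset {v} S (r + 2)
        (by simpa using hv) (by simp)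
      simp only [Finset.card_singleton, Finset.singleton_subset_iff, hm] at this
      exact (Finset.card_le_card (Finset.filter_subset_filter _ (hF i hi))).trans this.le
    by_cases hdeg : ∃ i ∈ I, ∃ v ∈ S,
        b * (r + 2) * m.choose r < ((F i).filter (v ∈ ·)).card
    · obtain ⟨i, hi, v, hv, hiv⟩ := hdeg
      have hIe : (I.erase i).card = b := by rw [Finset.card_erase_of_mem hi, hb]; rfl
      have hSe : (S.erase v).card = m + 1 := by rw [Finset.card_erase_of_mem hv, hm]; rfl
      obtain ⟨e, he, hd⟩ := ih (I.erase i) (S.erase v) (fun j => (F j).filter (v ∉ ·))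
        (by
          intro j hj e he
          obtain ⟨he, hve⟩ := Finset.mem_filter.1 he
          obtain ⟨h1, h2⟩ := hsz j (Finset.mem_of_mem_erase hj) e he
          exact Finset.mem_powersetCard.2 ⟨Finset.subset_erase.2 ⟨h1, hve⟩, h2⟩)
        (by rw [hIe, hSe]; omega)
        (by
          intro j hj
          have hjI := Finset.mem_of_mem_erase hj
          have h1 := hcard j hjI
          have h2 := hdeg1 j hjI v hv
          have h3 := Finset.card_filter_add_card_filter_not (s := F j) (v ∈ ·)
          have h4 : (m + 2).choose (r + 2) = (m + 1).choose (r + 1) + (m + 1).choose (r + 2) :=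
            Nat.choose_succ_succ (m + 1) (r + 1)
          rw [hIe, hSe]
          rw [hm, show m + 2 - (b + 1) + 1 = m + 1 - b + 1 by omega] at h1
          omega) hIe
      have hU : ((I.erase i).biUnion e).card ≤ b * (r + 2) := by
        rw [← hIe]
        exact card_biUnion_le_mul_of_mem (fun j hj f hf =>
          (hsz j (Finset.mem_of_mem_erase hj) f (Finset.mem_of_mem_filter f hf)).2.le) he
      obtain ⟨A, hA, hdA⟩ := exists_disjoint_of_degree_le ((F i).filter (v ∈ ·))
        ((I.erase i).biUnion e) (m.choose r) (by
          intro u hu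
          obtain ⟨j, hj, huj⟩ := Finset.mem_biUnion.1 hu
          obtain ⟨hjF, hvj⟩ := Finset.mem_filter.1 (he j hj)
          have huv : v ≠ u := fun h => hvj (h ▸ huj)
          have huS : u ∈ S := (hsz j (Finset.mem_of_mem_erase hj) _ hjF).1 huj
          have := Finset.card_filter_powersetCard_subset {v, u} S (r + 2)
            (by simp [Finset.insert_subset_iff, hv, huS])
            (by rw [Finset.card_pair huv]; omega)
          rw [Finset.card_pair huv, hm] at this
          refine le_trans (Finset.card_le_card ?_) this.le
          intro f hf
          simp only [Finset.mem_filter] at hf ⊢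
          refine ⟨hF i hi hf.1.1, ?_⟩
          simp [Finset.insert_subset_iff, hf.1.2, hf.2])
        ((Nat.mul_le_mul_right _ hU).trans_lt hiv)
      rw [← Finset.insert_erase hi]
      exact hasRainbowMatching_insert (Finset.notMem_erase i I)
        (fun j hj => Finset.mem_of_mem_filter _ (he j hj)) hd
        (Finset.mem_of_mem_filter _ hA) hdA
    · push Not at hdeg
      refine hasRainbowMatching_of_greedy F (r + 2) (b * (r + 2)) I (by rw [hb]; rfl)
        (fun i hi e he => (hsz i hi e he).2.le) ?_
      intro i hi U hU
      refine exists_disjoint_of_degree_le (F i) U (b * (r + 2) * m.choose r) ?_ ?_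
      · intro u _
        by_cases huS : u ∈ S
        · exact hdeg i hi u huS
        · rw [Finset.filter_false_of_mem fun e he hue => huS ((hsz i hi e he).1 hue)]
          simp
      · have h1 := hcard i hi
        have h2 := choose_sub_add_mul_le m r b (by omega)
        have h3 : (m + 1) * m.choose r = (m + 1).choose (r + 1) * (r + 1) :=
          Nat.add_one_mul_choose_eq m r
        rw [hm, show m + 2 - (b + 1) + 1 = m + 2 - b by omega] at h1
        have h4 : U.card * (b * (r + 2) * m.choose r)
            ≤ b * (r + 2) * (b * (r + 2) * m.choose r) := Nat.mul_le_mul_right _ hU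
        have h5 : ((r + 2) ^ 2 + 1) * b * m.choose r ≤ (m + 1).choose (r + 1) := by
          refine Nat.le_of_mul_le_mul_right ?_ (Nat.succ_pos r)
          rw [← h3]
          calc ((r + 2) ^ 2 + 1) * b * m.choose r * (r + 1)
              = ((r + 2) ^ 2 + 1) * (r + 1) * b * m.choose r := by ring
            _ ≤ (m + 1) * m.choose r := by
              refine Nat.mul_le_mul_right _ ?_
              have : ((r + 2) ^ 2 + 1) * (r + 1) ≤ (r + 2) ^ 3 := by nlinarith
              have := Nat.mul_le_mul_right b this
              omega
        have h6 := Nat.mul_le_mul_left b h5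
        nlinarith

end RainbowMatching

section DenseFamilies

variable {ι α : Type*} [DecidableEq ι] [DecidableEq α]

theorem card_mul_choose_le_card_filter_meet [Fintype α] {A B C : Finset α} (hAB : Disjoint A B)
    (hAC : Disjoint A C) (hBC : Disjoint B C) {k : ℕ} (hk : 3 ≤ k) :
    A.card * B.card * C.card * (Fintype.card α).choose k ≤
      ((Finset.univ.powersetCard k).filter fun e : Finset α =>
        ¬ Disjoint e A ∧ ¬ Disjoint e B ∧ ¬ Disjoint e C).card * k ^ 3 * Fintype.card α ^ 3 := by
  set N := ((Finset.univ.powersetCard k).filter fun e : Finset α =>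
        ¬ Disjoint e A ∧ ¬ Disjoint e B ∧ ¬ Disjoint e C) with hN
  rcases lt_or_ge (Fintype.card α) 3 with hn | hn
  · rw [Nat.choose_eq_zero_of_lt (by omega)]; simp
  have hcount : (A ×ˢ B ×ˢ C).card * (Fintype.card α - 3).choose (k - 3) ≤ N.card * k ^ 3 := by
    refine Finset.card_mul_le_card_mul (fun (x : α × α × α) (e : Finset α) =>
      ({x.1, x.2.1, x.2.2} : Finset α) ⊆ e) ?_ ?_
    · rintro ⟨a, b, c⟩ hx
      simp only [Finset.mem_product] at hx
      obtain ⟨ha, hb, hc⟩ := hx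
      have h3 : ({a, b, c} : Finset α).card = 3 :=
        Finset.card_eq_three.2 ⟨a, b, c, Finset.disjoint_iff_ne.1 hAB a ha b hb,
          Finset.disjoint_iff_ne.1 hAC a ha c hc, Finset.disjoint_iff_ne.1 hBC b hb c hc, rfl⟩
      have h := Finset.card_filter_powersetCard_subset {a, b, c} (Finset.univ : Finset α) k
        (Finset.subset_univ _) (by omega)
      rw [h3, Finset.card_univ] at h
      rw [← h]
      refine Finset.card_le_card fun e he => ?_
      simp only [Finset.mem_filter] at he
      have h' := he.2
      simp only [Finset.insert_subset_iff, Finset.singleton_subset_iff] at h'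
      refine Finset.mem_filter.2 ⟨Finset.mem_filter.2 ⟨he.1, ?_, ?_, ?_⟩, he.2⟩
      · exact Finset.not_disjoint_iff.2 ⟨a, h'.1, ha⟩
      · exact Finset.not_disjoint_iff.2 ⟨b, h'.2.1, hb⟩
      · exact Finset.not_disjoint_iff.2 ⟨c, h'.2.2, hc⟩
    · intro e he
      have hek : e.card = k := (Finset.mem_powersetCard.1 (Finset.mem_filter.1 he).1).2
      calc _ ≤ (e ×ˢ e ×ˢ e).card := by
            refine Finset.card_le_card fun x hx => ?_
            have := (Finset.mem_filter.1 hx).2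
            simpa [Finset.insert_subset_iff] using this
        _ = k ^ 3 := by simp only [Finset.card_product, hek]; ring
  rw [Finset.card_product, Finset.card_product] at hcount
  obtain ⟨r, rfl⟩ : ∃ r, k = r + 3 := ⟨k - 3, by omega⟩
  obtain ⟨m, hm⟩ : ∃ m, Fintype.card α = m + 3 := ⟨Fintype.card α - 3, by omega⟩
  rw [hm] at hcount ⊢
  simp only [Nat.add_sub_cancel] at hcount
  have e1 := Nat.add_one_mul_choose_eq m r
  have e2 := Nat.add_one_mul_choose_eq (m + 1) (r + 1)
  have e3 := Nat.add_one_mul_choose_eq (m + 2) (r + 2)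
  have key : (m + 3).choose (r + 3) ≤ (m + 3) ^ 3 * m.choose r := by
    calc (m + 3).choose (r + 3) ≤ (m + 3).choose (r + 3) * (r + 3) :=
          Nat.le_mul_of_pos_right _ (by omega)
      _ = (m + 3) * (m + 2).choose (r + 2) := e3.symm
      _ ≤ (m + 3) * ((m + 2).choose (r + 2) * (r + 2)) :=
          Nat.mul_le_mul_left _ (Nat.le_mul_of_pos_right _ (by omega))
      _ = (m + 3) * ((m + 2) * (m + 1).choose (r + 1)) := by rw [← e2]
      _ ≤ (m + 3) * ((m + 2) * ((m + 1).choose (r + 1) * (r + 1))) :=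
          Nat.mul_le_mul_left _ (Nat.mul_le_mul_left _ (Nat.le_mul_of_pos_right _ (by omega)))
      _ = (m + 3) * ((m + 2) * ((m + 1) * m.choose r)) := by rw [← e1]
      _ ≤ (m + 3) * ((m + 3) * ((m + 3) * m.choose r)) := by gcongr <;> omega
      _ = (m + 3) ^ 3 * m.choose r := by ring
  calc A.card * B.card * C.card * (m + 3).choose (r + 3)
      ≤ A.card * B.card * C.card * ((m + 3) ^ 3 * m.choose r) := Nat.mul_le_mul_left _ key
    _ = A.card * (B.card * C.card) * m.choose r * (m + 3) ^ 3 := by ring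
    _ ≤ N.card * (r + 3) ^ 3 * (m + 3) ^ 3 := Nat.mul_le_mul_right _ hcount

theorem exists_maximal_matching (R : ι → α → Prop) (I : Finset ι) (T : Finset α)
    [Nonempty α] : ∃ J ⊆ I, ∃ f : ι → α, Set.InjOn f J ∧ (∀ i ∈ J, f i ∈ T ∧ R i (f i)) ∧
      ∀ i ∈ I \ J, ∀ v ∈ T \ J.image f, ¬ R i v := by
  classical
  let P : Finset ι → Prop := fun J =>
    ∃ f : ι → α, Set.InjOn f J ∧ ∀ i ∈ J, f i ∈ T ∧ R i (f i)
  obtain ⟨J, hJ, hmax⟩ := Finset.exists_max_image (I.powerset.filter P) Finset.card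
    ⟨∅, by simp [P]⟩
  obtain ⟨hJI, f, hinj, hf⟩ := Finset.mem_filter.1 hJ
  rw [Finset.mem_powerset] at hJI
  refine ⟨J, hJI, f, hinj, hf, fun i hi v hv hR => ?_⟩
  obtain ⟨hiI, hiJ⟩ := Finset.mem_sdiff.1 hi
  obtain ⟨hvT, hvJ⟩ := Finset.mem_sdiff.1 hv
  have hne : ∀ j ∈ J, j ≠ i := fun j hj h => hiJ (h ▸ hj)
  have hEq : Set.EqOn f (Function.update f i v) J := fun j hj => by
    simp [Function.update_of_ne (hne j hj)]
  have hnew : insert i J ∈ I.powerset.filter P := by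
    refine Finset.mem_filter.2
      ⟨Finset.mem_powerset.2 (Finset.insert_subset hiI hJI), Function.update f i v, ?_, ?_⟩
    · rw [Finset.coe_insert, Set.injOn_insert (by simpa using hiJ)]
      refine ⟨hinj.congr hEq, ?_⟩
      rw [← hEq.image_eq]
      simpa using hvJ
    · intro j hj
      rcases Finset.mem_insert.1 hj with rfl | hj
      · simpa using ⟨hvT, hR⟩
      · simpa [Function.update_of_ne (hne j hj)] using hf j hj
  have := hmax _ hnew
  rw [Finset.card_insert_of_notMem hiJ] at this
  omega

/-- A partial matching `f` of dense pairs extends to a rainbow matching: the families outside `J`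
are handled by the small case, those in `J` greedily inside `W`. -/
theorem hasRainbowMatching_of_partial_matching [Fintype ι] [Fintype α] {k p : ℕ} (hk : 2 ≤ k)
    {F : ι → Finset (Finset α)} (hF : ∀ i, F i ⊆ Finset.univ.powersetCard k)
    (hcard : ∀ i, (Fintype.card α).choose k <
      (F i).card + (Fintype.card α - Fintype.card ι + 1).choose k)
    {T W : Finset α} (hTW : Disjoint T W) (hW : Fintype.card α ≤ W.card + Fintype.card ι + p)
    {J : Finset ι} {f : ι → α} (hinj : Set.InjOn f J) (hfT : ∀ i ∈ J, f i ∈ T)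
    {D : ℝ} (hD : ∀ i ∈ J,
      (((W.powersetCard (k - 1)).filter fun A => insert (f i) A ∉ F i).card : ℝ) ≤ D)
    (hsmall : k ^ 3 * (Jᶜ).card + J.card ≤ Fintype.card α)
    (hroom : k * Fintype.card ι + (Jᶜ).card + p ≤ Fintype.card α)
    (hDlt : D < ((Fintype.card α - (k * Fintype.card ι + (Jᶜ).card + p) + (k - 1)).choose
      (k - 1) : ℝ)) :
    HasRainbowMatching F Finset.univ := by
  have hJc : J.card + (Jᶜ).card = Fintype.card ι := Finset.card_add_card_compl J
  set S : Finset α := (J.image f)ᶜ with hS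
  have hSc : J.card + S.card = Fintype.card α := by
    rw [← Finset.card_image_of_injOn hinj]; exact Finset.card_add_card_compl _
  have hSn : S.card ≤ Fintype.card α := Finset.card_le_univ S
  obtain ⟨e, he, hed⟩ := hasRainbowMatching_of_card k hk Jᶜ S
    (fun i => (F i).filter (· ⊆ S))
    (fun i _ A hA => by
      obtain ⟨h1, h2⟩ := Finset.mem_filter.1 hA
      exact Finset.mem_powersetCard.2 ⟨h2, (Finset.mem_powersetCard.1 (hF i h1)).2⟩)
    (by omega)
    (fun i _ => by
      have h1 := hcard i
      have h2 := Finset.card_filter_add_card_filter_not (s := F i) (· ⊆ S)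
      have h3 : ((F i).filter fun A => ¬ A ⊆ S).card + S.card.choose k
          ≤ (Fintype.card α).choose k := by
        rw [← Finset.card_powersetCard k S, ← Finset.card_univ (α := α),
          ← Finset.card_powersetCard k (Finset.univ : Finset α), ← Finset.card_union_of_disjoint]
        · refine Finset.card_le_card (Finset.union_subset ?_ ?_)
          · exact (Finset.filter_subset _ _).trans (hF i)
          · exact Finset.powersetCard_mono (Finset.subset_univ S)
        · refine Finset.disjoint_left.2 fun A hA hA' => ?_
          exact (Finset.mem_filter.1 hA).2 (Finset.mem_powersetCard.1 hA').1
      rw [show S.card - (Jᶜ).card + 1 = Fintype.card α - Fintype.card ι + 1 by omega]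
      omega)
  set U₀ : Finset α := (Jᶜ).biUnion e with hU₀
  have hU₀c : U₀.card ≤ (Jᶜ).card * k := card_biUnion_le_mul_of_mem (fun i _ A hA =>
    (Finset.mem_powersetCard.1 (hF i (Finset.mem_of_mem_filter A hA))).2.le) he
  obtain ⟨g, hg, hgd⟩ := hasRainbowMatching_of_greedy
    (fun i => ((W \ U₀).powersetCard (k - 1)).filter fun A => insert (f i) A ∈ F i)
    (k - 1) ((J.card - 1) * (k - 1)) J le_rfl
    (fun i _ A hA => (Finset.mem_powersetCard.1 (Finset.mem_of_mem_filter A hA)).2.le)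
    (by
      intro i hi U hU
      by_contra! hcon
      have hJ1 : 1 ≤ J.card := Finset.card_pos.2 ⟨i, hi⟩
      have hsub : ((W \ U₀) \ U).powersetCard (k - 1) ⊆
          (W.powersetCard (k - 1)).filter fun A => insert (f i) A ∉ F i := by
        intro A hA
        obtain ⟨h1, h2⟩ := Finset.mem_powersetCard.1 hA
        rw [Finset.subset_sdiff] at h1
        refine Finset.mem_filter.2 ⟨Finset.mem_powersetCard.2
          ⟨h1.1.trans Finset.sdiff_subset, h2⟩, fun h => ?_⟩
        exact hcon A (Finset.mem_filter.2 ⟨Finset.mem_powersetCard.2 ⟨h1.1, h2⟩, h⟩) h1.2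
      have hle := Finset.card_le_card hsub
      rw [Finset.card_powersetCard] at hle
      have h1 := Finset.le_card_sdiff U₀ W
      have h2 := Finset.le_card_sdiff U (W \ U₀)
      have hL : Fintype.card α - (k * Fintype.card ι + (Jᶜ).card + p) + (k - 1)
          ≤ ((W \ U₀) \ U).card := by
        obtain ⟨c, hc⟩ : ∃ c, k = c + 1 := ⟨k - 1, by omega⟩
        obtain ⟨d, hd⟩ : ∃ d, J.card = d + 1 := ⟨J.card - 1, by omega⟩
        rw [← hJc, hd] at hroom hW ⊢
        rw [hd] at hU
        rw [hc] at hroom hU₀c hU ⊢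
        simp only [Nat.add_sub_cancel] at hU ⊢
        have e1 : (c + 1) * (d + 1 + (Jᶜ).card)
          = d * c + c + d + 1 + (Jᶜ).card * (c + 1) := by ring
        rw [e1] at hroom ⊢
        omega
      have := (Nat.choose_le_choose (k - 1) hL).trans hle
      exact absurd (hD i hi) (not_le.2 (hDlt.trans_le (by exact_mod_cast this))))
  have hgW : ∀ i ∈ J, g i ⊆ W ∧ Disjoint (g i) U₀ := fun i hi =>
    Finset.subset_sdiff.1 (Finset.mem_powersetCard.1 (Finset.mem_of_mem_filter _ (hg i hi))).1
  have hJJ : ∀ i ∈ J, ∀ j ∈ J, i ≠ j →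
      Disjoint (insert (f i) (g i)) (insert (f j) (g j)) := by
    intro i hi j hj hij
    rw [Finset.disjoint_insert_left, Finset.disjoint_insert_right, Finset.mem_insert]
    refine ⟨?_, ?_, hgd hi hj hij⟩
    · rintro (h | h)
      · exact hij (hinj hi hj h)
      · exact Finset.disjoint_left.1 hTW (hfT i hi) ((hgW j hj).1 h)
    · exact fun h => Finset.disjoint_left.1 hTW (hfT j hj) ((hgW i hi).1 h)
  have hJC : ∀ i ∈ J, ∀ j ∈ Jᶜ, Disjoint (insert (f i) (g i)) (e j) := by
    intro i hi j hj
    rw [Finset.disjoint_insert_left]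
    refine ⟨fun h => ?_, (hgW i hi).2.mono_right (Finset.subset_biUnion_of_mem e hj)⟩
    have := (Finset.mem_filter.1 (he j hj)).2 h
    exact Finset.mem_compl.1 this (Finset.mem_image_of_mem f hi)
  refine ⟨fun i => if i ∈ J then insert (f i) (g i) else e i, fun i _ => ?_, ?_⟩
  · by_cases hi : i ∈ J
    · simpa [hi] using (Finset.mem_filter.1 (hg i hi)).2
    · simpa [hi] using Finset.mem_of_mem_filter _ (he i (Finset.mem_compl.2 hi))
  · intro i _ j _ hij
    by_cases hi : i ∈ J <;> by_cases hj : j ∈ J <;> simp only [Function.onFun, hi, hj, if_true,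
      if_false]
    · exact hJJ i hi j hj hij
    · exact hJC i hi j (Finset.mem_compl.2 hj)
    · exact (hJC j hj i (Finset.mem_compl.2 hi)).symm
    · exact hed (by simpa using hi) (by simpa using hj) hij

/-- If almost all sets meeting `T` in one point and otherwise contained in `W` belong to almost all
the families, then there is a rainbow matching. -/
theorem hasRainbowMatching_of_few_missing [Fintype ι] [Fintype α] {k p : ℕ} (hk : 3 ≤ k)
    (hkn : k ≤ Fintype.card α) {ζ s : ℝ} (hζ : 0 < ζ) (hs : 0 < s)
    {F : ι → Finset (Finset α)} (hF : ∀ i, F i ⊆ Finset.univ.powersetCard k)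
    (hcard : ∀ i, (Fintype.card α).choose k <
      (F i).card + (Fintype.card α - Fintype.card ι + 1).choose k)
    {I : Finset ι} {T W : Finset α} (hTW : Disjoint T W)
    (hI : Fintype.card ι ≤ I.card + p) (hT : Fintype.card ι ≤ T.card + p)
    (hW : Fintype.card α ≤ W.card + Fintype.card ι + p)
    (hmiss : ((∑ i ∈ I, ∑ v ∈ T,
      ((W.powersetCard (k - 1)).filter fun A => insert v A ∉ F i).card : ℕ) : ℝ)
        ≤ s ^ 2 * Fintype.card ι * (Fintype.card α).choose k)
    (htn : (k : ℝ) * Fintype.card ι + ζ * Fintype.card α ≤ Fintype.card α)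
    (hpζ : (16 : ℝ) * p ≤ ζ * Fintype.card α)
    (hpk : (8 : ℝ) * k ^ 3 * p ≤ Fintype.card α)
    (hsζ : 64 * s ≤ ζ ^ 2) (hsk : 64 * (k : ℝ) ^ 6 * s ≤ 1) (hspow : s < (ζ / 2) ^ (k - 1)) :
    HasRainbowMatching F Finset.univ := by
  obtain ⟨v₀⟩ : Nonempty α := Fintype.card_pos_iff.1 (by omega)
  have : Nonempty α := ⟨v₀⟩
  set n := Fintype.card α with hn
  set t := Fintype.card ι with ht
  have hn0 : (0 : ℝ) < n := by exact_mod_cast (show 0 < n by omega)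
  have hk0 : (3 : ℝ) ≤ k := by exact_mod_cast hk
  set D : ℝ := s * (n - 1).choose (k - 1) with hDdef
  have hch : (0 : ℝ) < (n - 1).choose (k - 1) := by
    exact_mod_cast Nat.choose_pos (show k - 1 ≤ n - 1 by omega)
  have hD0 : 0 < D := mul_pos hs hch
  let miss : ι → α → ℕ := fun i v =>
    ((W.powersetCard (k - 1)).filter fun A => insert v A ∉ F i).card
  obtain ⟨J, hJI, f, hinj, hf, hmax⟩ := exists_maximal_matching
    (fun i v => (miss i v : ℝ) ≤ D) I T
  have hJc : J.card + (Jᶜ).card = t := Finset.card_add_card_compl J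
  have habs : (n : ℝ) * (n - 1).choose (k - 1) = n.choose k * k := by
    have := Nat.add_one_mul_choose_eq (n - 1) (k - 1)
    rw [show n - 1 + 1 = n by omega, show k - 1 + 1 = k by omega] at this
    exact_mod_cast this
  have hrect : ((I \ J).card : ℝ) * (T \ J.image f).card * D
      ≤ s ^ 2 * t * n.choose k := by
    refine le_trans ?_ hmiss
    push_cast
    calc ((I \ J).card : ℝ) * (T \ J.image f).card * D
        = ∑ i ∈ I \ J, ∑ v ∈ T \ J.image f, D := by
          simp only [Finset.sum_const, nsmul_eq_mul]; ring
      _ ≤ ∑ i ∈ I \ J, ∑ v ∈ T \ J.image f, (miss i v : ℝ) :=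
          Finset.sum_le_sum fun i hi => Finset.sum_le_sum fun v hv =>
            (not_le.1 (hmax i hi v hv)).le
      _ ≤ ∑ i ∈ I \ J, ∑ v ∈ T, (miss i v : ℝ) :=
          Finset.sum_le_sum fun i _ => Finset.sum_le_sum_of_subset_of_nonneg
            Finset.sdiff_subset fun _ _ _ => Nat.cast_nonneg _
      _ ≤ ∑ i ∈ I, ∑ v ∈ T, (miss i v : ℝ) :=
          Finset.sum_le_sum_of_subset_of_nonneg Finset.sdiff_subset
            fun _ _ _ => Finset.sum_nonneg fun _ _ => Nat.cast_nonneg _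
  have hrect' : ((I \ J).card : ℝ) * (T \ J.image f).card * k ≤ s * t * n := by
    refine le_of_mul_le_mul_right ?_ hD0
    calc ((I \ J).card : ℝ) * (T \ J.image f).card * k * D
        = (((I \ J).card : ℝ) * (T \ J.image f).card * D) * k := by ring
      _ ≤ (s ^ 2 * t * n.choose k) * k := mul_le_mul_of_nonneg_right hrect (by positivity)
      _ = s ^ 2 * t * (n.choose k * k) := by ring
      _ = s * t * n * D := by rw [← habs, hDdef]; ring
  have htk : (k : ℝ) * t ≤ n := by nlinarith
  set z : ℕ := (Jᶜ).card - p with hz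
  have hz1 : z ≤ (I \ J).card := by
    have := Finset.le_card_sdiff J I; omega
  have hz2 : z ≤ (T \ J.image f).card := by
    have := Finset.le_card_sdiff (J.image f) T
    rw [Finset.card_image_of_injOn hinj] at this; omega
  have hzz : (z : ℝ) ^ 2 ≤ s * n ^ 2 := by
    have h1 : (z : ℝ) * z ≤ ((I \ J).card : ℝ) * (T \ J.image f).card := by
      exact_mod_cast Nat.mul_le_mul hz1 hz2
    have h2 : (z : ℝ) * z * k ≤ s * t * n :=
      (mul_le_mul_of_nonneg_right h1 (by positivity)).trans hrect'
    have h3 : (z : ℝ) * z ≤ (z : ℝ) * z * k := le_mul_of_one_le_right (by positivity) (by linarith)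
    have h4 : (t : ℝ) ≤ n := by nlinarith [Nat.cast_nonneg (α := ℝ) t]
    calc (z : ℝ) ^ 2 ≤ s * t * n := by rw [sq]; linarith
      _ ≤ s * n * n := by gcongr
      _ = s * n ^ 2 := by ring
  have hzζ : 8 * (z : ℝ) ≤ ζ * n := by
    refine le_of_pow_le_pow_left₀ two_ne_zero (by positivity) ?_
    nlinarith [mul_le_mul_of_nonneg_right hsζ (sq_nonneg (n : ℝ))]
  have hzk : 8 * (k : ℝ) ^ 3 * z ≤ n := by
    refine le_of_pow_le_pow_left₀ two_ne_zero (by positivity) ?_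
    calc (8 * (k : ℝ) ^ 3 * z) ^ 2 = 64 * (k : ℝ) ^ 6 * z ^ 2 := by ring
      _ ≤ 64 * (k : ℝ) ^ 6 * (s * n ^ 2) := by gcongr
      _ = (64 * (k : ℝ) ^ 6 * s) * n ^ 2 := by ring
      _ ≤ 1 * n ^ 2 := by gcongr
      _ = (n : ℝ) ^ 2 := one_mul _
  have hbz : ((Jᶜ).card : ℝ) ≤ z + p := by exact_mod_cast (show (Jᶜ).card ≤ z + p by omega)
  have hsmall : k ^ 3 * (Jᶜ).card + J.card ≤ n := by
    have hJt : (J.card : ℝ) ≤ t := by exact_mod_cast (show J.card ≤ t by omega)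
    have h1 : (k : ℝ) ^ 3 * (Jᶜ).card ≤ (k : ℝ) ^ 3 * (z + p) := by gcongr
    have h2 : 3 * (t : ℝ) ≤ k * t := by gcongr
    have : (k : ℝ) ^ 3 * (Jᶜ).card + J.card ≤ n := by nlinarith
    exact_mod_cast this
  have hroomR : (k : ℝ) * t + (Jᶜ).card + p + ζ / 2 * n ≤ n := by
    have : 0 < ζ * n := by positivity
    linarith
  have hroom : k * t + (Jᶜ).card + p ≤ n := by
    have : (k : ℝ) * t + (Jᶜ).card + p ≤ n := by
      have : 0 < ζ * n := by positivity
      linarith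
    exact_mod_cast this
  refine hasRainbowMatching_of_partial_matching (by omega) hF hcard hTW hW hinj
    (fun i hi => (hf i hi).1) (fun i hi => (hf i hi).2) hsmall hroom ?_
  set L := n - (k * t + (Jᶜ).card + p) with hL
  have hLR : ζ / 2 * n ≤ L := by
    rw [hL, Nat.cast_sub hroom]; push_cast; linarith
  have hfac : (0 : ℝ) < (k - 1).factorial := by exact_mod_cast Nat.factorial_pos _
  have hup : ((n - 1).choose (k - 1) : ℝ) ≤ (n : ℝ) ^ (k - 1) / (k - 1).factorial := by
    refine (Nat.choose_le_pow_div (k - 1) (n - 1)).trans ?_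
    gcongr
    omega
  have hlow := Nat.pow_le_choose (α := ℝ) (k - 1) (L + (k - 1))
  rw [show L + (k - 1) + 1 - (k - 1) = L + 1 by omega] at hlow
  calc D ≤ s * ((n : ℝ) ^ (k - 1) / (k - 1).factorial) := by rw [hDdef]; gcongr
    _ < (ζ / 2) ^ (k - 1) * ((n : ℝ) ^ (k - 1) / (k - 1).factorial) := by gcongr
    _ = (ζ / 2 * n) ^ (k - 1) / (k - 1).factorial := by rw [mul_pow]; ring
    _ ≤ ((L + 1 : ℕ) : ℝ) ^ (k - 1) / (k - 1).factorial := by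
        gcongr; push_cast; linarith
    _ ≤ _ := by exact_mod_cast hlow

end DenseFamilies

section PartiteEdges

variable {ι α : Type*} [DecidableEq ι] [DecidableEq α]

/-- The edge `{i} ∪ e` of a `(1,k)`-partite hypergraph. -/
def partiteEdge (i : ι) (e : Finset α) : Finset (ι ⊕ α) :=
  insert (Sum.inl i) (e.image Sum.inr)

theorem inl_mem_partiteEdge {i j : ι} {e : Finset α} :
    Sum.inl j ∈ partiteEdge i e ↔ j = i := by
  simp [partiteEdge]

theorem inr_mem_partiteEdge {i : ι} {e : Finset α} {v : α} :
    Sum.inr v ∈ partiteEdge i e ↔ v ∈ e := by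
  simp [partiteEdge]

theorem partiteEdge_inj {i j : ι} {e f : Finset α} :
    partiteEdge i e = partiteEdge j f ↔ i = j ∧ e = f := by
  refine ⟨fun h => ⟨?_, ?_⟩, by rintro ⟨rfl, rfl⟩; rfl⟩
  · exact inl_mem_partiteEdge.1 (h ▸ inl_mem_partiteEdge.2 rfl)
  · ext v
    rw [← inr_mem_partiteEdge (i := i), h, inr_mem_partiteEdge]

theorem image_partiteEdge (σ : Equiv.Perm (ι ⊕ α)) {i i' : ι} {e : Finset α} {g : α → α}
    (hi : σ (Sum.inl i) = Sum.inl i') (hg : ∀ v ∈ e, σ (Sum.inr v) = Sum.inr (g v)) :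
    (partiteEdge i e).image σ = partiteEdge i' (e.image g) ∧ (e.image g).card = e.card := by
  refine ⟨?_, ?_⟩
  · rw [partiteEdge, partiteEdge, Finset.image_insert, hi, Finset.image_image, Finset.image_image]
    congr 1
    exact Finset.image_congr fun v hv => hg v hv
  · refine Finset.card_image_of_injOn fun v hv w hw h => ?_
    have : σ (Sum.inr v) = σ (Sum.inr w) := by rw [hg v hv, hg w hw, h]
    simpa using this

theorem card_filter_isLeft_perm {ι α : Type*} [Fintype ι] [Fintype α] (σ : Equiv.Perm (ι ⊕ α)) :
    (Finset.univ.filter fun i : ι => (σ (Sum.inl i)).isLeft).card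
      + (Finset.univ.filter fun v : α => (σ (Sum.inr v)).isLeft).card = Fintype.card ι := by
  have h := Equiv.sum_comp σ fun z : ι ⊕ α => if z.isLeft then 1 else 0
  rw [Fintype.sum_sum_type, Fintype.sum_sum_type] at h
  rw [Finset.card_filter, Finset.card_filter, h]
  simp

theorem card_mul_card_le_of_partiteEdge_mem {J : Finset ι} {𝓔 : Finset (Finset α)}
    {E : Finset (Finset (ι ⊕ α))} (h : ∀ i ∈ J, ∀ e ∈ 𝓔, partiteEdge i e ∈ E) :
    J.card * 𝓔.card ≤ E.card := by
  rw [← Finset.card_product]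
  refine Finset.card_le_card_of_injOn (fun x => partiteEdge x.1 x.2) ?_ ?_
  · intro x hx
    obtain ⟨h1, h2⟩ := Finset.mem_product.1 hx
    exact h _ h1 _ h2
  · rintro ⟨i, e⟩ _ ⟨j, f⟩ _ hef
    obtain ⟨rfl, rfl⟩ := partiteEdge_inj.1 hef
    rfl

end PartiteEdges

section Closeness

variable {n k t : ℕ}

theorem partiteEdge_mem_FtEdges {i : Fin t} {e : Finset (Fin n)} :
    partiteEdge i e ∈ FtEdges n k t ↔ e.card = k ∧ ∃ v ∈ e, (v : ℕ) < t := by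
  have : partiteEdge i e ∈ FtEdges n k t ↔ e ∈ Hk n k t := by
    simp only [FtEdges, Finset.mem_biUnion, Finset.mem_univ, true_and, Finset.mem_image]
    refine ⟨?_, fun h => ⟨i, e, h, rfl⟩⟩
    rintro ⟨j, f, hf, h⟩
    obtain ⟨rfl, rfl⟩ := partiteEdge_inj.1 h
    exact hf
  rw [this, Hk, Finset.mem_filter, Finset.mem_powersetCard_univ]

theorem mem_Fedges {F : Fin t → Finset (Finset (Fin n))} {s : Finset (Fin t ⊕ Fin n)} :
    s ∈ Fedges n k t F ↔ ∃ i, ∃ e ∈ F i, partiteEdge i e = s := by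
  simp [Fedges, partiteEdge]

theorem partiteEdge_mem_Fedges {F : Fin t → Finset (Finset (Fin n))} {i : Fin t}
    {e : Finset (Fin n)} : partiteEdge i e ∈ Fedges n k t F ↔ e ∈ F i := by
  rw [mem_Fedges]
  refine ⟨?_, fun h => ⟨i, e, h, rfl⟩⟩
  rintro ⟨j, f, hf, h⟩
  obtain ⟨rfl, rfl⟩ := partiteEdge_inj.1 h
  exact hf

theorem card_FtEdges_le : (FtEdges n k t).card ≤ t * n.choose k := by
  refine (Finset.card_biUnion_le_card_mul _ _ (n.choose k) fun i _ => ?_).trans (by simp)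
  refine Finset.card_image_le.trans ((Finset.card_filter_le _ _).trans ?_)
  simp

theorem eq_of_mem_image_Fedges {F : Fin t → Finset (Finset (Fin n))}
    {σ : Equiv.Perm (Fin t ⊕ Fin n)} {s : Finset (Fin t ⊕ Fin n)}
    (hs : s ∈ (Fedges n k t F).image fun e => e.image σ) {x y : Fin t ⊕ Fin n}
    (hx : x ∈ s) (hy : y ∈ s) (hx' : (σ.symm x).isLeft) (hy' : (σ.symm y).isLeft) : x = y := by
  obtain ⟨e, he, rfl⟩ := Finset.mem_image.1 hs
  obtain ⟨i, f, -, rfl⟩ := mem_Fedges.1 he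
  have key : ∀ z ∈ (partiteEdge i f).image σ, (σ.symm z).isLeft → z = σ (Sum.inl i) := by
    intro z hz hz'
    obtain ⟨w, hw, rfl⟩ := Finset.mem_image.1 hz
    rw [Equiv.symm_apply_apply] at hz'
    obtain ⟨j, rfl⟩ := Sum.isLeft_iff.1 hz'
    rw [inl_mem_partiteEdge.1 hw]
  rw [key x hx hx', key y hy hy']

/-- A permutation witnessing closeness moves few vertices from one partition class to the
other. -/
theorem card_crossing_le (hk : 3 ≤ k) (hkn : k ≤ n) (ht48 : 48 ≤ t) (htn : 3 * t ≤ n)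
    (hnt : n ≤ t * k ^ 3) {ε : ℝ} (hε0 : 0 ≤ ε) (hε : 3456 * ε * (k : ℝ) ^ 12 < 1)
    {F : Fin t → Finset (Finset (Fin n))} {σ : Equiv.Perm (Fin t ⊕ Fin n)}
    (hσ : ((FtEdges n k t \ (Fedges n k t F).image fun e => e.image σ).card : ℝ)
      ≤ ε * (FtEdges n k t).card) :
    ((Finset.univ.filter fun v : Fin n => (σ.symm (Sum.inr v)).isLeft).card : ℝ)
      ≤ 8 * ε * (k : ℝ) ^ 6 * n := by
  set Y : Finset (Fin n) := Finset.univ.filter fun v => (σ.symm (Sum.inr v)).isLeft with hY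
  set J : Finset (Fin t) := Finset.univ.filter fun i => (σ.symm (Sum.inl i)).isLeft with hJ
  set T : Finset (Fin n) := Finset.univ.filter fun v => (v : ℕ) < t with hT
  have hJY : J.card + Y.card = t := by simpa using card_filter_isLeft_perm σ.symm
  have hTc : T.card = t := by
    rw [hT, Fin.card_filter_val_lt]; omega
  have hn0 : (0 : ℝ) < n := by exact_mod_cast (show 0 < n by omega)
  have ht0 : (0 : ℝ) < t := by exact_mod_cast (show 0 < t by omega)
  have hch : (0 : ℝ) < n.choose k := by exact_mod_cast Nat.choose_pos hkn
  have hntR : (n : ℝ) ≤ t * (k : ℝ) ^ 3 := by exact_mod_cast hnt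
  -- A set of indices covering half of `Fin t` which only gives missing edges with the
  -- `k`-sets meeting `A`, `B` and `C` bounds `|A| |B| |C|`.
  have main : ∀ (K : Finset (Fin t)) (A B C : Finset (Fin n)), Disjoint A B → Disjoint A C →
      Disjoint B C → t ≤ 2 * K.card →
      (∀ i ∈ K, ∀ e : Finset (Fin n), e.card = k → ¬ Disjoint e A → ¬ Disjoint e B →
        ¬ Disjoint e C → partiteEdge i e ∈
          FtEdges n k t \ (Fedges n k t F).image fun e => e.image σ) →
      (A.card : ℝ) * B.card * C.card ≤ 2 * ε * (k : ℝ) ^ 3 * (n : ℝ) ^ 3 := by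
    intro K A B C hAB hAC hBC hK hmem
    set N := ((Finset.univ.powersetCard k).filter fun e : Finset (Fin n) =>
        ¬ Disjoint e A ∧ ¬ Disjoint e B ∧ ¬ Disjoint e C) with hN
    have h1 : K.card * N.card ≤
        (FtEdges n k t \ (Fedges n k t F).image fun e => e.image σ).card := by
      refine card_mul_card_le_of_partiteEdge_mem fun i hi e he => ?_
      obtain ⟨he1, he2, he3, he4⟩ := Finset.mem_filter.1 he
      exact hmem i hi e (Finset.mem_powersetCard_univ.1 he1) he2 he3 he4
    have h2 : (K.card : ℝ) * N.card ≤ ε * (t * n.choose k) := by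
      calc (K.card : ℝ) * N.card ≤ _ := by exact_mod_cast h1
        _ ≤ ε * (FtEdges n k t).card := hσ
        _ ≤ ε * (t * n.choose k) := by
          gcongr; exact_mod_cast card_FtEdges_le
    have h3 : (t : ℝ) ≤ 2 * K.card := by exact_mod_cast hK
    have h4 : (N.card : ℝ) ≤ 2 * ε * n.choose k := by
      refine le_of_mul_le_mul_left ?_ ht0
      calc (t : ℝ) * N.card ≤ 2 * K.card * N.card := by gcongr
        _ = 2 * (K.card * N.card) := by ring
        _ ≤ 2 * (ε * (t * n.choose k)) := by gcongr
        _ = t * (2 * ε * n.choose k) := by ring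
    have h5 := card_mul_choose_le_card_filter_meet hAB hAC hBC hk
    rw [Fintype.card_fin] at h5
    have h6 : (A.card : ℝ) * B.card * C.card * n.choose k ≤ N.card * k ^ 3 * n ^ 3 := by
      exact_mod_cast h5
    refine le_of_mul_le_mul_right ?_ hch
    calc (A.card : ℝ) * B.card * C.card * n.choose k ≤ N.card * k ^ 3 * n ^ 3 := h6
      _ ≤ (2 * ε * n.choose k) * k ^ 3 * n ^ 3 := by gcongr
      _ = 2 * ε * (k : ℝ) ^ 3 * (n : ℝ) ^ 3 * n.choose k := by ring
  rcases le_or_gt (2 * Y.card) t with hp | hp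
  · have h := main J Y (T \ Y) (Y ∪ T)ᶜ Finset.disjoint_sdiff
      (disjoint_compl_right.mono_left Finset.subset_union_left)
      (disjoint_compl_right.mono_left (Finset.sdiff_subset.trans Finset.subset_union_right))
      (by omega) (by
        intro i hi e hek heY heT _
        obtain ⟨y, hye, hy⟩ := Finset.not_disjoint_iff.1 heY
        obtain ⟨v, hve, hv⟩ := Finset.not_disjoint_iff.1 heT
        refine Finset.mem_sdiff.2 ⟨partiteEdge_mem_FtEdges.2
          ⟨hek, v, hve, (Finset.mem_filter.1 (Finset.mem_sdiff.1 hv).1).2⟩, fun hmem => ?_⟩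
        have := eq_of_mem_image_Fedges hmem (inl_mem_partiteEdge.2 rfl)
          (inr_mem_partiteEdge.2 hye) (Finset.mem_filter.1 hi).2 (Finset.mem_filter.1 hy).2
        simp at this)
    have hB : t ≤ 2 * (T \ Y).card := by
      have := Finset.le_card_sdiff Y T; omega
    have hC : n ≤ 2 * ((Y ∪ T)ᶜ).card := by
      have h1 := Finset.card_union_le Y T
      have h2 := Finset.card_add_card_compl (Y ∪ T)
      rw [Fintype.card_fin] at h2
      omega
    have hB' : (t : ℝ) ≤ 2 * (T \ Y).card := by exact_mod_cast hB
    have hC' : (n : ℝ) ≤ 2 * ((Y ∪ T)ᶜ).card := by exact_mod_cast hC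
    have h1 : (Y.card : ℝ) * t * n ≤ 4 * (2 * ε * (k : ℝ) ^ 3 * (n : ℝ) ^ 3) := by
      calc (Y.card : ℝ) * t * n ≤ Y.card * (2 * (T \ Y).card) * (2 * ((Y ∪ T)ᶜ).card) := by
            gcongr
        _ = 4 * (Y.card * (T \ Y).card * ((Y ∪ T)ᶜ).card) := by ring
        _ ≤ _ := by gcongr
    refine le_of_mul_le_mul_right ?_ (mul_pos hn0 hn0)
    calc (Y.card : ℝ) * (n * n) ≤ Y.card * (t * (k : ℝ) ^ 3 * n) := by gcongr
      _ = Y.card * t * n * (k : ℝ) ^ 3 := by ring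
      _ ≤ 4 * (2 * ε * (k : ℝ) ^ 3 * (n : ℝ) ^ 3) * (k : ℝ) ^ 3 := by gcongr
      _ = 8 * ε * (k : ℝ) ^ 6 * n * (n * n) := by ring
  · exfalso
    set q := t / 6 with hq
    obtain ⟨A, hAT, hA⟩ := Finset.exists_subset_card_eq (show q ≤ T.card by omega)
    obtain ⟨B, hBY, hB⟩ := Finset.exists_subset_card_eq (show q ≤ (Y \ A).card by
      have := Finset.le_card_sdiff A Y; omega)
    obtain ⟨C, hCY, hC⟩ := Finset.exists_subset_card_eq (show q ≤ ((Y \ A) \ B).card by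
      have := Finset.le_card_sdiff A Y
      have := Finset.le_card_sdiff B (Y \ A); omega)
    rw [Finset.subset_sdiff] at hBY
    rw [Finset.subset_sdiff, Finset.subset_sdiff] at hCY
    have hJc := Finset.card_add_card_compl J
    rw [Fintype.card_fin] at hJc
    have h := main Jᶜ A B C hBY.2.symm hCY.1.2.symm hCY.2.symm (by omega) (by
      intro i _ e hek heA heB heC
      obtain ⟨a, hae, ha⟩ := Finset.not_disjoint_iff.1 heA
      obtain ⟨b, hbe, hb⟩ := Finset.not_disjoint_iff.1 heB
      obtain ⟨c, hce, hc⟩ := Finset.not_disjoint_iff.1 heC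
      refine Finset.mem_sdiff.2 ⟨partiteEdge_mem_FtEdges.2
          ⟨hek, a, hae, (Finset.mem_filter.1 (hAT ha)).2⟩, fun hmem => ?_⟩
      have := eq_of_mem_image_Fedges hmem (inr_mem_partiteEdge.2 hbe)
          (inr_mem_partiteEdge.2 hce) (Finset.mem_filter.1 (hBY.1 hb)).2
          (Finset.mem_filter.1 (hCY.1.1 hc)).2
      rw [Sum.inr_injective this] at hb
      exact Finset.disjoint_left.1 hCY.2 hc hb)
    rw [hA, hB, hC] at h
    have hqt : (t : ℝ) ≤ 12 * q := by exact_mod_cast (show t ≤ 12 * q by omega)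
    have h1 : (t : ℝ) ^ 3 ≤ 3456 * ε * (k : ℝ) ^ 12 * t ^ 3 := by
      calc (t : ℝ) ^ 3 ≤ (12 * (q : ℝ)) ^ 3 := by gcongr
        _ = 1728 * ((q : ℝ) * q * q) := by ring
        _ ≤ 1728 * (2 * ε * (k : ℝ) ^ 3 * (n : ℝ) ^ 3) := by gcongr
        _ ≤ 1728 * (2 * ε * (k : ℝ) ^ 3 * (t * (k : ℝ) ^ 3) ^ 3) := by gcongr
        _ = _ := by ring
    have h2 : (0 : ℝ) < (t : ℝ) ^ 3 := by positivity
    nlinarith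

/-- Double counting of the missing edges with one vertex in `[t]`, for a permutation `σ`. -/
theorem sum_missing_le (hk : 1 ≤ k) {F : Fin t → Finset (Finset (Fin n))}
    {σ : Equiv.Perm (Fin t ⊕ Fin n)} {g : Fin n → Fin n} {I : Finset (Fin t)}
    {T W : Finset (Fin n)} (hI : ∀ i ∈ I, (σ (Sum.inl i)).isLeft)
    (hT : ∀ v ∈ T, σ (Sum.inr v) = Sum.inr (g v) ∧ (g v : ℕ) < t)
    (hW : ∀ v ∈ W, σ (Sum.inr v) = Sum.inr (g v)) (hTW : Disjoint T W) :
    ∑ i ∈ I, ∑ v ∈ T, ((W.powersetCard (k - 1)).filter fun A => insert v A ∉ F i).card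
      ≤ (FtEdges n k t \ (Fedges n k t F).image fun e => e.image σ).card := by
  rw [← Finset.sum_product', ← Finset.card_sigma]
  refine Finset.card_le_card_of_injOn
    (fun x => (partiteEdge x.1.1 (insert x.1.2 x.2)).image σ) ?_ ?_
  · rintro ⟨⟨i, v⟩, A⟩ hx
    simp only [Finset.coe_sigma, Set.mem_sigma_iff, Finset.mem_coe, Finset.mem_product,
      Finset.mem_filter, Finset.mem_powersetCard] at hx
    obtain ⟨⟨hi, hv⟩, ⟨hAW, hA⟩, hmem⟩ := hx
    have hvA : v ∉ A := fun h => Finset.disjoint_left.1 hTW hv (hAW h)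
    obtain ⟨i', hi'⟩ := Sum.isLeft_iff.1 (hI i hi)
    obtain ⟨h1, h2⟩ := image_partiteEdge σ (e := insert v A) (g := g) hi' (by
      intro w hw
      rcases Finset.mem_insert.1 hw with rfl | hw
      · exact (hT w hv).1
      · exact hW w (hAW hw))
    refine Finset.mem_coe.2 (Finset.mem_sdiff.2 ⟨?_, fun h => ?_⟩)
    · simp only
      rw [h1]
      refine partiteEdge_mem_FtEdges.2 ⟨?_, g v,
        Finset.mem_image_of_mem g (Finset.mem_insert_self v A), (hT v hv).2⟩
      rw [h2, Finset.card_insert_of_notMem hvA, hA]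
      omega
    · obtain ⟨e, he, hee⟩ := Finset.mem_image.1 h
      rw [Finset.image_injective σ.injective hee] at he
      exact hmem (partiteEdge_mem_Fedges.1 he)
  · rintro ⟨⟨i, v⟩, A⟩ hx ⟨⟨j, w⟩, B⟩ hy hxy
    simp only [Finset.coe_sigma, Set.mem_sigma_iff, Finset.mem_coe, Finset.mem_product,
      Finset.mem_filter, Finset.mem_powersetCard] at hx hy
    obtain ⟨⟨hi, hv⟩, ⟨hAW, hA⟩, -⟩ := hx
    obtain ⟨⟨hj, hw⟩, ⟨hBW, hB⟩, -⟩ := hy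
    obtain ⟨hij, he⟩ := partiteEdge_inj.1 (Finset.image_injective σ.injective hxy)
    simp only at hij he
    have hvw : v = w := by
      rcases Finset.mem_insert.1 (he ▸ Finset.mem_insert_self v A) with h | h
      · exact h
      · exact absurd (hBW h) (Finset.disjoint_left.1 hTW hv)
    subst hij hvw
    have hvA : v ∉ A := fun h => Finset.disjoint_left.1 hTW hv (hAW h)
    have hvB : v ∉ B := fun h => Finset.disjoint_left.1 hTW hv (hBW h)
    rw [← Finset.erase_insert hvA, he, Finset.erase_insert hvB]

theorem exists_matching_of_hasRainbowMatching {F : Fin t → Finset (Finset (Fin n))}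
    (h : HasRainbowMatching F Finset.univ) :
    ∃ M ⊆ Fedges n k t F, M.card = t ∧ ∀ e ∈ M, ∀ f ∈ M, e ≠ f → Disjoint e f := by
  obtain ⟨e, he, hd⟩ := h
  refine ⟨Finset.univ.image fun i => partiteEdge i (e i), ?_, ?_, ?_⟩
  · intro s hs
    obtain ⟨i, -, rfl⟩ := Finset.mem_image.1 hs
    exact partiteEdge_mem_Fedges.2 (he i (Finset.mem_univ i))
  · rw [Finset.card_image_of_injective _ fun i j hij => (partiteEdge_inj.1 hij).1]
    simp
  · intro x hx y hy hxy
    obtain ⟨i, -, rfl⟩ := Finset.mem_image.1 hx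
    obtain ⟨j, -, rfl⟩ := Finset.mem_image.1 hy
    have hij : i ≠ j := fun h => hxy (h ▸ rfl)
    refine Finset.disjoint_left.2 fun z hz hz' => ?_
    rcases z with z | z
    · exact hij ((inl_mem_partiteEdge.1 hz).symm.trans (inl_mem_partiteEdge.1 hz'))
    · exact Finset.disjoint_left.1 (hd (by simp) (by simp) hij)
        (inr_mem_partiteEdge.1 hz) (inr_mem_partiteEdge.1 hz')

/-- Closeness to `FtEdges n k t` with a quantitatively small `ε = s ^ 2` forces a rainbow
matching. -/
theorem hasRainbowMatching_of_isClose (hk : 3 ≤ k) (hn : 48 * k ^ 3 ≤ n) {ζ s : ℝ} (hζ : 0 < ζ)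
    (hζ1 : ζ < 1) (hs : 0 < s) (htn : (k : ℝ) * t + ζ * n ≤ n)
    (hsk : 442368 * (k : ℝ) ^ 6 * s ≤ 1) (hsζ : 64 * s ≤ ζ ^ 2)
    (hspow : s < (ζ / 2) ^ (k - 1)) {F : Fin t → Finset (Finset (Fin n))}
    (hF : ∀ i, F i ⊆ Finset.univ.powersetCard k)
    (hFcard : ∀ i, n.choose k < (F i).card + (n - t + 1).choose k)
    (hclose : isClose (FtEdges n k t) (Fedges n k t F) (s ^ 2)) :
    HasRainbowMatching F Finset.univ := by
  rcases le_or_gt (k ^ 3 * t) n with hsmall | hlarge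
  · exact hasRainbowMatching_of_card k (by omega) Finset.univ Finset.univ F (fun i _ => hF i)
      (by simpa using hsmall) (fun i _ => by simpa using hFcard i)
  have hk3 : k ≤ k ^ 3 := Nat.le_self_pow (by norm_num) k
  have hk0 : (3 : ℝ) ≤ k := by exact_mod_cast hk
  have hn0 : (0 : ℝ) < n := by exact_mod_cast (show 0 < n by omega)
  have hkt : k * t ≤ n := by
    have : (k : ℝ) * t ≤ n := by nlinarith
    exact_mod_cast this
  have ht48 : 48 ≤ t := by
    by_contra! h
    have : k ^ 3 * t ≤ k ^ 3 * 48 := Nat.mul_le_mul_left _ h.le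
    omega
  have h3t : 3 * t ≤ n := (Nat.mul_le_mul_right t hk).trans hkt
  obtain ⟨σ, hσ⟩ := hclose
  set u : ℝ := (k : ℝ) ^ 6 * s with hu
  have hu0 : 0 < u := by positivity
  have hu1 : 442368 * u ≤ 1 := by rw [hu, ← mul_assoc]; exact hsk
  have hp := card_crossing_le hk (by omega) ht48 h3t (by rw [mul_comm]; exact hlarge.le)
    (sq_nonneg s)
    (by
      calc 3456 * s ^ 2 * (k : ℝ) ^ 12 = 3456 * u ^ 2 := by rw [hu]; ring
        _ < 1 := by nlinarith) hσ
  set Y : Finset (Fin n) := Finset.univ.filter fun v => (σ.symm (Sum.inr v)).isLeft with hY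
  let g : Fin n → Fin n := fun v => (σ (Sum.inr v)).elim (fun _ => v) id
  have hg : ∀ v w, σ (Sum.inr v) = Sum.inr w → g v = w := fun v w h => by simp [g, h]
  set I : Finset (Fin t) := Finset.univ.filter fun i => (σ (Sum.inl i)).isLeft with hI
  set T : Finset (Fin n) := Finset.univ.filter fun v =>
    σ (Sum.inr v) = Sum.inr (g v) ∧ (g v : ℕ) < t with hT
  set W : Finset (Fin n) := Finset.univ.filter fun v =>
    σ (Sum.inr v) = Sum.inr (g v) ∧ ¬ (g v : ℕ) < t with hW
  have hTW : Disjoint T W := Finset.disjoint_left.2 fun v hv hw =>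
    (Finset.mem_filter.1 hw).2.2 (Finset.mem_filter.1 hv).2.2
  have hcov : ∀ w : Fin n, w ∉ Y → ∃ v, σ (Sum.inr v) = Sum.inr w := by
    intro w hw
    have : ¬ (σ.symm (Sum.inr w)).isLeft := fun h => hw (Finset.mem_filter.2 ⟨by simp, h⟩)
    obtain ⟨v, hv⟩ := Sum.isRight_iff.1 (Sum.not_isLeft.1 this)
    exact ⟨v, by rw [← hv, Equiv.apply_symm_apply]⟩
  have hIc : t ≤ I.card + Y.card := by
    have h1 : (Finset.univ.filter fun i : Fin t => (σ.symm (Sum.inl i)).isLeft).card + Y.card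
        = t := by
      simpa using card_filter_isLeft_perm σ.symm
    have h2 : (Finset.univ.filter fun i : Fin t => (σ.symm (Sum.inl i)).isLeft).card ≤ I.card := by
      refine (Finset.card_le_card (t := I.image fun i => (σ (Sum.inl i)).elim id fun _ => i)
        fun j hj => ?_).trans Finset.card_image_le
      obtain ⟨i, hi⟩ := Sum.isLeft_iff.1 (Finset.mem_filter.1 hj).2
      have hi' : σ (Sum.inl i) = Sum.inl j := by rw [← hi, Equiv.apply_symm_apply]
      exact Finset.mem_image.2 ⟨i, Finset.mem_filter.2 ⟨by simp, by simp [hi']⟩, by simp [hi']⟩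
    omega
  have hlt : (Finset.univ.filter fun v : Fin n => (v : ℕ) < t).card = t := by
    rw [Fin.card_filter_val_lt]; omega
  have hTc : t ≤ T.card + Y.card := by
    calc t = (Finset.univ.filter fun v : Fin n => (v : ℕ) < t).card := hlt.symm
      _ ≤ (T.image g ∪ Y).card := Finset.card_le_card fun w hw => by
        by_cases hwY : w ∈ Y
        · exact Finset.mem_union_right _ hwY
        obtain ⟨v, hv⟩ := hcov w hwY
        have hgv := hg v w hv
        exact Finset.mem_union_left _ (Finset.mem_image.2 ⟨v, Finset.mem_filter.2
          ⟨by simp, by rw [hgv]; exact ⟨hv, (Finset.mem_filter.1 hw).2⟩⟩, hgv⟩)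
      _ ≤ _ := (Finset.card_union_le _ _).trans (Nat.add_le_add_right Finset.card_image_le _)
  have hWc : n ≤ W.card + t + Y.card := by
    have h1 : (Finset.univ.filter fun v : Fin n => ¬ (v : ℕ) < t).card ≤ W.card + Y.card := by
      calc _ ≤ (W.image g ∪ Y).card := Finset.card_le_card fun w hw => by
            by_cases hwY : w ∈ Y
            · exact Finset.mem_union_right _ hwY
            obtain ⟨v, hv⟩ := hcov w hwY
            have hgv := hg v w hv
            exact Finset.mem_union_left _ (Finset.mem_image.2 ⟨v, Finset.mem_filter.2
              ⟨by simp, by rw [hgv]; exact ⟨hv, (Finset.mem_filter.1 hw).2⟩⟩, hgv⟩)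
        _ ≤ _ := (Finset.card_union_le _ _).trans (Nat.add_le_add_right Finset.card_image_le _)
    have h2 := Finset.card_filter_add_card_filter_not
      (s := (Finset.univ : Finset (Fin n))) fun v => (v : ℕ) < t
    rw [hlt, Finset.card_univ, Fintype.card_fin] at h2
    omega
  have hmiss : ((∑ i ∈ I, ∑ v ∈ T,
      ((W.powersetCard (k - 1)).filter fun A => insert v A ∉ F i).card : ℕ) : ℝ)
        ≤ s ^ 2 * t * n.choose k := by
    have h1 := sum_missing_le (k := k) (F := F) (I := I) (T := T) (W := W) (by omega)
      (fun i hi => (Finset.mem_filter.1 hi).2) (fun v hv => (Finset.mem_filter.1 hv).2)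
      (fun v hv => (Finset.mem_filter.1 hv).2.1) hTW
    calc _ ≤ ((FtEdges n k t \ (Fedges n k t F).image fun e => e.image σ).card : ℝ) := by
          exact_mod_cast h1
      _ ≤ s ^ 2 * (FtEdges n k t).card := hσ
      _ ≤ s ^ 2 * (t * n.choose k) := by gcongr; exact_mod_cast card_FtEdges_le
      _ = _ := by ring
  have hp' : (Y.card : ℝ) ≤ 8 * u * s * n := by
    calc (Y.card : ℝ) ≤ 8 * s ^ 2 * (k : ℝ) ^ 6 * n := hp
      _ = _ := by rw [hu]; ring
  refine hasRainbowMatching_of_few_missing (p := Y.card) (ζ := ζ) (s := s) hk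
    (by rw [Fintype.card_fin]; omega) hζ hs hF (by simpa using hFcard) (I := I) hTW
    (by simpa using hIc) (by simpa using hTc) (by simpa using hWc) (by simpa using hmiss)
    (by simpa using htn) ?_ ?_ hsζ ?_ hspow
  · rw [Fintype.card_fin]
    calc 16 * (Y.card : ℝ) ≤ 16 * (8 * u * s * n) := by gcongr
      _ = 128 * u * s * n := by ring
      _ ≤ ζ * n := by
        gcongr
        have : u * s ≤ 1 * s := by gcongr; linarith
        nlinarith
  · rw [Fintype.card_fin]
    have hk36 : (k : ℝ) ^ 3 ≤ (k : ℝ) ^ 6 := pow_le_pow_right₀ (by linarith) (by norm_num)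
    calc 8 * (k : ℝ) ^ 3 * Y.card ≤ 8 * (k : ℝ) ^ 6 * (8 * u * s * n) := by gcongr
      _ = 64 * u ^ 2 * n := by rw [hu]; ring
      _ ≤ 1 * n := by gcongr; nlinarith
      _ = n := one_mul _
  · rw [mul_assoc]; linarith

end Closeness

/-- Lemma 3.2 of the paper (the extremal case): under the stated numerical conditions,
if each `|F_i| > C(n,k) - C(n-t+1,k)` and `𝔉^t(k,n)` is `ε`-close to `𝔉_t(k,n)`, then
`𝔉^t(k,n)` has a matching of size `t`. -/
theorem stmt_4 (ζ ε : ℝ) (k t n : ℕ) (hk : 3 ≤ k) (hn0 : 1 ≤ n)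
    (hζ0 : 0 < ζ) (hζ1 : ζ < 1) (hε0 : 0 < ε) (hε1 : ε < 1)
    (htn : (t : ℝ) < (1 - ζ) * (1 - k * (k + 1) * Real.sqrt ε) * n / k)
    (hn : 48 * k ^ 3 ≤ n)
    (hεs : 2 ^ k * Real.sqrt ε < min ((((k : ℝ) + 1) * 24 ^ k * (k : ℝ) ^ (2 * k))⁻¹)
      (ζ ^ (k - 1) * (6 * (k : ℝ) ^ 2 * 2 ^ k * ((k - 1).factorial : ℝ))⁻¹))
    (F : Fin t → Finset (Finset (Fin n)))
    (hF : ∀ i, F i ⊆ Finset.univ.powersetCard k)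
    (hFcard : ∀ i, Nat.choose n k - Nat.choose (n - t + 1) k < (F i).card)
    (hclose : isClose (FtEdges n k t) (Fedges n k t F) ε) :
    ∃ M ⊆ Fedges n k t F, M.card = t ∧ ∀ e ∈ M, ∀ f ∈ M, e ≠ f → Disjoint e f := by
  set s := Real.sqrt ε with hs
  have hs0 : 0 < s := Real.sqrt_pos.2 hε0
  have hsε : s ^ 2 = ε := Real.sq_sqrt hε0.le
  have hk0 : (3 : ℝ) ≤ k := by exact_mod_cast hk
  have hkpos : (0 : ℝ) < k := by linarith
  have hn1 : (1 : ℝ) ≤ n := by exact_mod_cast hn0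
  have h2k : (8 : ℝ) ≤ 2 ^ k := by
    calc (8 : ℝ) = 2 ^ 3 := by norm_num
      _ ≤ 2 ^ k := pow_le_pow_right₀ (by norm_num) hk
  have hs1 : 442368 * (k : ℝ) ^ 6 * s ≤ 1 := by
    have h := hεs.trans_le (min_le_left _ _)
    rw [← one_div, lt_div_iff₀ (by positivity)] at h
    have h1 : (13824 : ℝ) ≤ 24 ^ k := by
      calc (13824 : ℝ) = 24 ^ 3 := by norm_num
        _ ≤ 24 ^ k := pow_le_pow_right₀ (by norm_num) hk
    have h2 : (k : ℝ) ^ 6 ≤ (k : ℝ) ^ (2 * k) := pow_le_pow_right₀ (by linarith) (by omega)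
    have h3 : 4 * 13824 * (k : ℝ) ^ 6 ≤ ((k : ℝ) + 1) * 24 ^ k * (k : ℝ) ^ (2 * k) := by
      gcongr; linarith
    calc 442368 * (k : ℝ) ^ 6 * s = 8 * s * (4 * 13824 * (k : ℝ) ^ 6) := by ring
      _ ≤ 2 ^ k * s * (((k : ℝ) + 1) * 24 ^ k * (k : ℝ) ^ (2 * k)) := by gcongr
      _ ≤ 1 := h.le
  have hs2 : 2 ^ k * s * 8 ≤ ζ ^ (k - 1) := by
    have h := hεs.trans_le (min_le_right _ _)
    have hf : (1 : ℝ) ≤ ((k - 1).factorial : ℝ) := by exact_mod_cast Nat.factorial_pos _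
    rw [← div_eq_mul_inv, lt_div_iff₀ (by positivity)] at h
    refine le_trans ?_ h.le
    gcongr
    calc (8 : ℝ) = 1 * 1 * 8 * 1 := by norm_num
      _ ≤ 6 * (k : ℝ) ^ 2 * 2 ^ k * ((k - 1).factorial : ℝ) := by
        gcongr
        · norm_num
        · nlinarith
  have hζ2 : ζ ^ (k - 1) ≤ ζ ^ 2 := pow_le_pow_of_le_one hζ0.le hζ1.le (by omega)
  refine exists_matching_of_hasRainbowMatching
    (hasRainbowMatching_of_isClose hk hn hζ0 hζ1 hs0 ?_ hs1 ?_ ?_ hF ?_ (by rwa [hsε]))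
  · rw [lt_div_iff₀ hkpos] at htn
    have h1 : (1 - ζ) * (1 - k * (k + 1) * s) * n ≤ (1 - ζ) * 1 * n := by
      gcongr
      · have : 0 < (k : ℝ) * (k + 1) * s := by positivity
        linarith
    linarith
  · nlinarith
  · rw [div_pow, lt_div_iff₀ (by positivity)]
    have h1 : (2 : ℝ) ^ (k - 1) ≤ 2 ^ k := pow_le_pow_right₀ (by norm_num) (by omega)
    have h2 : s * 2 ^ (k - 1) ≤ s * 2 ^ k := by gcongr
    have h3 : 0 < s * 2 ^ k := by positivity
    linarith
  · intro i
    have := hFcard i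
    omega
end
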